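/- Every Turing degree that is bounded by a 2-random Turing degree has a strong minimal cover; hence no such degree has the cupping property. -/

import Mathlib

/-
Common framework: oracle (relative) partial computability via codes,
Turing reducibility, the jump, Cantor-space measure, Martin-Löf randomness
and genericity relative to an oracle, Turing functionals.
-/

open scoped ENNReal

namespace TypicalDegree

/-- Codes for partial functions recursive in an oracle (Kleene-style),
    following `Nat.Partrec.Code` with an extra `oracle` constructor. -/
inductive OracleCode : Type
  | zero : OracleCode
  | succ : OracleCode
  | left : OracleCode
  | right : OracleCode
  | oracle : OracleCode
  | pair : OracleCode → OracleCode → OracleCode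
  | comp : OracleCode → OracleCode → OracleCode
  | prec : OracleCode → OracleCode → OracleCode
  | rfind' : OracleCode → OracleCode

/-- Evaluation of an oracle code relative to an oracle `g : ℕ →. ℕ`. -/
def OracleCode.eval (g : ℕ →. ℕ) : OracleCode → ℕ →. ℕ
  | .zero => pure 0
  | .succ => Nat.succ
  | .left => ↑fun n : ℕ => n.unpair.1
  | .right => ↑fun n : ℕ => n.unpair.2
  | .oracle => g
  | .pair cf cg => fun n => Nat.pair <$> OracleCode.eval g cf n <*> OracleCode.eval g cg n
  | .comp cf cg => fun n => OracleCode.eval g cg n >>= OracleCode.eval g cf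
  | .prec cf cg =>
    Nat.unpaired fun a n =>
      n.rec (OracleCode.eval g cf a) fun y IH => do
        let i ← IH
        OracleCode.eval g cg (Nat.pair a (Nat.pair y i))
  | .rfind' cf =>
    Nat.unpaired fun a m =>
      (Nat.rfind fun n => (fun m => m = 0) <$> OracleCode.eval g cf (Nat.pair a (n + m))).map
        (· + m)

/-- An effective injective numbering of oracle codes. -/
def OracleCode.encodeCode : OracleCode → ℕ
  | .zero => 0
  | .succ => 1
  | .left => 2
  | .right => 3
  | .oracle => 4
  | .pair cf cg => 4 * Nat.pair cf.encodeCode cg.encodeCode + 5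
  | .comp cf cg => 4 * Nat.pair cf.encodeCode cg.encodeCode + 6
  | .prec cf cg => 4 * Nat.pair cf.encodeCode cg.encodeCode + 7
  | .rfind' cf => 4 * Nat.pair cf.encodeCode cf.encodeCode + 8

/-- The characteristic (total) oracle of an element of Cantor space. -/
def chi (X : ℕ → Bool) : ℕ →. ℕ := fun n => Part.some (cond (X n) 1 0)

/-- `f` is partial recursive relative to the oracle `g`. -/
def RedIn (f g : ℕ →. ℕ) : Prop := ∃ c : OracleCode, c.eval g = f

/-- A total function `ℕ → ℕ` viewed as a partial function. -/
def natFun (f : ℕ → ℕ) : ℕ →. ℕ := fun n => Part.some (f n)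

/-- Turing reducibility between elements of Cantor space. -/
def TRed (X Y : ℕ → Bool) : Prop := RedIn (chi X) (chi Y)

/-- Turing equivalence. -/
def TEquiv (X Y : ℕ → Bool) : Prop := TRed X Y ∧ TRed Y X

/-- `X` is computable. -/
def ComputableSeq (X : ℕ → Bool) : Prop := TRed X fun _ => false

/-- `f : ℕ → ℕ` is computable. -/
def ComputableFun (f : ℕ → ℕ) : Prop := RedIn (natFun f) (chi fun _ => false)

/-- The Turing jump of `X`: the halting problem relative to `X`,
    under the numbering `encodeCode`. -/
noncomputable def jump (X : ℕ → Bool) : ℕ → Bool := fun n =>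
  @decide (∃ c : OracleCode, c.encodeCode = n ∧ (c.eval (chi X) n).Dom) (Classical.dec _)

/-- `∅'`, the halting problem. -/
noncomputable def zeroJump : ℕ → Bool := jump fun _ => false

/-- `X` extends the finite binary string `σ` (i.e. `σ ⊂ X`). -/
def extendsStr (X : ℕ → Bool) (σ : List Bool) : Prop :=
  ∀ i : Fin σ.length, X i.1 = σ.get i

/-- `⟦V⟧`: the open set of infinite sequences extending some string in `V`. -/
def openOf (V : Set (List Bool)) : Set (ℕ → Bool) := {X | ∃ σ ∈ V, extendsStr X σ}

/-- The (fair-coin) measure of the open set `⟦V⟧` determined by a set of strings `V`: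
    the supremum over `n` of the proportion of length-`n` strings with a prefix in `V`. -/
noncomputable def stringMeasure (V : Set (List Bool)) : ℝ≥0∞ :=
  ⨆ n : ℕ, (Nat.card {f : Fin n → Bool // ∃ σ ∈ V, σ <+: List.ofFn f} : ℝ≥0∞) / 2 ^ n

/-- The fair-coin (Lebesgue) measure on Cantor space, as the outer measure obtained from
    open coverings by sets of strings; it agrees with Lebesgue measure on measurable sets. -/
noncomputable def cantorMeasure (S : Set (ℕ → Bool)) : ℝ≥0∞ :=
  ⨅ (V : Set (List Bool)) (_ : S ⊆ openOf V), stringMeasure V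

/-- `W` is computably enumerable relative to `X`. -/
def CEIn (X : ℕ → Bool) (W : Set (List Bool)) : Prop :=
  ∃ c : OracleCode, ∀ σ : List Bool, σ ∈ W ↔ (c.eval (chi X) (Encodable.encode σ)).Dom

/-- `W` is computably enumerable. -/
def CE (W : Set (List Bool)) : Prop := CEIn (fun _ => false) W

/-- The c.e. set of strings with index `d`. -/
def ceSetOf (d : OracleCode) : Set (List Bool) :=
  {σ | (d.eval (chi fun _ => false) (Encodable.encode σ)).Dom}

/-- The sequence `V` of sets of strings is uniformly c.e. relative to `X`. -/
def UniformCEIn (X : ℕ → Bool) (V : ℕ → Set (List Bool)) : Prop :=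
  ∃ c : OracleCode, ∀ (i : ℕ) (σ : List Bool),
    σ ∈ V i ↔ (c.eval (chi X) (Nat.pair i (Encodable.encode σ))).Dom

/-- A Martin-Löf test relative to `X`. -/
def MLTest (X : ℕ → Bool) (V : ℕ → Set (List Bool)) : Prop :=
  UniformCEIn X V ∧ ∀ i : ℕ, stringMeasure (V i) < (2 : ℝ≥0∞)⁻¹ ^ i

/-- `Y` is Martin-Löf random relative to `X`. -/
def MLRandomIn (X Y : ℕ → Bool) : Prop :=
  ∀ V : ℕ → Set (List Bool), MLTest X V → ∃ i, Y ∉ openOf (V i)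

/-- `Y` is 1-random. -/
def OneRandom (Y : ℕ → Bool) : Prop := MLRandomIn (fun _ => false) Y

/-- `Y` is 2-random: Martin-Löf random relative to `∅'`. -/
def TwoRandom (Y : ℕ → Bool) : Prop := MLRandomIn zeroJump Y

/-- `Y` is weakly 2-random: it avoids every null `Π⁰₂` class
    (every null intersection of a uniformly c.e. sequence of open sets). -/
def Weak2Random (Y : ℕ → Bool) : Prop :=
  ∀ V : ℕ → Set (List Bool), UniformCEIn (fun _ => false) V →
    cantorMeasure (⋂ i, openOf (V i)) = 0 → Y ∉ ⋂ i, openOf (V i)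

/-- `Y` is 1-generic relative to `X`. -/
def OneGenericIn (X Y : ℕ → Bool) : Prop :=
  ∀ W : Set (List Bool), CEIn X W →
    ∃ σ : List Bool, extendsStr Y σ ∧ (σ ∈ W ∨ ∀ τ : List Bool, σ <+: τ → τ ∉ W)

/-- `Y` is 1-generic. -/
def OneGeneric (Y : ℕ → Bool) : Prop := OneGenericIn (fun _ => false) Y

/-- `Y` is 2-generic: 1-generic relative to `∅'`. -/
def TwoGeneric (Y : ℕ → Bool) : Prop := OneGenericIn zeroJump Y

/-- The Turing functional coded by `c` is total on oracle `X` with value `Y ∈ 2^ω`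
    (i.e. `Ψ^X = Y`). -/
def FTotal (c : OracleCode) (X : ℕ → Bool) (Y : ℕ → Bool) : Prop :=
  c.eval (chi X) = chi Y

/-- `Ψ^X ⊇ σ`: the output of the functional `c` on oracle `X` extends the string `σ`. -/
def FExtends (c : OracleCode) (X : ℕ → Bool) (σ : List Bool) : Prop :=
  ∀ i : Fin σ.length, c.eval (chi X) i.1 = Part.some (cond (σ.get i) 1 0)

/-- `π(Ψ,σ) = μ({X : Ψ^X ⊇ σ})`. -/
noncomputable def piMeasure (c : OracleCode) (σ : List Bool) : ℝ≥0∞ :=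
  cantorMeasure {X | FExtends c X σ}

/-- A Turing functional is special if every infinite binary sequence
    in its range is incomputable. -/
def Special (c : OracleCode) : Prop :=
  ∀ X Y : ℕ → Bool, FTotal c X Y → ¬ ComputableSeq Y

/-- The code `c` computes the total function `T` on strings (no oracle). -/
def ComputesFun (c : OracleCode) (T : List Bool → Bool) : Prop :=
  ∀ σ : List Bool, c.eval (chi fun _ => false) (Encodable.encode σ) = Part.some (cond (T σ) 1 0)

/-- `T` is (the characteristic function of) a tree: closed under prefixes. -/
def IsTree (T : List Bool → Bool) : Prop :=
  ∀ σ τ : List Bool, σ <+: τ → T τ = true → T σ = true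

/-- The set of infinite paths through the tree `T`; `Π⁰₁` classes are the
    sets of paths through computable trees. -/
def pathsOf (T : List Bool → Bool) : Set (ℕ → Bool) :=
  {X | ∀ n : ℕ, T (List.ofFn fun i : Fin n => X i.1) = true}

/-- The computable join `X ⊕ Y`. -/
def join (X Y : ℕ → Bool) : ℕ → Bool := fun n =>
  if n % 2 = 0 then X (n / 2) else Y (n / 2)

/-- A finite string used as a (partial) oracle. -/
def strOracle (τ : List Bool) : ℕ →. ℕ := fun n =>
  if h : n < τ.length then Part.some (cond (τ.get ⟨n, h⟩) 1 0) else Part.none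

/-- `Ψ^{τ₀}` and `Ψ^{τ₁}` are incompatible: they give different outputs somewhere. -/
def SplitPair (c : OracleCode) (τ₀ τ₁ : List Bool) : Prop :=
  ∃ (n v₀ v₁ : ℕ), v₀ ∈ c.eval (strOracle τ₀) n ∧ v₁ ∈ c.eval (strOracle τ₁) n ∧ v₀ ≠ v₁

/-- `(U,V)` is a `Ψ`-splitting above `τ`. -/
def SplittingAbove (c : OracleCode) (τ : List Bool) (U V : Finset (List Bool)) : Prop :=
  (∃ ℓ : ℕ, ∀ σ ∈ U ∪ V, σ.length = ℓ ∧ τ <+: σ) ∧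
    ∀ σ₀ ∈ U, ∀ σ₁ ∈ V, SplitPair c σ₀ σ₁

/-- The output sequence `Ψ^X` of the functional `c` on oracle `X`
    (defaults to `false` when not total). -/
noncomputable def outSeq (c : OracleCode) (X : ℕ → Bool) : ℕ → Bool := fun n =>
  @dite _ (∃ Y : ℕ → Bool, FTotal c X Y) (Classical.dec _) (fun h => h.choose n) fun _ => false

/-- `Ψ^X ↾ n`, as a finite string. -/
noncomputable def outStr (c : OracleCode) (X : ℕ → Bool) (n : ℕ) : List Bool :=
  List.ofFn fun i : Fin n => outSeq c X i.1

/-- The degree of `M` is a minimal Turing degree. -/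
def MinimalDeg (M : ℕ → Bool) : Prop :=
  ¬ ComputableSeq M ∧ ∀ Z : ℕ → Bool, TRed Z M → ComputableSeq Z ∨ TRed M Z


end TypicalDegree


namespace TypicalDegree

/-! ## Primitive recursive functions, automation -/

attribute [fun_prop] Primrec PrimrecPred

section Prim
variable {α β γ δ : Type*} [Primcodable α] [Primcodable β] [Primcodable γ] [Primcodable δ]

@[fun_prop] theorem prim_id : Primrec (fun x : α => x) := Primrec.id
@[fun_prop] theorem prim_const (c : β) : Primrec (fun _ : α => c) := Primrec.const c
@[fun_prop] theorem prim_comp (f : β → γ) (g : α → β) (hf : Primrec f) (hg : Primrec g) :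
    Primrec (fun x => f (g x)) := hf.comp hg
@[fun_prop] theorem prim_fst (g : α → β × γ) (hg : Primrec g) : Primrec (fun x => (g x).1) :=
  Primrec.fst.comp hg
@[fun_prop] theorem prim_snd (g : α → β × γ) (hg : Primrec g) : Primrec (fun x => (g x).2) :=
  Primrec.snd.comp hg
@[fun_prop] theorem prim_mk (f : α → β) (g : α → γ) (hf : Primrec f) (hg : Primrec g) :
    Primrec (fun x => (f x, g x)) := hf.pair hg
@[fun_prop] theorem prim_length (f : α → List β) (hf : Primrec f) :
    Primrec (fun x => (f x).length) := Primrec.list_length.comp hf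
@[fun_prop] theorem prim_append (f g : α → List β) (hf : Primrec f) (hg : Primrec g) :
    Primrec (fun x => f x ++ g x) := Primrec.list_append.comp hf hg
@[fun_prop] theorem prim_cons (f : α → β) (g : α → List β) (hf : Primrec f) (hg : Primrec g) :
    Primrec (fun x => f x :: g x) := Primrec.list_cons.comp hf hg
@[fun_prop] theorem prim_range (f : α → ℕ) (hf : Primrec f) :
    Primrec (fun x => List.range (f x)) := Primrec.list_range.comp hf
@[fun_prop] theorem prim_getElem? (f : α → List β) (g : α → ℕ) (hf : Primrec f) (hg : Primrec g) :
    Primrec (fun x => (f x)[g x]?) := Primrec.list_getElem?.comp hf hg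
@[fun_prop] theorem prim_take (f : α → List β) (g : α → ℕ) (hf : Primrec f) (hg : Primrec g) :
    Primrec (fun x => (f x).take (g x)) := Primrec.list_take.comp hg hf
@[fun_prop] theorem prim_some (f : α → β) (hf : Primrec f) :
    Primrec (fun x => some (f x)) := Primrec.option_some.comp hf
@[fun_prop] theorem prim_add (f g : α → ℕ) (hf : Primrec f) (hg : Primrec g) :
    Primrec (fun x => f x + g x) := Primrec.nat_add.comp hf hg
@[fun_prop] theorem prim_mul (f g : α → ℕ) (hf : Primrec f) (hg : Primrec g) :
    Primrec (fun x => f x * g x) := Primrec.nat_mul.comp hf hg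
@[fun_prop] theorem prim_div (f g : α → ℕ) (hf : Primrec f) (hg : Primrec g) :
    Primrec (fun x => f x / g x) := Primrec.nat_div.comp hf hg
@[fun_prop] theorem prim_mod (f g : α → ℕ) (hf : Primrec f) (hg : Primrec g) :
    Primrec (fun x => f x % g x) := Primrec.nat_mod.comp hf hg
@[fun_prop] theorem prim_natpair (f g : α → ℕ) (hf : Primrec f) (hg : Primrec g) :
    Primrec (fun x => Nat.pair (f x) (g x)) := Primrec₂.natPair.comp hf hg
@[fun_prop] theorem prim_unpair (f : α → ℕ) (hf : Primrec f) :
    Primrec (fun x => Nat.unpair (f x)) := Primrec.unpair.comp hf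
@[fun_prop] theorem prim_encode (f : α → β) (hf : Primrec f) :
    Primrec (fun x => Encodable.encode (f x)) := Primrec.encode.comp hf
@[fun_prop] theorem prim_decode (f : α → ℕ) (hf : Primrec f) :
    Primrec (fun x => (Encodable.decode (f x) : Option β)) := Primrec.decode.comp hf
@[fun_prop] theorem prim_cond (f : α → Bool) (g h : α → β) (hf : Primrec f) (hg : Primrec g)
    (hh : Primrec h) : Primrec (fun x => cond (f x) (g x) (h x)) := Primrec.cond hf hg hh
@[fun_prop] theorem prim_two_pow (f : α → ℕ) (hf : Primrec f) : Primrec (fun x => 2 ^ (f x)) := by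
  have : Primrec (fun n : ℕ => 2 ^ n) := by
    have h := Primrec.nat_rec₁ (f := fun _ r => r * 2) 1
      (Primrec.nat_mul.comp Primrec.snd (Primrec.const 2))
    refine h.of_eq fun n => ?_
    induction n with
    | zero => rfl
    | succ n ih => simp only [pow_succ, ← ih]
  exact this.comp hf
@[fun_prop] theorem prim_decide (p : α → Prop) [DecidablePred p] (hp : PrimrecPred p) :
    Primrec (fun x => decide (p x)) := hp.decide
@[fun_prop] theorem prim_getD (f : α → Option β) (g : α → β) (hf : Primrec f) (hg : Primrec g) :
    Primrec (fun x => (f x).getD (g x)) := Primrec.option_getD.comp hf hg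
@[fun_prop] theorem prim_replicate (f : α → ℕ) (g : α → β) (hf : Primrec f) (hg : Primrec g) :
    Primrec (fun x => List.replicate (f x) (g x)) := by
  have : Primrec (fun x => (List.range (f x)).map (fun _ => g x)) :=
    Primrec.list_map (Primrec.list_range.comp hf) (hg.comp Primrec.fst).to₂
  refine this.of_eq fun x => ?_
  simp

@[fun_prop] theorem pp_comp (p : β → Prop) (g : α → β) (hp : PrimrecPred p) (hg : Primrec g) :
    PrimrecPred (fun x => p (g x)) := hp.comp hg
@[fun_prop] theorem pp_const (p : Prop) : PrimrecPred (fun _ : α => p) := by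
  classical
  exact ⟨fun _ => Classical.dec p, Primrec.const _⟩
@[fun_prop] theorem pp_and (p q : α → Prop) (hp : PrimrecPred p) (hq : PrimrecPred q) :
    PrimrecPred (fun x => p x ∧ q x) := hp.and hq
@[fun_prop] theorem pp_or (p q : α → Prop) (hp : PrimrecPred p) (hq : PrimrecPred q) :
    PrimrecPred (fun x => p x ∨ q x) := hp.or hq
@[fun_prop] theorem pp_not (p : α → Prop) (hp : PrimrecPred p) :
    PrimrecPred (fun x => ¬ p x) := hp.not
theorem pp_imp (p q : α → Prop) (hp : PrimrecPred p) (hq : PrimrecPred q) :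
    PrimrecPred (fun x => p x → q x) :=
  (hp.not.or hq).of_eq fun x => by tauto
@[fun_prop] theorem pp_eq (f g : α → β) (hf : Primrec f) (hg : Primrec g) :
    PrimrecPred (fun x => f x = g x) := Primrec.eq.comp hf hg
@[fun_prop] theorem pp_lt (f g : α → ℕ) (hf : Primrec f) (hg : Primrec g) :
    PrimrecPred (fun x => f x < g x) := Primrec.nat_lt.comp hf hg
@[fun_prop] theorem pp_le (f g : α → ℕ) (hf : Primrec f) (hg : Primrec g) :
    PrimrecPred (fun x => f x ≤ g x) := Primrec.nat_le.comp hf hg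
@[fun_prop] theorem pp_pfx (f g : α → List β) (hf : Primrec f) (hg : Primrec g) :
    PrimrecPred (fun x => f x <+: g x) := by
  have : PrimrecPred (fun x => f x = (g x).take (f x).length) := by fun_prop
  exact this.of_eq fun x => (List.prefix_iff_eq_take).symm
@[fun_prop] theorem pp_mem (f : α → β) (g : α → List β) (hf : Primrec f) (hg : Primrec g) :
    PrimrecPred (fun x => f x ∈ g x) := by
  have h : PrimrecRel (fun (l : List β) (b : β) => ∃ a ∈ l, a = b) :=
    PrimrecRel.exists_mem_list Primrec.eq
  refine (h.comp hg hf).of_eq fun x => ?_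
  simp
@[fun_prop] theorem pp_ball (l : α → List β) (p : α → β → Prop) (hl : Primrec l)
    (hp : PrimrecPred (fun x : α × β => p x.1 x.2)) :
    PrimrecPred (fun a => ∀ b ∈ l a, p a b) := by
  have h : PrimrecRel (fun (l : List β) (a : α) => ∀ b ∈ l, p a b) :=
    PrimrecRel.forall_mem_list (R := fun b a => p a b)
      (hp.comp (Primrec.snd.pair Primrec.fst))
  exact h.comp hl Primrec.id
@[fun_prop] theorem pp_bex (l : α → List β) (p : α → β → Prop) (hl : Primrec l)
    (hp : PrimrecPred (fun x : α × β => p x.1 x.2)) :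
    PrimrecPred (fun a => ∃ b ∈ l a, p a b) := by
  have h : PrimrecRel (fun (l : List β) (a : α) => ∃ b ∈ l, p a b) :=
    PrimrecRel.exists_mem_list (R := fun b a => p a b)
      (hp.comp (Primrec.snd.pair Primrec.fst))
  exact h.comp hl Primrec.id
theorem pp_ball_lt (f : α → ℕ) (p : α → ℕ → Prop) (hf : Primrec f)
    (hp : PrimrecPred (fun x : α × ℕ => p x.1 x.2)) :
    PrimrecPred (fun a => ∀ i < f a, p a i) := by
  refine (pp_ball (fun a => List.range (f a)) p (by fun_prop) hp).of_eq fun a => ?_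
  simp
theorem pp_bex_lt (f : α → ℕ) (p : α → ℕ → Prop) (hf : Primrec f)
    (hp : PrimrecPred (fun x : α × ℕ => p x.1 x.2)) :
    PrimrecPred (fun a => ∃ i < f a, p a i) := by
  refine (pp_bex (fun a => List.range (f a)) p (by fun_prop) hp).of_eq fun a => ?_
  simp

end Prim

/-! ## Semirecursive predicates -/

/-- Semirecursive (r.e.) predicate, in primitive recursive normal form. -/
@[fun_prop] def SRE {α : Type*} [Primcodable α] (p : α → Prop) : Prop :=
  ∃ q : α × ℕ → Prop, PrimrecPred q ∧ ∀ a, p a ↔ ∃ n, q (a, n)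

section SREs
variable {α β γ δ : Type*} [Primcodable α] [Primcodable β] [Primcodable γ] [Primcodable δ]

theorem SRE.of_iff {p q : α → Prop} (hp : SRE p) (h : ∀ a, q a ↔ p a) : SRE q := by
  obtain ⟨r, hr, hrp⟩ := hp
  exact ⟨r, hr, fun a => (h a).trans (hrp a)⟩

@[fun_prop] theorem sre_of_pp (p : α → Prop) (hp : PrimrecPred p) : SRE p :=
  ⟨fun x => p x.1, by fun_prop, fun a => by simp⟩

@[fun_prop] theorem sre_comp (p : β → Prop) (g : α → β) (hp : SRE p) (hg : Primrec g) :
    SRE (fun x => p (g x)) := by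
  obtain ⟨r, hr, hrp⟩ := hp
  exact ⟨fun x => r (g x.1, x.2), by fun_prop, fun a => hrp _⟩

@[fun_prop] theorem sre_ex (p : α → β → Prop) (hp : SRE (fun x : α × β => p x.1 x.2)) :
    SRE (fun a => ∃ b, p a b) := by
  obtain ⟨r, hr, hrp⟩ := hp
  classical
  refine ⟨fun x => ∃ b ∈ (Encodable.decode x.2.unpair.1 : Option β).toList,
    r ((x.1, b), x.2.unpair.2), ?_, fun a => ?_⟩
  · have : Primrec (fun x : α × ℕ => (Encodable.decode x.2.unpair.1 : Option β).toList) := by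
      have h : Primrec (fun x : α × ℕ => (Encodable.decode x.2.unpair.1 : Option β)) := by fun_prop
      have := Primrec.option_casesOn (o := fun x : α × ℕ =>
        (Encodable.decode x.2.unpair.1 : Option β)) (f := fun _ => ([] : List β))
        (g := fun _ b => [b]) h (Primrec.const _)
        (Primrec.list_cons.comp Primrec.snd (Primrec.const []))
      refine this.of_eq fun x => ?_
      cases (Encodable.decode x.2.unpair.1 : Option β) <;> rfl
    fun_prop
  · constructor
    · rintro ⟨b, hb⟩
      obtain ⟨n, hn⟩ := (hrp (a, b)).1 hb
      exact ⟨Nat.pair (Encodable.encode b) n, b, by simp, by simpa using hn⟩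
    · rintro ⟨n, b, -, hb⟩
      exact ⟨b, (hrp (a, b)).2 ⟨_, hb⟩⟩

@[fun_prop] theorem sre_and (p q : α → Prop) (hp : SRE p) (hq : SRE q) :
    SRE (fun x => p x ∧ q x) := by
  obtain ⟨r, hr, hrp⟩ := hp
  obtain ⟨s, hs, hsq⟩ := hq
  have : SRE (fun a => ∃ n : ℕ × ℕ, r (a, n.1) ∧ s (a, n.2)) :=
    sre_ex _ (sre_of_pp _ (by fun_prop))
  refine this.of_iff fun a => ?_
  rw [hrp, hsq]
  constructor
  · rintro ⟨⟨n, hn⟩, m, hm⟩; exact ⟨(n, m), hn, hm⟩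
  · rintro ⟨⟨n, m⟩, hn, hm⟩; exact ⟨⟨n, hn⟩, m, hm⟩

@[fun_prop] theorem sre_or (p q : α → Prop) (hp : SRE p) (hq : SRE q) :
    SRE (fun x => p x ∨ q x) := by
  obtain ⟨r, hr, hrp⟩ := hp
  obtain ⟨s, hs, hsq⟩ := hq
  have : SRE (fun a => ∃ n : ℕ, r (a, n) ∨ s (a, n)) :=
    sre_ex _ (sre_of_pp _ (by fun_prop))
  refine this.of_iff fun a => ?_
  rw [hrp, hsq, exists_or]

/-- Monotone normal form. -/
theorem SRE.mono {p : α → Prop} (hp : SRE p) : ∃ q : α × ℕ → Prop, PrimrecPred q ∧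
    (∀ a, p a ↔ ∃ n, q (a, n)) ∧ ∀ a n m, n ≤ m → q (a, n) → q (a, m) := by
  obtain ⟨r, hr, hrp⟩ := hp
  refine ⟨fun x => ∃ i < x.2 + 1, r (x.1, i), ?_, fun a => ?_, ?_⟩
  · exact pp_bex_lt (fun x : α × ℕ => x.2 + 1) (fun x i => r (x.1, i)) (by fun_prop)
      (by fun_prop)
  · rw [hrp]
    constructor
    · rintro ⟨n, hn⟩; exact ⟨n, n, by simp, hn⟩
    · rintro ⟨n, i, -, hi⟩; exact ⟨i, hi⟩
  · rintro a n m hnm ⟨i, hi, h⟩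
    exact ⟨i, by simp only at *; omega, h⟩

@[fun_prop] theorem sre_ball (l : α → List β) (p : α → β → Prop) (hl : Primrec l)
    (hp : SRE (fun x : α × β => p x.1 x.2)) : SRE (fun a => ∀ b ∈ l a, p a b) := by
  obtain ⟨r, hr, hrp, hm⟩ := hp.mono
  have : PrimrecPred (fun x : α × ℕ => ∀ b ∈ l x.1, r ((x.1, b), x.2)) := by fun_prop
  refine ⟨_, this, fun a => ⟨fun h => ?_, ?_⟩⟩
  · have h' : ∀ b ∈ l a, ∃ n, r ((a, b), n) := fun b hb => (hrp (a, b)).1 (h b hb)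
    show ∃ n, ∀ b ∈ l a, r ((a, b), n)
    clear h this
    generalize l a = L at h' ⊢
    induction L with
    | nil => exact ⟨0, by simp⟩
    | cons b L ih =>
      obtain ⟨n, hn⟩ := ih fun c hc => h' c (List.mem_cons_of_mem _ hc)
      obtain ⟨k, hk⟩ := h' b (by simp)
      refine ⟨max n k, fun c hc => ?_⟩
      rcases List.mem_cons.1 hc with rfl | hc
      · exact hm _ _ _ (le_max_right _ _) hk
      · exact hm _ _ _ (le_max_left _ _) (hn c hc)
  · rintro ⟨n, hn⟩ b hb
    exact (hrp (a, b)).2 ⟨n, hn b hb⟩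

theorem sre_ball_lt (f : α → ℕ) (p : α → ℕ → Prop) (hf : Primrec f)
    (hp : SRE (fun x : α × ℕ => p x.1 x.2)) : SRE (fun a => ∀ i < f a, p a i) := by
  refine (sre_ball (fun a => List.range (f a)) p (by fun_prop) hp).of_iff fun a => ?_
  simp

/-- Uniformization of semirecursive relations. -/
theorem SRE.uniformize {p : α → β → Prop} (hp : SRE (fun x : α × β => p x.1 x.2)) :
    ∃ s : α → β → Prop, SRE (fun x : α × β => s x.1 x.2) ∧ (∀ a b, s a b → p a b) ∧
      (∀ a b b', s a b → s a b' → b = b') ∧ (∀ a b, p a b → ∃ b', s a b') := by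
  obtain ⟨r, hr, hrp⟩ := hp
  classical
  let Q : (α × ℕ) → Prop := fun x => ∃ b, Encodable.decode x.2.unpair.1 = some b ∧
    r ((x.1, b), x.2.unpair.2)
  have hQ : PrimrecPred Q := by
    have h : Primrec (fun x : α × ℕ => (Encodable.decode x.2.unpair.1 : Option β)) := by fun_prop
    have := Primrec.option_casesOn (o := fun x : α × ℕ =>
      (Encodable.decode x.2.unpair.1 : Option β)) (f := fun _ => false)
      (g := fun x b => decide (r ((x.1, b), x.2.unpair.2))) h (Primrec.const _)
      (by
        show Primrec (fun y : (α × ℕ) × β => decide (r ((y.1.1, y.2), y.1.2.unpair.2)))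
        fun_prop)
    refine ⟨fun _ => Classical.dec _, this.of_eq fun x => ?_⟩
    cases h : (Encodable.decode x.2.unpair.1 : Option β) <;> simp [Q, h]
  have hmin : PrimrecPred (fun x : α × ℕ => ∀ i < x.2, ¬ Q (x.1, i)) :=
    pp_ball_lt (fun x : α × ℕ => x.2) (fun x i => ¬ Q (x.1, i)) (by fun_prop) (by fun_prop)
  refine ⟨fun a b => ∃ t : ℕ, (Encodable.decode t.unpair.1 = some b ∧
    r ((a, b), t.unpair.2)) ∧ ∀ i < t, ¬ Q (a, i), ?_, ?_, ?_, ?_⟩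
  · have h2 : PrimrecPred (fun y : (α × β) × ℕ => ∀ i < y.2, ¬ Q (y.1.1, i)) :=
      hmin.comp (f := fun y : (α × β) × ℕ => (y.1.1, y.2)) (by fun_prop)
    apply sre_ex (fun (x : α × β) (t : ℕ) => (Encodable.decode t.unpair.1 = some x.2 ∧
      r ((x.1, x.2), t.unpair.2)) ∧ ∀ i < t, ¬ Q (x.1, i))
    apply sre_of_pp
    apply PrimrecPred.and _ h2
    fun_prop
  · rintro a b ⟨t, ⟨-, h⟩, -⟩
    exact (hrp (a, b)).2 ⟨_, h⟩
  · rintro a b b' ⟨t, ⟨h1, h2⟩, h3⟩ ⟨t', ⟨h1', h2'⟩, h3'⟩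
    rcases lt_trichotomy t t' with h | rfl | h
    · exact absurd ⟨b, h1, h2⟩ (h3' t h)
    · rw [h1] at h1'; exact Option.some.inj h1'
    · exact absurd ⟨b', h1', h2'⟩ (h3 t' h)
  · intro a b hab
    obtain ⟨n, hn⟩ := (hrp (a, b)).1 hab
    have hex : ∃ t, Q (a, t) := ⟨Nat.pair (Encodable.encode b) n, b, by simp, by simpa using hn⟩
    obtain ⟨b', hb'⟩ := Nat.find_spec hex
    exact ⟨b', Nat.find hex, hb', fun i hi => Nat.find_min hex hi⟩

/-- Chain characterization of reflexive transitive closure. -/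
theorem rtg_iff_list {α : Type*} (r : α → α → Prop) (a b : α) : Relation.ReflTransGen r a b ↔
    ∃ l : List α, l[0]? = some a ∧ l[l.length - 1]? = some b ∧
      ∀ i < l.length - 1, ∃ x y, l[i]? = some x ∧ l[i+1]? = some y ∧ r x y := by
  constructor
  · intro h
    induction h with
    | refl => exact ⟨[a], by simp⟩
    | @tail b c hab hbc ih =>
      obtain ⟨l, h0, h1, h2⟩ := ih
      have hl : 0 < l.length := by
        rcases l with _ | _
        · simp at h0
        · simp
      refine ⟨l ++ [c], ?_, ?_, ?_⟩
      · rw [List.getElem?_append_left hl, h0]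
      · simp
      · intro i hi
        simp only [List.length_append, List.length_singleton, Nat.add_sub_cancel] at hi
        rcases Nat.lt_or_ge i (l.length - 1) with hi' | hi'
        · obtain ⟨x, y, hx, hy, hr⟩ := h2 i hi'
          refine ⟨x, y, ?_, ?_, hr⟩
          · rw [List.getElem?_append_left hi, hx]
          · rw [List.getElem?_append_left (by omega), hy]
        · have : i = l.length - 1 := by omega
          subst this
          refine ⟨b, c, ?_, ?_, hbc⟩
          · rw [List.getElem?_append_left hi, h1]
          · rw [List.getElem?_append_right (by omega)]
            have : l.length - 1 + 1 - l.length = 0 := by omega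
            simp [this]
  · rintro ⟨l, h0, h1, h2⟩
    have key : ∀ i x, i ≤ l.length - 1 → l[i]? = some x → Relation.ReflTransGen r a x := by
      intro i
      induction i with
      | zero => intro x _ hx; rw [h0] at hx; cases hx; exact .refl
      | succ i ih =>
        intro x hi hx
        obtain ⟨u, v, hu, hv, hr⟩ := h2 i (by omega)
        rw [hx] at hv; cases hv
        exact (ih u (by omega) hu).tail hr
    exact key _ _ le_rfl h1

theorem sre_rtg (r : α → β → β → Prop) (hr : SRE (fun x : α × β × β => r x.1 x.2.1 x.2.2)) :
    SRE (fun x : α × β × β => Relation.ReflTransGen (r x.1) x.2.1 x.2.2) := by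
  have h1 : SRE (fun x : (α × β × β) × List β => ∀ i < x.2.length - 1,
      ∃ u v, x.2[i]? = some u ∧ x.2[i+1]? = some v ∧ r x.1.1 u v) := by
    refine sre_ball_lt (fun x : (α × β × β) × List β => x.2.length - 1)
      (fun x i => ∃ u v, x.2[i]? = some u ∧ x.2[i+1]? = some v ∧ r x.1.1 u v)
      (Primrec.nat_sub.comp (by fun_prop) (by fun_prop)) ?_
    have : SRE (fun y : (((((α × β × β) × List β) × ℕ) × β) × β) => r y.1.1.1.1.1 y.1.2 y.2) :=
      sre_comp _ (fun y : (((((α × β × β) × List β) × ℕ) × β) × β) => (y.1.1.1.1.1, y.1.2, y.2)) hr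
        (by fun_prop)
    fun_prop
  have h3 : Primrec (fun x : (α × β × β) × List β => x.2.length - 1) :=
    Primrec.nat_sub.comp (by fun_prop) (by fun_prop)
  have h2 := sre_ex (fun (x : α × β × β) (l : List β) => l[0]? = some x.2.1 ∧
    l[l.length - 1]? = some x.2.2 ∧ ∀ i < l.length - 1,
      ∃ u v, l[i]? = some u ∧ l[i+1]? = some v ∧ r x.1 u v) (by fun_prop)
  exact h2.of_iff fun x => rtg_iff_list _ _ _

/-- The graph of a partial recursive function is semirecursive. -/
theorem sre_graph {f : α →. β} (hf : Partrec f) : SRE (fun x : α × β => x.2 ∈ f x.1) := by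
  have hf' : Nat.Partrec fun n => Part.bind (Encodable.decode (α := α) n : Part α)
    fun a => (f a).map Encodable.encode := hf
  obtain ⟨c, hc⟩ := Nat.Partrec.Code.exists_code.1 hf'
  refine ⟨fun x => Encodable.encode x.1.2 ∈
    Nat.Partrec.Code.evaln x.2 c (Encodable.encode x.1.1), ?_, fun x => ?_⟩
  · have h := Nat.Partrec.Code.primrec_evaln.comp (g := fun x : (α × β) × ℕ =>
      ((x.2, c), Encodable.encode x.1.1)) (by fun_prop)
    have : PrimrecPred (fun x : (α × β) × ℕ =>
      Nat.Partrec.Code.evaln x.2 c (Encodable.encode x.1.1) = some (Encodable.encode x.1.2)) :=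
      Primrec.eq.comp h (by fun_prop)
    exact this
  · show x.2 ∈ f x.1 ↔ ∃ n, Encodable.encode x.2 ∈
      Nat.Partrec.Code.evaln n c (Encodable.encode x.1)
    rw [← Nat.Partrec.Code.evaln_complete, hc]
    simp

end SREs

end TypicalDegree


namespace TypicalDegree

/-! ## Oracle computations -/

theorem pfx_get {α : Type*} {l l' : List α} (h : l <+: l') {i : ℕ} {a : α} (ha : l[i]? = some a) :
    l'[i]? = some a := by
  obtain ⟨t, rfl⟩ := h
  rw [List.getElem?_append_left (List.getElem?_eq_some_iff.1 ha).1, ha]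

/-- Restriction of a sequence to its first `k` bits. -/
def pre (X : ℕ → Bool) (k : ℕ) : List Bool := (List.range k).map X

@[simp] theorem pre_length (X : ℕ → Bool) (k : ℕ) : (pre X k).length = k := by simp [pre]

theorem pre_getElem? (X : ℕ → Bool) (k i : ℕ) :
    (pre X k)[i]? = if i < k then some (X i) else none := by
  unfold pre
  split_ifs with h
  · simp [h]
  · simp [h]

theorem pre_getElem?_of_lt (X : ℕ → Bool) {k i : ℕ} (h : i < k) : (pre X k)[i]? = some (X i) := by
  rw [pre_getElem?, if_pos h]

theorem pre_take (X : ℕ → Bool) {k l : ℕ} (h : k ≤ l) : (pre X l).take k = pre X k := by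
  apply List.ext_getElem?
  intro i
  rw [List.getElem?_take, pre_getElem?, pre_getElem?]
  split_ifs <;> first | rfl | omega

theorem pre_pfx (X : ℕ → Bool) {k l : ℕ} (h : k ≤ l) : pre X k <+: pre X l := by
  rw [← pre_take X h]; exact List.take_prefix _ _

theorem pre_succ (X : ℕ → Bool) (k : ℕ) : pre X (k + 1) = pre X k ++ [X k] := by
  simp [pre, List.range_succ]

theorem prefix_pre_iff (X : ℕ → Bool) (w : List Bool) (k : ℕ) :
    w <+: pre X k ↔ w = pre X w.length ∧ w.length ≤ k := by
  constructor
  · intro h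
    have hl : w.length ≤ k := by simpa using h.length_le
    refine ⟨?_, hl⟩
    rw [List.prefix_iff_eq_take] at h
    rwa [pre_take X hl] at h
  · rintro ⟨h1, h2⟩
    rw [h1]; exact pre_pfx X h2

theorem pre_eq_iff (X : ℕ → Bool) (w : List Bool) :
    w = pre X w.length ↔ ∀ i b, w[i]? = some b → b = X i := by
  constructor
  · intro h i b hb
    rw [h, pre_getElem?] at hb
    split_ifs at hb
    exact (Option.some.inj hb).symm
  · intro h
    apply List.ext_getElem?
    intro i
    rw [pre_getElem?]
    split_ifs with hi
    · rw [List.getElem?_eq_getElem hi]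
      exact congrArg some (h i _ (List.getElem?_eq_getElem hi))
    · rw [List.getElem?_eq_none]; omega

theorem extendsStr_iff (X : ℕ → Bool) (w : List Bool) : extendsStr X w ↔ w = pre X w.length := by
  rw [pre_eq_iff]
  unfold extendsStr
  constructor
  · intro h i b hb
    obtain ⟨hi, rfl⟩ := List.getElem?_eq_some_iff.1 hb
    exact (h ⟨i, hi⟩).symm
  · intro h i
    exact (h i.1 _ (by simp)).symm

section eval
variable (g : ℕ →. ℕ)

theorem mem_eval_pair (cf cg : OracleCode) (n v : ℕ) : v ∈ (OracleCode.pair cf cg).eval g n ↔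
    ∃ a ∈ cf.eval g n, ∃ b ∈ cg.eval g n, Nat.pair a b = v := by
  simp [OracleCode.eval, Seq.seq]

theorem mem_eval_comp (cf cg : OracleCode) (n v : ℕ) : v ∈ (OracleCode.comp cf cg).eval g n ↔
    ∃ a ∈ cg.eval g n, v ∈ cf.eval g a := Part.mem_bind_iff

theorem mem_eval_prec_zero (cf cg : OracleCode) (a v : ℕ) :
    v ∈ (OracleCode.prec cf cg).eval g (Nat.pair a 0) ↔ v ∈ cf.eval g a := by
  simp [OracleCode.eval]

theorem mem_eval_prec_succ (cf cg : OracleCode) (a n v : ℕ) :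
    v ∈ (OracleCode.prec cf cg).eval g (Nat.pair a (n+1)) ↔
    ∃ i ∈ (OracleCode.prec cf cg).eval g (Nat.pair a n),
      v ∈ cg.eval g (Nat.pair a (Nat.pair n i)) := by
  simp [OracleCode.eval]

theorem mem_eval_rfind (cf : OracleCode) (a m v : ℕ) :
    v ∈ (OracleCode.rfind' cf).eval g (Nat.pair a m) ↔
    ∃ k, k + m = v ∧ 0 ∈ cf.eval g (Nat.pair a (k + m)) ∧
      ∀ j < k, ∃ w ∈ cf.eval g (Nat.pair a (j + m)), w ≠ 0 := by
  have h : v ∈ (OracleCode.rfind' cf).eval g (Nat.pair a m) ↔ ∃ k, ((true ∈ (fun m =>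
      decide (m = 0)) <$> OracleCode.eval g cf (Nat.pair a (k + m))) ∧ ∀ {j : ℕ}, j < k →
      false ∈ (fun m => decide (m = 0)) <$> OracleCode.eval g cf (Nat.pair a (j + m))) ∧
      k + m = v := by
    simp only [OracleCode.eval, Nat.unpaired, Nat.unpair_pair, Part.mem_map_iff]
    exact exists_congr fun k => and_congr_left fun _ => Nat.mem_rfind
  rw [h]
  constructor
  · rintro ⟨k, ⟨h1, h2⟩, rfl⟩
    refine ⟨k, rfl, by simpa using h1, fun j hj => ?_⟩
    have := h2 hj
    simpa [and_comm] using this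
  · rintro ⟨k, rfl, h1, h2⟩
    refine ⟨k, ⟨by simpa using h1, fun {j} hj => ?_⟩, rfl⟩
    simpa [and_comm] using h2 j hj

end eval

/-- Continuity of evaluation in the oracle. -/
theorem eval_mono {g g' : ℕ →. ℕ} (h : ∀ n v, v ∈ g n → v ∈ g' n) (c : OracleCode) :
    ∀ n v, v ∈ c.eval g n → v ∈ c.eval g' n := by
  induction c with
  | zero => exact fun n v h => h
  | succ => exact fun n v h => h
  | left => exact fun n v h => h
  | right => exact fun n v h => h
  | oracle => exact h
  | pair cf cg ihf ihg =>
    intro n v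
    rw [mem_eval_pair, mem_eval_pair]
    rintro ⟨a, ha, b, hb, rfl⟩
    exact ⟨a, ihf _ _ ha, b, ihg _ _ hb, rfl⟩
  | comp cf cg ihf ihg =>
    intro n v
    rw [mem_eval_comp, mem_eval_comp]
    rintro ⟨a, ha, hb⟩
    exact ⟨a, ihg _ _ ha, ihf _ _ hb⟩
  | prec cf cg ihf ihg =>
    intro n v
    obtain ⟨⟨a, n⟩, rfl⟩ : ∃ p : ℕ × ℕ, Nat.pair p.1 p.2 = n := ⟨n.unpair, by simp⟩
    dsimp only
    induction n generalizing v with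
    | zero => rw [mem_eval_prec_zero, mem_eval_prec_zero]; exact ihf _ _
    | succ n ih =>
      rw [mem_eval_prec_succ, mem_eval_prec_succ]
      rintro ⟨i, hi, hv⟩
      exact ⟨i, ih _ hi, ihg _ _ hv⟩
  | rfind' cf ih =>
    intro n v
    obtain ⟨⟨a, n⟩, rfl⟩ : ∃ p : ℕ × ℕ, Nat.pair p.1 p.2 = n := ⟨n.unpair, by simp⟩
    rw [mem_eval_rfind, mem_eval_rfind]
    rintro ⟨k, hk, h0, h1⟩
    refine ⟨k, hk, ih _ _ h0, fun j hj => ?_⟩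
    obtain ⟨w, hw, hw0⟩ := h1 j hj
    exact ⟨w, ih _ _ hw, hw0⟩

theorem eval_cont {g : ℕ →. ℕ} (G : ℕ → ℕ →. ℕ) (hG : ∀ k l, k ≤ l → ∀ n v, v ∈ G k n → v ∈ G l n)
    (h : ∀ n v, v ∈ g n → ∃ k, v ∈ G k n) (c : OracleCode) :
    ∀ n v, v ∈ c.eval g n → ∃ k, v ∈ c.eval (G k) n := by
  have up : ∀ (c : OracleCode) k l, k ≤ l → ∀ n v, v ∈ c.eval (G k) n → v ∈ c.eval (G l) n :=
    fun c k l hkl => eval_mono (hG k l hkl) c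
  induction c with
  | zero => exact fun n v h => ⟨0, h⟩
  | succ => exact fun n v h => ⟨0, h⟩
  | left => exact fun n v h => ⟨0, h⟩
  | right => exact fun n v h => ⟨0, h⟩
  | oracle => exact h
  | pair cf cg ihf ihg =>
    intro n v
    rw [mem_eval_pair]
    rintro ⟨a, ha, b, hb, rfl⟩
    obtain ⟨k, hk⟩ := ihf _ _ ha
    obtain ⟨l, hl⟩ := ihg _ _ hb
    refine ⟨max k l, ?_⟩
    rw [mem_eval_pair]
    exact ⟨a, up _ _ _ (le_max_left _ _) _ _ hk, b, up _ _ _ (le_max_right _ _) _ _ hl, rfl⟩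
  | comp cf cg ihf ihg =>
    intro n v
    rw [mem_eval_comp]
    rintro ⟨a, ha, hb⟩
    obtain ⟨k, hk⟩ := ihg _ _ ha
    obtain ⟨l, hl⟩ := ihf _ _ hb
    refine ⟨max k l, ?_⟩
    rw [mem_eval_comp]
    exact ⟨a, up _ _ _ (le_max_left _ _) _ _ hk, up _ _ _ (le_max_right _ _) _ _ hl⟩
  | prec cf cg ihf ihg =>
    intro n v
    obtain ⟨⟨a, n⟩, rfl⟩ : ∃ p : ℕ × ℕ, Nat.pair p.1 p.2 = n := ⟨n.unpair, by simp⟩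
    dsimp only
    induction n generalizing v with
    | zero =>
      rw [mem_eval_prec_zero]
      intro hv
      obtain ⟨k, hk⟩ := ihf _ _ hv
      exact ⟨k, by rwa [mem_eval_prec_zero]⟩
    | succ n ih =>
      rw [mem_eval_prec_succ]
      rintro ⟨i, hi, hv⟩
      obtain ⟨k, hk⟩ := ih _ hi
      obtain ⟨l, hl⟩ := ihg _ _ hv
      refine ⟨max k l, ?_⟩
      rw [mem_eval_prec_succ]
      exact ⟨i, up _ _ _ (le_max_left _ _) _ _ hk, up _ _ _ (le_max_right _ _) _ _ hl⟩
  | rfind' cf ih =>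
    intro n v
    obtain ⟨⟨a, n⟩, rfl⟩ : ∃ p : ℕ × ℕ, Nat.pair p.1 p.2 = n := ⟨n.unpair, by simp⟩
    rw [mem_eval_rfind]
    rintro ⟨k, hk, h0, h1⟩
    obtain ⟨l0, hl0⟩ := ih _ _ h0
    have : ∃ l, ∀ j < k, ∃ w ∈ cf.eval (G l) (Nat.pair a (j + n)), w ≠ 0 := by
      clear hk h0 hl0
      induction k with
      | zero => exact ⟨0, by simp⟩
      | succ k ihk =>
        obtain ⟨l, hl⟩ := ihk fun j hj => h1 j (by omega)
        obtain ⟨w, hw, hw0⟩ := h1 k (by omega)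
        obtain ⟨l', hl'⟩ := ih _ _ hw
        refine ⟨max l l', fun j hj => ?_⟩
        rcases Nat.lt_or_ge j k with hj' | hj'
        · obtain ⟨w, hw, hw0⟩ := hl j hj'
          exact ⟨w, up _ _ _ (le_max_left _ _) _ _ hw, hw0⟩
        · obtain rfl : j = k := by omega
          exact ⟨w, up _ _ _ (le_max_right _ _) _ _ hl', hw0⟩
    obtain ⟨l, hl⟩ := this
    refine ⟨max l0 l, ?_⟩
    rw [mem_eval_rfind]
    refine ⟨k, hk, up _ _ _ (le_max_left _ _) _ _ hl0, fun j hj => ?_⟩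
    obtain ⟨w, hw, hw0⟩ := hl j hj
    exact ⟨w, up _ _ _ (le_max_right _ _) _ _ hw, hw0⟩

theorem mem_strOracle (τ : List Bool) (n v : ℕ) :
    v ∈ strOracle τ n ↔ ∃ b, τ[n]? = some b ∧ v = cond b 1 0 := by
  unfold strOracle
  split_ifs with h
  · simp [h]
  · simp [h]

theorem mem_chi (X : ℕ → Bool) (n v : ℕ) : v ∈ chi X n ↔ v = cond (X n) 1 0 := by
  simp [chi]

theorem strOracle_mono {τ τ' : List Bool} (h : τ <+: τ') (n v : ℕ) (hv : v ∈ strOracle τ n) :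
    v ∈ strOracle τ' n := by
  rw [mem_strOracle] at *
  obtain ⟨b, hb, rfl⟩ := hv
  exact ⟨b, pfx_get h hb, rfl⟩

theorem eval_str_mono (c : OracleCode) {τ τ' : List Bool} (h : τ <+: τ') (n v : ℕ)
    (hv : v ∈ c.eval (strOracle τ) n) : v ∈ c.eval (strOracle τ') n :=
  eval_mono (strOracle_mono h) c n v hv

theorem eval_chi_iff (c : OracleCode) (X : ℕ → Bool) (n v : ℕ) :
    v ∈ c.eval (chi X) n ↔ ∃ k, v ∈ c.eval (strOracle (pre X k)) n := by
  constructor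
  · apply eval_cont (fun k => strOracle (pre X k))
    · intro k l hkl n v; exact strOracle_mono (pre_pfx X hkl) n v
    · intro n v hv
      rw [mem_chi] at hv
      exact ⟨n+1, (mem_strOracle _ _ _).2 ⟨X n, by rw [pre_getElem?_of_lt X (by omega)], hv⟩⟩
  · rintro ⟨k, hk⟩
    refine eval_mono ?_ c n v hk
    intro n v hv
    rw [mem_strOracle] at hv
    obtain ⟨b, hb, rfl⟩ := hv
    rw [pre_getElem?] at hb
    split_ifs at hb
    cases hb
    rw [mem_chi]

/-- Evaluation with a string oracle is partial recursive. -/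
theorem partrec_eval_str (c : OracleCode) :
    Partrec (fun x : List Bool × ℕ => c.eval (strOracle x.1) x.2) := by
  induction c with
  | zero => exact (Partrec.const' (Part.some 0)).of_eq fun x => rfl
  | succ =>
    have : Computable (fun x : List Bool × ℕ => x.2 + 1) := Primrec.to_comp (by fun_prop)
    exact this.partrec.of_eq fun x => rfl
  | left =>
    have : Computable (fun x : List Bool × ℕ => x.2.unpair.1) := Primrec.to_comp (by fun_prop)
    exact this.partrec.of_eq fun x => rfl
  | right =>
    have : Computable (fun x : List Bool × ℕ => x.2.unpair.2) := Primrec.to_comp (by fun_prop)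
    exact this.partrec.of_eq fun x => rfl
  | oracle =>
    have h : Primrec (fun x : List Bool × ℕ => (x.1[x.2]?).map (fun b => cond b 1 0)) :=
      Primrec.option_map (by fun_prop) (Primrec.cond Primrec.snd (Primrec.const 1)
        (Primrec.const 0)).to₂
    have := Computable.ofOption h.to_comp
    refine this.of_eq fun x => ?_
    apply Part.ext
    intro v
    rw [OracleCode.eval, mem_strOracle]
    simp [eq_comm]
  | pair cf cg ihf ihg =>
    have : Partrec (fun x : List Bool × ℕ => (cf.eval (strOracle x.1) x.2).bind fun a =>
        (cg.eval (strOracle x.1) x.2).map fun b => Nat.pair a b) := by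
      refine Partrec.bind ihf ?_
      refine Partrec.map (ihg.comp Computable.fst) ?_
      exact (Primrec₂.natPair.comp (Primrec.snd.comp Primrec.fst) Primrec.snd).to_comp
    refine this.of_eq fun x => ?_
    apply Part.ext
    intro v
    rw [mem_eval_pair]
    simp
  | comp cf cg ihf ihg =>
    have : Partrec (fun x : List Bool × ℕ => (cg.eval (strOracle x.1) x.2).bind fun a =>
        cf.eval (strOracle x.1) a) := by
      refine Partrec.bind ihg ?_
      exact ihf.comp ((Computable.fst.comp Computable.fst).pair Computable.snd)
    exact this.of_eq fun x => rfl
  | prec cf cg ihf ihg =>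
    have : Partrec (fun x : List Bool × ℕ => Nat.rec (motive := fun _ => Part ℕ)
        (cf.eval (strOracle x.1) x.2.unpair.1) (fun y IH => IH.bind fun i =>
        cg.eval (strOracle x.1) (Nat.pair x.2.unpair.1 (Nat.pair y i))) x.2.unpair.2) := by
      refine Partrec.nat_rec (f := fun x : List Bool × ℕ => x.2.unpair.2)
        (g := fun x : List Bool × ℕ => cf.eval (strOracle x.1) x.2.unpair.1)
        (h := fun (x : List Bool × ℕ) (p : ℕ × ℕ) => cg.eval (strOracle x.1)
          (Nat.pair x.2.unpair.1 (Nat.pair p.1 p.2))) ?_ ?_ ?_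
      · exact Primrec.to_comp (by fun_prop)
      · exact ihf.comp (g := fun x : List Bool × ℕ => (x.1, x.2.unpair.1))
          (Primrec.to_comp (by fun_prop))
      · exact ihg.comp (g := fun y : (List Bool × ℕ) × (ℕ × ℕ) => (y.1.1,
          (Nat.pair y.1.2.unpair.1 (Nat.pair y.2.1 y.2.2)))) (Primrec.to_comp (by fun_prop))
    exact this.of_eq fun x => rfl
  | rfind' cf ih =>
    have h1 : Partrec₂ (fun (x : List Bool × ℕ) (n : ℕ) => (cf.eval (strOracle x.1)
        (Nat.pair x.2.unpair.1 (n + x.2.unpair.2))).map (fun m => decide (m = 0))) := by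
      refine Partrec.map (ih.comp (g := fun y : (List Bool × ℕ) × ℕ => (y.1.1,
        (Nat.pair y.1.2.unpair.1 (y.2 + y.1.2.unpair.2)))) (Primrec.to_comp (by fun_prop))) ?_
      have : Primrec (fun z : ((List Bool × ℕ) × ℕ) × ℕ => decide (z.2 = 0)) := by fun_prop
      exact this.to_comp
    have := Partrec.map (Partrec.rfind h1) (g := fun (x : List Bool × ℕ) (n : ℕ) =>
      n + x.2.unpair.2) (Primrec.to_comp (by
        show Primrec (fun y : (List Bool × ℕ) × ℕ => y.2 + y.1.2.unpair.2)
        fun_prop))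
    exact this.of_eq fun x => rfl

/-- `Comp c τ w`: with oracle string `τ`, the functional `c` outputs at least `w`. -/
def Comp (c : OracleCode) (τ w : List Bool) : Prop :=
  ∀ i < w.length, ∃ b, w[i]? = some b ∧ cond b 1 0 ∈ c.eval (strOracle τ) i

theorem sre_Comp (c : OracleCode) : SRE (fun x : List Bool × List Bool => Comp c x.1 x.2) := by
  unfold Comp
  apply sre_ball_lt (fun x : List Bool × List Bool => x.2.length)
    (fun x i => ∃ b, x.2[i]? = some b ∧ cond b 1 0 ∈ c.eval (strOracle x.1) i) (by fun_prop)
  have h := sre_graph (partrec_eval_str c)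
  have : SRE (fun y : ((List Bool × List Bool) × ℕ) × Bool =>
      cond y.2 1 0 ∈ c.eval (strOracle y.1.1.1) y.1.2) :=
    sre_comp _ (fun y : ((List Bool × List Bool) × ℕ) × Bool =>
      ((y.1.1.1, y.1.2), cond y.2 1 0)) h (by fun_prop)
  fun_prop

theorem Comp.mono {c : OracleCode} {τ τ' w : List Bool} (h : Comp c τ w) (hτ : τ <+: τ') :
    Comp c τ' w := by
  intro i hi
  obtain ⟨b, hb, hv⟩ := h i hi
  exact ⟨b, hb, eval_str_mono c hτ _ _ hv⟩

theorem Comp.down {c : OracleCode} {τ w w' : List Bool} (h : Comp c τ w) (hw : w' <+: w) :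
    Comp c τ w' := by
  intro i hi
  obtain ⟨b, hb, hv⟩ := h i (lt_of_lt_of_le hi hw.length_le)
  refine ⟨b, ?_, hv⟩
  rw [← hb, List.getElem?_eq_getElem hi]
  exact (pfx_get hw (List.getElem?_eq_getElem hi)).symm

theorem cond_inj {a b : Bool} (h : (cond a 1 0 : ℕ) = cond b 1 0) : a = b := by
  cases a <;> cases b <;> simp_all

theorem Comp.consistent {c : OracleCode} {τ w w' : List Bool} (h : Comp c τ w) (h' : Comp c τ w') :
    w <+: w' ∨ w' <+: w := by
  have key : ∀ (u u' : List Bool), Comp c τ u → Comp c τ u' → u.length ≤ u'.length → u <+: u' := by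
    intro u u' hu hu' hl
    rw [List.prefix_iff_eq_take]
    apply List.ext_getElem?
    intro i
    rw [List.getElem?_take]
    split_ifs with hi
    · obtain ⟨b, hb, hv⟩ := hu i hi
      obtain ⟨b', hb', hv'⟩ := hu' i (by omega)
      rw [hb, hb']
      exact congrArg some (cond_inj (Part.mem_unique hv hv'))
    · rw [List.getElem?_eq_none]; omega
  rcases le_total w.length w'.length with hl | hl
  · exact Or.inl (key _ _ h h' hl)
  · exact Or.inr (key _ _ h' h hl)

/-- If `c` computes `Y` from `X` then `Comp` outputs prefixes of `Y`. -/
theorem Comp.prefix_of_eval {c : OracleCode} {X Y : ℕ → Bool} (hc : c.eval (chi X) = chi Y)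
    {k : ℕ} {w : List Bool} (h : Comp c (pre X k) w) : w = pre Y w.length := by
  rw [pre_eq_iff]
  intro i b hb
  obtain ⟨hi, -⟩ := List.getElem?_eq_some_iff.1 hb
  obtain ⟨b', hb', hv⟩ := h i hi
  rw [hb] at hb'
  cases hb'
  have := (eval_chi_iff c X i _).2 ⟨k, hv⟩
  rw [hc, mem_chi] at this
  exact cond_inj this

theorem exists_Comp {c : OracleCode} {X Y : ℕ → Bool} (hc : c.eval (chi X) = chi Y) (n : ℕ) :
    ∃ k, Comp c (pre X k) (pre Y n) := by
  induction n with
  | zero => exact ⟨0, fun i hi => by simp at hi⟩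
  | succ n ih =>
    obtain ⟨k, hk⟩ := ih
    have : cond (Y n) 1 0 ∈ c.eval (chi X) n := by rw [hc, mem_chi]
    obtain ⟨l, hl⟩ := (eval_chi_iff c X n _).1 this
    refine ⟨max k l, fun i hi => ?_⟩
    rw [pre_length] at hi
    refine ⟨Y i, pre_getElem?_of_lt Y hi, ?_⟩
    rcases Nat.lt_or_ge i n with hin | hin
    · obtain ⟨b, hb, hv⟩ := hk i (by simpa using hin)
      rw [pre_getElem?_of_lt Y hin] at hb
      cases hb
      exact eval_str_mono c (pre_pfx X (le_max_left _ _)) _ _ hv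
    · obtain rfl : i = n := by omega
      exact eval_str_mono c (pre_pfx X (le_max_right _ _)) _ _ hl

/-! ### Codes -/

/-- Substitution of a code for the oracle. -/
def substCode (d : OracleCode) : OracleCode → OracleCode
  | .zero => .zero
  | .succ => .succ
  | .left => .left
  | .right => .right
  | .oracle => d
  | .pair cf cg => .pair (substCode d cf) (substCode d cg)
  | .comp cf cg => .comp (substCode d cf) (substCode d cg)
  | .prec cf cg => .prec (substCode d cf) (substCode d cg)
  | .rfind' cf => .rfind' (substCode d cf)

theorem eval_subst (g : ℕ →. ℕ) (d c : OracleCode) :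
    (substCode d c).eval g = c.eval (d.eval g) := by
  induction c with
  | zero => rfl
  | succ => rfl
  | left => rfl
  | right => rfl
  | oracle => rfl
  | pair cf cg ihf ihg => simp only [substCode, OracleCode.eval, ihf, ihg]; rfl
  | comp cf cg ihf ihg => simp only [substCode, OracleCode.eval, ihf, ihg]; rfl
  | prec cf cg ihf ihg => simp only [substCode, OracleCode.eval, ihf, ihg]; rfl
  | rfind' cf ih => simp only [substCode, OracleCode.eval, ih]; rfl

theorem TRed.trans {X Y Z : ℕ → Bool} (h1 : TRed X Y) (h2 : TRed Y Z) : TRed X Z := by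
  obtain ⟨c, hc⟩ := h1
  obtain ⟨d, hd⟩ := h2
  exact ⟨substCode d c, by rw [eval_subst, hd, hc]⟩

/-- Translation of ordinary codes. -/
def ofCode : Nat.Partrec.Code → OracleCode
  | .zero => .zero
  | .succ => .succ
  | .left => .left
  | .right => .right
  | .pair cf cg => .pair (ofCode cf) (ofCode cg)
  | .comp cf cg => .comp (ofCode cf) (ofCode cg)
  | .prec cf cg => .prec (ofCode cf) (ofCode cg)
  | .rfind' cf => .rfind' (ofCode cf)

theorem eval_ofCode (g : ℕ →. ℕ) (c : Nat.Partrec.Code) : (ofCode c).eval g = c.eval := by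
  induction c with
  | zero => rfl
  | succ => rfl
  | left => rfl
  | right => rfl
  | pair cf cg ihf ihg => simp only [ofCode, OracleCode.eval, Nat.Partrec.Code.eval, ihf, ihg]; rfl
  | comp cf cg ihf ihg => simp only [ofCode, OracleCode.eval, Nat.Partrec.Code.eval, ihf, ihg]; rfl
  | prec cf cg ihf ihg => simp only [ofCode, OracleCode.eval, Nat.Partrec.Code.eval, ihf, ihg]; rfl
  | rfind' cf ih => simp only [ofCode, OracleCode.eval, Nat.Partrec.Code.eval, ih]; rfl

theorem exists_code_prim {f : ℕ → ℕ} (hf : Primrec f) :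
    ∃ c : OracleCode, ∀ g n, c.eval g n = Part.some (f n) := by
  have h : Nat.Partrec (f : ℕ →. ℕ) := Nat.Partrec.of_primrec (Primrec.nat_iff.1 hf)
  obtain ⟨c, hc⟩ := Nat.Partrec.Code.exists_code.1 h
  exact ⟨ofCode c, fun g n => by rw [eval_ofCode, hc]; rfl⟩

theorem exists_prefix_code : ∃ P : OracleCode, ∀ Y a k,
    P.eval (chi Y) (Nat.pair a k) = Part.some (Encodable.encode (pre Y k)) := by
  obtain ⟨z, hz⟩ := exists_code_prim (f := fun _ => Encodable.encode ([] : List Bool))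
    (by fun_prop)
  obtain ⟨s, hs⟩ := exists_code_prim (f := fun n => Encodable.encode
    (((Encodable.decode n.unpair.1 : Option (List Bool)).getD []) ++ [decide (n.unpair.2 = 1)]))
    (by fun_prop)
  refine ⟨.prec z (.comp s (.pair (.comp .right .right)
    (.comp .oracle (.comp .left .right)))), fun Y a k => ?_⟩
  induction k with
  | zero =>
    rw [Part.eq_some_iff, mem_eval_prec_zero, hz]; simp [pre]
  | succ k ih =>
    rw [Part.eq_some_iff, mem_eval_prec_succ, ih]
    refine ⟨_, Part.mem_some _, ?_⟩
    rw [mem_eval_comp]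
    refine ⟨Nat.pair (Encodable.encode (pre Y k)) (cond (Y k) 1 0), ?_, ?_⟩
    · rw [mem_eval_pair]
      refine ⟨_, ?_, _, ?_, rfl⟩
      · rw [mem_eval_comp]
        exact ⟨Nat.pair k (Encodable.encode (pre Y k)), by simp [OracleCode.eval],
          by simp [OracleCode.eval]⟩
      · rw [mem_eval_comp]
        refine ⟨k, ?_, by simp [OracleCode.eval, chi]⟩
        rw [mem_eval_comp]
        exact ⟨Nat.pair k (Encodable.encode (pre Y k)), by simp [OracleCode.eval],
          by simp [OracleCode.eval]⟩
    · rw [hs, pre_succ]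
      simp
      cases Y k <;> simp

/-- Unbounded search relative to an oracle. -/
theorem exists_search_code {S : ℕ × ℕ × List Bool → Prop} (hS : PrimrecPred S) :
    ∃ c : OracleCode, ∀ Y n v, v ∈ c.eval (chi Y) n ↔
      S (n, v, pre Y v) ∧ ∀ j < v, ¬ S (n, j, pre Y j) := by
  classical
  obtain ⟨P, hP⟩ := exists_prefix_code
  obtain ⟨t, ht⟩ := exists_code_prim (f := fun x => cond (decide (S (x.unpair.1.unpair.1,
    x.unpair.1.unpair.2, ((Encodable.decode x.unpair.2 : Option (List Bool)).getD [])))) 0 1)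
    (by fun_prop)
  obtain ⟨i, hi⟩ := exists_code_prim (f := fun n => n) (by fun_prop)
  obtain ⟨p0, hp0⟩ := exists_code_prim (f := fun n => Nat.pair n 0) (by fun_prop)
  have hT : ∀ Y n v, (OracleCode.comp t (.pair i P)).eval (chi Y) (Nat.pair n v) =
      Part.some (cond (decide (S (n, v, pre Y v))) 0 1) := by
    intro Y n v
    rw [Part.eq_some_iff, mem_eval_comp]
    refine ⟨Nat.pair (Nat.pair n v) (Encodable.encode (pre Y v)), ?_, ?_⟩
    · rw [mem_eval_pair, hi, hP]
      exact ⟨_, Part.mem_some _, _, Part.mem_some _, rfl⟩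
    · rw [ht]; simp
  refine ⟨.comp (.rfind' (.comp t (.pair i P))) p0, fun Y n v => ?_⟩
  rw [mem_eval_comp]
  simp only [hp0, Part.mem_some_iff, exists_eq_left]
  rw [mem_eval_rfind]
  simp only [hT, Part.mem_some_iff, add_zero, exists_eq_left]
  constructor
  · rintro ⟨h0, h1⟩
    refine ⟨?_, fun j hj => ?_⟩
    · by_contra h; simp [h] at h0
    · intro h
      have := h1 j hj
      simp [h] at this
  · rintro ⟨h0, h1⟩
    refine ⟨by simp [h0], fun j hj => by simp [h1 j hj]⟩

/-- Criterion for Turing reducibility. -/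
theorem tred_of_sre {X Y : ℕ → Bool} {Q : List Bool → ℕ → Bool → Prop}
    (hQ : SRE (fun x : List Bool × ℕ × Bool => Q x.1 x.2.1 x.2.2))
    (h1 : ∀ n, ∃ k, Q (pre Y k) n (X n)) (h2 : ∀ k n b, Q (pre Y k) n b → b = X n) : TRed X Y := by
  obtain ⟨q, hq, hqQ⟩ := hQ
  obtain ⟨c, hc⟩ := exists_search_code (S := fun x => q ((x.2.2.take x.2.1.unpair.1, x.1,
    decide (x.2.1.unpair.2.unpair.1 = 1)), x.2.1.unpair.2.unpair.2)) (by fun_prop)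
  obtain ⟨e, he⟩ := exists_code_prim (f := fun n => cond (decide (n.unpair.2.unpair.1 = 1)) 1 0)
    (by fun_prop)
  refine ⟨.comp e c, ?_⟩
  funext n
  have hdom : ∃ v, q (((pre Y v).take v.unpair.1, n,
      decide (v.unpair.2.unpair.1 = 1)), v.unpair.2.unpair.2) := by
    obtain ⟨k, hk⟩ := h1 n
    obtain ⟨s, hs⟩ := (hqQ (pre Y k, n, X n)).1 hk
    refine ⟨Nat.pair k (Nat.pair (cond (X n) 1 0) s), ?_⟩
    rw [Nat.unpair_pair, Nat.unpair_pair, pre_take Y (Nat.left_le_pair _ _)]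
    have : decide ((cond (X n) 1 0 : ℕ) = 1) = X n := by cases X n <;> simp
    simpa only [this] using hs
  classical
  have hmem := (hc Y n (Nat.find hdom)).2 ⟨Nat.find_spec hdom, fun j hj => Nat.find_min hdom hj⟩
  have hsp := Nat.find_spec hdom
  generalize Nat.find hdom = v at hmem hsp
  rw [pre_take Y (Nat.unpair_left_le v)] at hsp
  have hb := h2 _ _ _ ((hqQ (pre Y v.unpair.1, n, _)).2 ⟨_, hsp⟩)
  show _ = Part.some _
  rw [Part.eq_some_iff, mem_eval_comp]
  refine ⟨v, hmem, ?_⟩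
  rw [he, ← hb]
  simp

/-! ### Numbering and the jump -/

theorem encodeCode_injective : Function.Injective OracleCode.encodeCode := by
  intro c
  induction c with
  | zero => intro d h; cases d <;> simp [OracleCode.encodeCode] at h ⊢
  | succ => intro d h; cases d <;> simp [OracleCode.encodeCode] at h ⊢
  | left => intro d h; cases d <;> simp [OracleCode.encodeCode] at h ⊢
  | right => intro d h; cases d <;> simp [OracleCode.encodeCode] at h ⊢
  | oracle => intro d h; cases d <;> simp [OracleCode.encodeCode] at h ⊢
  | pair a b iha ihb =>
    intro d h
    cases d with
    | pair a' b' =>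
      simp only [OracleCode.encodeCode] at h
      have h' := Nat.pair_eq_pair.1 (show Nat.pair a.encodeCode b.encodeCode =
        Nat.pair a'.encodeCode b'.encodeCode by omega)
      rw [iha h'.1, ihb h'.2]
    | _ => simp only [OracleCode.encodeCode] at h; omega
  | comp a b iha ihb =>
    intro d h
    cases d with
    | comp a' b' =>
      simp only [OracleCode.encodeCode] at h
      have h' := Nat.pair_eq_pair.1 (show Nat.pair a.encodeCode b.encodeCode =
        Nat.pair a'.encodeCode b'.encodeCode by omega)
      rw [iha h'.1, ihb h'.2]
    | _ => simp only [OracleCode.encodeCode] at h; omega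
  | prec a b iha ihb =>
    intro d h
    cases d with
    | prec a' b' =>
      simp only [OracleCode.encodeCode] at h
      have h' := Nat.pair_eq_pair.1 (show Nat.pair a.encodeCode b.encodeCode =
        Nat.pair a'.encodeCode b'.encodeCode by omega)
      rw [iha h'.1, ihb h'.2]
    | _ => simp only [OracleCode.encodeCode] at h; omega
  | rfind' a iha =>
    intro d h
    cases d with
    | rfind' a' =>
      simp only [OracleCode.encodeCode] at h
      have h' := Nat.pair_eq_pair.1 (show Nat.pair a.encodeCode a.encodeCode =
        Nat.pair a'.encodeCode a'.encodeCode by omega)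
      rw [iha h'.1]
    | _ => simp only [OracleCode.encodeCode] at h; omega

theorem exists_enum_codes : ∃ C : ℕ → OracleCode, Function.Surjective C := by
  have : Countable OracleCode := encodeCode_injective.countable
  have : Nonempty OracleCode := ⟨.zero⟩
  exact exists_surjective_nat OracleCode

/-- Constant codes. -/
def constCode : ℕ → OracleCode
  | 0 => .zero
  | n + 1 => .comp .succ (constCode n)

theorem eval_constCode (g : ℕ →. ℕ) (n m : ℕ) : (constCode n).eval g m = Part.some n := by
  induction n with
  | zero => rfl
  | succ n ih =>
    rw [Part.eq_some_iff, constCode, mem_eval_comp, ih]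
    exact ⟨n, Part.mem_some _, by simp [OracleCode.eval]⟩

@[fun_prop] theorem prim_encode_constCode : Primrec (fun n => (constCode n).encodeCode) := by
  have h := Primrec.nat_rec₁ (f := fun _ r => 4 * Nat.pair 1 r + 6) 0 (by
    show Primrec (fun x : ℕ × ℕ => 4 * Nat.pair 1 x.2 + 6)
    fun_prop)
  refine h.of_eq fun n => ?_
  induction n with
  | zero => rfl
  | succ n ih =>
    simp only at ih ⊢
    rw [ih]
    rfl

theorem sre_le_zeroJump {α : Type*} [Primcodable α] {M : α → Prop} (hM : SRE M) :
    ∃ F : α → ℕ, Primrec F ∧ ∀ a, zeroJump (F a) = true ↔ M a := by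
  obtain ⟨q, hq, hqM⟩ : SRE (fun n : ℕ => ∃ a, Encodable.decode n = some a ∧ M a) := by fun_prop
  obtain ⟨c, hc⟩ := exists_search_code (S := fun x => q (x.1, x.2.1)) (by fun_prop)
  refine ⟨fun a => (OracleCode.comp c (constCode (Encodable.encode a))).encodeCode, ?_, ?_⟩
  · simp only [OracleCode.encodeCode]
    have h2 : Primrec (fun a : α => (constCode (Encodable.encode a)).encodeCode) :=
      prim_comp (fun n => (constCode n).encodeCode) (fun a : α => Encodable.encode a)
        prim_encode_constCode (by fun_prop)
    fun_prop
  · intro a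
    unfold zeroJump jump
    rw [@decide_eq_true_iff _ (Classical.dec _)]
    have hd : ∀ m, ((OracleCode.comp c (constCode (Encodable.encode a))).eval
        (chi fun _ => false) m).Dom ↔ M a := by
      intro m
      rw [Part.dom_iff_mem]
      simp only [mem_eval_comp, eval_constCode, Part.mem_some_iff, exists_eq_left, hc]
      have hM' := hqM (Encodable.encode a)
      simp only [Encodable.encodek, Option.some.injEq, exists_eq_left'] at hM'
      rw [hM']
      constructor
      · rintro ⟨y, h, -⟩; exact ⟨y, h⟩
      · intro h
        classical
        exact ⟨Nat.find h, Nat.find_spec h, fun j hj => Nat.find_min h hj⟩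
    constructor
    · rintro ⟨d, hd1, hd2⟩
      rw [encodeCode_injective hd1] at hd2
      exact (hd _).1 hd2
    · intro h
      exact ⟨_, rfl, (hd _).2 h⟩

/-- Differences of r.e. sets are c.e. in the halting problem, uniformly. -/
theorem uniformCE_zeroJump {β : Type} [Primcodable β] {P1 P2 : ℕ → List Bool → β → Prop}
    (h1 : SRE (fun x : (ℕ × List Bool) × β => P1 x.1.1 x.1.2 x.2))
    (h2 : SRE (fun x : (ℕ × List Bool) × β => P2 x.1.1 x.1.2 x.2)) :
    UniformCEIn zeroJump (fun i => {σ | ∃ x, P1 i σ x ∧ ¬ P2 i σ x}) := by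
  classical
  obtain ⟨F, hF, hF2⟩ := sre_le_zeroJump h2
  obtain ⟨q, hq, hq1⟩ := h1
  -- search predicate
  have hS : PrimrecPred (fun z : ((ℕ × ℕ × List Bool) × List Bool) × β =>
      Encodable.decode z.1.1.1.unpair.2 = some z.1.2 ∧
      Encodable.decode z.1.1.2.1.unpair.1 = some z.2 ∧
      q (((z.1.1.1.unpair.1, z.1.2), z.2), z.1.1.2.1.unpair.2.unpair.1) ∧
      z.1.1.2.2[F ((z.1.1.1.unpair.1, z.1.2), z.2)]? = some false) := by fun_prop
  have hO : ∀ {γ δ : Type} [Primcodable γ] [Primcodable δ] (r : γ × δ → Prop) (f : γ → ℕ),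
      Primrec f → PrimrecPred r →
      PrimrecPred (fun a => ∃ b ∈ (Encodable.decode (f a) : Option δ), r (a, b)) := by
    intro γ δ _ _ r f hf hr
    have := Primrec.option_casesOn (o := fun x : γ =>
      (Encodable.decode (f x) : Option δ)) (f := fun _ => false)
      (g := fun x b => decide (r (x, b))) (by fun_prop) (Primrec.const _)
      (by
        show Primrec (fun y : γ × δ => decide (r (y.1, y.2)))
        fun_prop)
    refine ⟨fun _ => Classical.dec _, this.of_eq fun x => ?_⟩
    cases h : (Encodable.decode (f x) : Option δ) <;> simp [h]
  have hS2 := hO (δ := List Bool) _ (fun x : (ℕ × ℕ × List Bool) => x.1.unpair.2) (by fun_prop)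
    (hO (δ := β) _ (fun x : (ℕ × ℕ × List Bool) × List Bool => x.1.2.1.unpair.1) (by fun_prop) hS)
  obtain ⟨c, hc⟩ := exists_search_code hS2
  refine ⟨c, fun i σ => ?_⟩
  rw [Part.dom_iff_mem]
  simp only [hc]
  have hdom : (∃ x, P1 i σ x ∧ ¬ P2 i σ x) ↔ ∃ v, (∃ b ∈ (Encodable.decode
      (Nat.pair i (Encodable.encode σ), v, pre zeroJump v).1.unpair.2 : Option (List Bool)),
      ∃ b_1 ∈ (Encodable.decode
        ((Nat.pair i (Encodable.encode σ), v, pre zeroJump v), b).1.2.1.unpair.1 : Option β),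
      Encodable.decode (Nat.pair i (Encodable.encode σ)).unpair.2 = some b ∧
      Encodable.decode v.unpair.1 = some b_1 ∧
      q ((((Nat.pair i (Encodable.encode σ)).unpair.1, b), b_1), v.unpair.2.unpair.1) ∧
      (pre zeroJump v)[F (((Nat.pair i (Encodable.encode σ)).unpair.1, b), b_1)]? = some false) := by
    simp only [Nat.unpair_pair, Encodable.encodek, Option.mem_def, Option.some.injEq]
    constructor
    · rintro ⟨x, hx1, hx2⟩
      obtain ⟨s, hs⟩ := (hq1 ((i, σ), x)).1 hx1
      refine ⟨Nat.pair (Encodable.encode x) (Nat.pair s (F ((i, σ), x) + 1)), σ, rfl, x, ?_⟩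
      simp only [Nat.unpair_pair, Encodable.encodek, true_and]
      refine ⟨hs, ?_⟩
      rw [pre_getElem?_of_lt]
      · have := (hF2 ((i, σ), x)).not.2 hx2
        simpa using this
      · have h1 := Nat.right_le_pair (Encodable.encode x) (Nat.pair s (F ((i, σ), x) + 1))
        have h2 := Nat.right_le_pair s (F ((i, σ), x) + 1)
        omega
    · rintro ⟨v, σ', rfl, x, -, -, -, hq, hv⟩
      refine ⟨x, (hq1 ((i, σ), x)).2 ⟨_, hq⟩, ?_⟩
      rw [pre_getElem?] at hv
      split_ifs at hv
      intro h
      have := (hF2 ((i, σ), x)).2 h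
      rw [this] at hv
      simp at hv
  show (∃ x, P1 i σ x ∧ ¬ P2 i σ x) ↔ _
  rw [hdom]
  constructor
  · intro h
    exact ⟨Nat.find h, Nat.find_spec h, fun j hj => Nat.find_min h hj⟩
  · rintro ⟨v, h, -⟩; exact ⟨v, h⟩

end TypicalDegree


namespace TypicalDegree

open MeasureTheory
open scoped ENNReal

/-! ## Fair-coin measure -/

/-- Fair coin measure on Cantor space. -/
noncomputable def mu : Measure (ℕ → Bool) :=
  Measure.infinitePi (fun _ : ℕ => (PMF.uniformOfFintype Bool).toMeasure)

noncomputable instance : IsProbabilityMeasure mu := by unfold mu; infer_instance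

theorem mu_cyl (σ : List Bool) : mu {X | σ = pre X σ.length} = (2 : ℝ≥0∞)⁻¹ ^ σ.length := by
  have h : {X : ℕ → Bool | σ = pre X σ.length} =
      Set.pi (Finset.range σ.length) (fun i => {σ.getD i false}) := by
    ext X
    simp only [Set.mem_setOf_eq, Set.mem_pi, Finset.coe_range, Set.mem_Iio, Set.mem_singleton_iff]
    rw [pre_eq_iff]
    constructor
    · intro h i hi
      rw [List.getD_eq_getElem _ _ hi]
      exact (h i _ (List.getElem?_eq_getElem hi)).symm
    · intro h i b hb
      obtain ⟨hi, rfl⟩ := List.getElem?_eq_some_iff.1 hb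
      rw [h i hi, List.getD_eq_getElem _ _ hi]
  rw [h, mu, Measure.infinitePi_pi _ (fun i _ => measurableSet_singleton _)]
  simp [PMF.toMeasure_apply_singleton]

theorem measurableSet_cyl (σ : List Bool) : MeasurableSet {X : ℕ → Bool | σ = pre X σ.length} := by
  have h : {X : ℕ → Bool | σ = pre X σ.length} =
      ⋂ i : Fin σ.length, {X | X i.1 = σ.get i} := by
    ext X
    rw [Set.mem_setOf_eq, ← extendsStr_iff]
    simp [extendsStr]
  rw [h]
  exact MeasurableSet.iInter fun i => measurableSet_eq_fun (measurable_pi_apply _) measurable_const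

theorem measurableSet_openOf (V : Set (List Bool)) : MeasurableSet (openOf V) := by
  have : openOf V = ⋃ σ ∈ V, {X | σ = pre X σ.length} := by
    ext X; simp [openOf, extendsStr_iff]
  rw [this]
  exact MeasurableSet.biUnion (Set.to_countable V) fun σ _ => measurableSet_cyl σ

theorem mu_finset (N : ℕ) (S : Finset (List Bool)) (hS : ∀ σ ∈ S, σ.length = N) :
    mu {X | pre X N ∈ S} = S.card * (2 : ℝ≥0∞)⁻¹ ^ N := by
  have h : {X : ℕ → Bool | pre X N ∈ S} = ⋃ σ ∈ S, {X | σ = pre X σ.length} := by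
    ext X
    simp only [Set.mem_setOf_eq, Set.mem_iUnion, exists_prop]
    constructor
    · intro h; exact ⟨_, h, by simp⟩
    · rintro ⟨σ, hσ, h⟩; rw [← hS σ hσ, ← h]; exact hσ
  rw [h, measure_biUnion_finset]
  · rw [Finset.sum_congr rfl (g := fun _ => (2 : ℝ≥0∞)⁻¹ ^ N)]
    · simp
    · intro σ hσ; rw [mu_cyl, hS σ hσ]
  · intro σ hσ τ hτ hne
    rw [Function.onFun, Set.disjoint_left]
    intro X h1 h2
    apply hne
    rw [Set.mem_setOf_eq] at h1 h2
    rw [h1, h2, hS σ hσ, hS τ hτ]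
  · intro σ _; exact measurableSet_cyl σ

theorem two_inv_pow (N : ℕ) : ((2 : ℝ≥0∞) ^ N)⁻¹ = (2 : ℝ≥0∞)⁻¹ ^ N := by
  rw [ENNReal.inv_pow]

theorem ofFn_eq_pre {n : ℕ} (X : ℕ → Bool) : List.ofFn (fun i : Fin n => X i) = pre X n := by
  apply List.ext_getElem?
  intro i
  rw [pre_getElem?, List.getElem?_ofFn]
  split_ifs <;> rfl

theorem stringMeasure_le (V : Set (List Bool)) : stringMeasure V ≤ mu (openOf V) := by
  classical
  refine iSup_le fun n => ?_
  let S : Finset (List Bool) := (Finset.univ.filter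
    (fun f : Fin n → Bool => ∃ σ ∈ V, σ <+: List.ofFn f)).map
      ⟨fun f => List.ofFn f, List.ofFn_injective⟩
  have hS : ∀ σ ∈ S, σ.length = n := by
    intro σ hσ
    simp only [S, Finset.mem_map] at hσ
    obtain ⟨f, -, rfl⟩ := hσ
    simp
  have hc : (Nat.card {f : Fin n → Bool // ∃ σ ∈ V, σ <+: List.ofFn f}) = S.card := by
    rw [Finset.card_map, Nat.card_eq_fintype_card, Fintype.card_subtype]
  rw [hc, div_eq_mul_inv, two_inv_pow, ← mu_finset n S hS]
  apply measure_mono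
  intro X hX
  simp only [S, Set.mem_setOf_eq, Finset.mem_map, Finset.mem_filter, Finset.mem_univ, true_and] at hX
  obtain ⟨f, ⟨σ, hσ, hp⟩, hf⟩ := hX
  refine ⟨σ, hσ, ?_⟩
  rw [extendsStr_iff]
  simp only [Function.Embedding.coeFn_mk] at hf
  rw [hf] at hp
  exact ((prefix_pre_iff _ _ _).1 hp).1

/-- Closed under extensions. -/
def UpClosed (W : Set (List Bool)) : Prop := ∀ σ τ, σ ∈ W → σ <+: τ → τ ∈ W

/-- Finite witness for having measure bigger than `2^(-a)`. -/
def Big (W : Set (List Bool)) (a : ℕ) : Prop :=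
  ∃ (N : ℕ) (l : List (List Bool)), (∀ i < l.length, ∀ j < i, ¬ l[i]? = l[j]?) ∧
    (∀ σ ∈ l, σ.length = N ∧ σ ∈ W) ∧ 2 ^ N < l.length * 2 ^ a

theorem mem_openOf_up {W : Set (List Bool)} (hW : UpClosed W) (X : ℕ → Bool) :
    X ∈ openOf W ↔ ∃ n, pre X n ∈ W := by
  simp only [openOf, Set.mem_setOf_eq, extendsStr_iff]
  constructor
  · rintro ⟨σ, hσ, h⟩; exact ⟨σ.length, h ▸ hσ⟩
  · rintro ⟨n, hn⟩; exact ⟨_, hn, by simp⟩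

theorem openOf_mono {V W : Set (List Bool)} (h : V ⊆ W) : openOf V ⊆ openOf W := by
  rintro X ⟨σ, hσ, hX⟩; exact ⟨σ, h hσ, hX⟩

theorem pow_lt_aux (N a k : ℕ) : (2 : ℝ≥0∞)⁻¹ ^ a < k * (2 : ℝ≥0∞)⁻¹ ^ N ↔ 2 ^ N < k * 2 ^ a := by
  rw [← two_inv_pow, ← two_inv_pow, ← div_eq_mul_inv,
    ENNReal.lt_div_iff_mul_lt (by left; simp) (by left; simp), mul_comm, ← div_eq_mul_inv,
    ENNReal.div_lt_iff (by left; simp) (by left; simp)]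
  norm_cast

theorem big_iff {W : Set (List Bool)} (hW : UpClosed W) (a : ℕ) :
    Big W a ↔ (2 : ℝ≥0∞)⁻¹ ^ a < mu (openOf W) := by
  classical
  constructor
  · rintro ⟨N, l, hl, hlW, hb⟩
    have hnd : l.Nodup := by
      rw [List.nodup_iff_getElem?_ne_getElem?]
      intro i j hij hj h
      exact hl j hj i hij h.symm
    have h1 : mu {X | pre X N ∈ l.toFinset} ≤ mu (openOf W) := by
      apply measure_mono
      intro X hX
      simp only [List.mem_toFinset, Set.mem_setOf_eq] at hX
      rw [mem_openOf_up hW]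
      exact ⟨N, (hlW _ hX).2⟩
    refine lt_of_lt_of_le ?_ h1
    rw [mu_finset N _ (fun σ hσ => (hlW σ (List.mem_toFinset.1 hσ)).1),
      List.toFinset_card_of_nodup hnd, pow_lt_aux]
    exact hb
  · intro h
    have hU : openOf W = ⋃ n, {X | pre X n ∈ W} := by
      ext X; rw [mem_openOf_up hW]; simp
    have hm : Monotone (fun n => {X : ℕ → Bool | pre X n ∈ W}) := by
      intro n m hnm X hX
      exact hW _ _ hX (pre_pfx X hnm)
    rw [hU, hm.measure_iUnion, lt_iSup_iff] at h
    obtain ⟨N, hN⟩ := h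
    let S : Finset (List Bool) := ((Finset.univ : Finset (Fin N → Bool)).map
      ⟨fun f => List.ofFn f, List.ofFn_injective⟩).filter (fun σ => σ ∈ W)
    have hS : ∀ σ ∈ S, σ.length = N := by
      intro σ hσ
      simp only [S, Finset.mem_filter, Finset.mem_map] at hσ
      obtain ⟨⟨f, -, rfl⟩, -⟩ := hσ
      simp
    have hE : {X : ℕ → Bool | pre X N ∈ W} = {X | pre X N ∈ S} := by
      ext X
      simp only [S, Set.mem_setOf_eq, Finset.mem_filter, Finset.mem_map, Finset.mem_univ, true_and]
      constructor
      · intro h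
        exact ⟨⟨fun i => X i, ofFn_eq_pre X⟩, h⟩
      · exact fun h => h.2
    rw [hE, mu_finset N S hS, pow_lt_aux] at hN
    refine ⟨N, S.toList, ?_, ?_, ?_⟩
    · intro i hi j hj h
      have := List.nodup_iff_getElem?_ne_getElem?.1 S.nodup_toList j i hj hi
      exact this h.symm
    · intro σ hσ
      rw [Finset.mem_toList] at hσ
      refine ⟨hS σ hσ, ?_⟩
      simp only [S, Finset.mem_filter] at hσ
      exact hσ.2
    · simpa using hN

theorem sre_Big {α : Type*} [Primcodable α] (W : α → Set (List Bool)) (f : α → ℕ) (hf : Primrec f)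
    (hW : SRE (fun x : α × List Bool => x.2 ∈ W x.1)) : SRE (fun a => Big (W a) (f a)) := by
  unfold Big
  have h1 : PrimrecPred (fun z : (α × ℕ) × List (List Bool) =>
      ∀ i < z.2.length, ∀ j < i, ¬ z.2[i]? = z.2[j]?) := by
    apply pp_ball_lt (fun z : (α × ℕ) × List (List Bool) => z.2.length)
      (fun z i => ∀ j < i, ¬ z.2[i]? = z.2[j]?) (by fun_prop)
    apply pp_ball_lt (fun z : ((α × ℕ) × List (List Bool)) × ℕ => z.2)
      (fun z j => ¬ z.1.2[z.2]? = z.1.2[j]?) (by fun_prop)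
    fun_prop
  have h2 : SRE (fun z : ((α × ℕ) × List (List Bool)) × List Bool => z.2 ∈ W z.1.1.1) :=
    sre_comp _ (fun z : ((α × ℕ) × List (List Bool)) × List Bool => (z.1.1.1, z.2)) hW (by fun_prop)
  refine sre_ex _ (sre_ex (fun (z : α × ℕ) (l : List (List Bool)) =>
    (∀ i < l.length, ∀ j < i, ¬ l[i]? = l[j]?) ∧
    (∀ σ ∈ l, σ.length = z.2 ∧ σ ∈ W z.1) ∧ 2 ^ z.2 < l.length * 2 ^ f z.1)
    (sre_and _ _ (sre_of_pp _ h1) (sre_and _ _ ?_ ?_)))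
  · fun_prop
  · fun_prop

end TypicalDegree


namespace TypicalDegree

/-! ## Joins -/

theorem tred_refl (X : ℕ → Bool) : TRed X X := ⟨.oracle, rfl⟩

theorem join_even (A B : ℕ → Bool) (n : ℕ) : join A B (2 * n) = A n := by
  simp [join]

theorem join_odd (A B : ℕ → Bool) (n : ℕ) : join A B (2 * n + 1) = B n := by
  have : (2 * n + 1) / 2 = n := by omega
  simp [join, this]

theorem tred_join_left (A B : ℕ → Bool) : TRed A (join A B) := by
  refine tred_of_sre (Q := fun w n b => w[2 * n]? = some b) (by fun_prop) ?_ ?_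
  · intro n
    exact ⟨2 * n + 1, by rw [pre_getElem?_of_lt _ (by omega), join_even]⟩
  · intro k n b h
    rw [pre_getElem?] at h
    split_ifs at h
    rw [join_even] at h
    exact (Option.some.inj h).symm

theorem tred_join_right (A B : ℕ → Bool) : TRed B (join A B) := by
  refine tred_of_sre (Q := fun w n b => w[2 * n + 1]? = some b) (by fun_prop) ?_ ?_
  · intro n
    exact ⟨2 * n + 2, by rw [pre_getElem?_of_lt _ (by omega), join_odd]⟩
  · intro k n b h
    rw [pre_getElem?] at h
    split_ifs at h
    rw [join_odd] at h
    exact (Option.some.inj h).symm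

theorem sre_Comp' {α : Type*} [Primcodable α] (c : OracleCode) (f g : α → List Bool)
    (hf : Primrec f) (hg : Primrec g) : SRE (fun x => Comp c (f x) (g x)) :=
  sre_comp _ (fun x => (f x, g x)) (sre_Comp c) (by fun_prop)

attribute [fun_prop] sre_Comp'

theorem tred_join {A B C : ℕ → Bool} (hA : TRed A C) (hB : TRed B C) : TRed (join A B) C := by
  obtain ⟨c, hc⟩ := hA
  obtain ⟨d, hd⟩ := hB
  refine tred_of_sre (Q := fun w n b => (n % 2 = 0 ∧ ∃ v, Comp c w v ∧ v[n/2]? = some b) ∨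
    (n % 2 = 1 ∧ ∃ v, Comp d w v ∧ v[n/2]? = some b)) (by fun_prop) ?_ ?_
  · intro n
    rcases Nat.mod_two_eq_zero_or_one n with h | h
    · obtain ⟨k, hk⟩ := exists_Comp hc (n / 2 + 1)
      refine ⟨k, Or.inl ⟨h, _, hk, ?_⟩⟩
      rw [pre_getElem?_of_lt _ (by omega)]
      simp [join, h]
    · obtain ⟨k, hk⟩ := exists_Comp hd (n / 2 + 1)
      refine ⟨k, Or.inr ⟨h, _, hk, ?_⟩⟩
      rw [pre_getElem?_of_lt _ (by omega)]
      simp [join, h]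
  · rintro k n b (⟨h, v, hv, hb⟩ | ⟨h, v, hv, hb⟩)
    · have := (pre_eq_iff _ _).1 (Comp.prefix_of_eval hc hv) _ _ hb
      simp [join, h, this]
    · have := (pre_eq_iff _ _).1 (Comp.prefix_of_eval hd hv) _ _ hb
      simp [join, h, this]

/-- Join of strings. -/
def joinStr (α β : List Bool) : List Bool :=
  (List.range (2 * (List.range α.length).countP (fun i => decide (i < β.length)))).map (fun n =>
    cond (decide (n % 2 = 0)) ((α[n / 2]?).getD false) ((β[n / 2]?).getD false))

theorem countP_range_lt (a b : ℕ) : (List.range a).countP (fun i => decide (i < b)) = min a b := by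
  induction a with
  | zero => simp
  | succ a ih =>
    rw [List.range_succ, List.countP_append, ih]
    simp only [List.countP_singleton, decide_eq_true_eq]
    split_ifs <;> omega

theorem joinStr_getElem? (α β : List Bool) (n : ℕ) : (joinStr α β)[n]? =
    if n < 2 * min α.length β.length then
      some (if n % 2 = 0 then (α[n / 2]?).getD false else (β[n / 2]?).getD false) else none := by
  unfold joinStr
  rw [countP_range_lt]
  split_ifs with h h2 <;> simp [h, *]

theorem prim_joinStr : Primrec (fun x : List Bool × List Bool => joinStr x.1 x.2) := by
  have h : Primrec (fun x : List Bool × List Bool =>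
      min x.1.length x.2.length) := Primrec.nat_min.comp (by fun_prop) (by fun_prop)
  unfold joinStr
  simp only [countP_range_lt]
  refine Primrec.list_map (by fun_prop) ?_
  show Primrec (fun y : (List Bool × List Bool) × ℕ => cond (decide (y.2 % 2 = 0))
    ((y.1.1[y.2 / 2]?).getD false) ((y.1.2[y.2 / 2]?).getD false))
  fun_prop

theorem prefix_of_get {α : Type*} {l l' : List α}
    (h : ∀ (i : ℕ) (a : α), l[i]? = some a → l'[i]? = some a) : l <+: l' := by
  rw [List.prefix_iff_eq_take]
  apply List.ext_getElem?
  intro i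
  rw [List.getElem?_take]
  split_ifs with hi
  · rw [List.getElem?_eq_getElem hi, h i _ (List.getElem?_eq_getElem hi)]
  · rw [List.getElem?_eq_none]; omega

theorem joinStr_mono {α β α' β' : List Bool} (h1 : α <+: α') (h2 : β <+: β') :
    joinStr α β <+: joinStr α' β' := by
  apply prefix_of_get
  intro i b hb
  rw [joinStr_getElem?] at *
  have l1 := h1.length_le
  have l2 := h2.length_le
  by_cases h3 : i < 2 * min α.length β.length
  swap
  · rw [if_neg h3] at hb; cases hb
  rw [if_pos h3] at hb
  rw [if_pos (by omega), ← hb]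
  have e1 : i / 2 < α.length := by omega
  have e2 : i / 2 < β.length := by omega
  rw [pfx_get h1 (List.getElem?_eq_getElem e1), pfx_get h2 (List.getElem?_eq_getElem e2),
    List.getElem?_eq_getElem e1, List.getElem?_eq_getElem e2]

theorem joinStr_pre (A B : ℕ → Bool) (n k : ℕ) :
    joinStr (pre A n) (pre B k) = pre (join A B) (2 * min n k) := by
  apply List.ext_getElem?
  intro i
  rw [joinStr_getElem?, pre_getElem? (join A B)]
  simp only [pre_length]
  by_cases h1 : i < 2 * min n k
  · rw [if_pos h1, if_pos h1, pre_getElem?_of_lt A (show i / 2 < n by omega),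
      pre_getElem?_of_lt B (show i / 2 < k by omega)]
    simp [join]
  · rw [if_neg h1, if_neg h1]

/-! ## The forcing step: data -/

/-- Incompatible strings. -/
def Inc (u v : List Bool) : Prop := ¬ u <+: v ∧ ¬ v <+: u

theorem Inc.symm {u v : List Bool} (h : Inc u v) : Inc v u := ⟨h.2, h.1⟩

@[fun_prop] theorem pp_Inc {α : Type*} [Primcodable α] (f g : α → List Bool) (hf : Primrec f)
    (hg : Primrec g) : PrimrecPred (fun x => Inc (f x) (g x)) := by
  unfold Inc; fun_prop

theorem prefix_comparable {u v w : List Bool} (h1 : u <+: w) (h2 : v <+: w) : u <+: v ∨ v <+: u :=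
  List.prefix_or_prefix_of_prefix h1 h2

theorem Inc.not_both {u v w : List Bool} (h : Inc u v) (h1 : u <+: w) (h2 : v <+: w) : False := by
  rcases prefix_comparable h1 h2 with h' | h'
  · exact h.1 h'
  · exact h.2 h'

theorem Inc.ext {u v u' v' : List Bool} (h : Inc u v) (h1 : u <+: u') (h2 : v <+: v') :
    Inc u' v' :=
  ⟨fun h' => h.not_both (h1.trans h') h2, fun h' => h.not_both h1 (h2.trans h')⟩

/-- An entry: a string and a list of (node, value) pairs indexed by colors. -/
abbrev Ent := List Bool × List (List Bool × List Bool)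

/-- A key: name, level, color, entries. -/
abbrev Key := ℕ × ℕ × ℕ × List Ent

/-- Base data of the forcing step. -/
structure Base where
  T : List Bool → List Bool → Prop
  N : List Bool → List Bool → List Bool → Prop
  b0 : List Bool
  phi : OracleCode
  T_sre : SRE (fun x : List Bool × List Bool => T x.1 x.2)
  N_sre : SRE (fun x : List Bool × List Bool × List Bool => N x.1 x.2.1 x.2.2)
  T_mono : ∀ α α' β, T α β → α <+: α' → T α' β
  N_T : ∀ α β w, N α β w → T α β
  N_mono : ∀ α α' β w, N α β w → α <+: α' → N α' β w
  N_ext : ∀ α β β' w, N α β w → β <+: β' → T α β' → N α β' w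
  N_down : ∀ α β w w', N α β w → w' <+: w → N α β w'
  N_cons : ∀ α β w w', N α β w → N α β w' → w <+: w' ∨ w' <+: w
  N_nil : ∀ α β, T α β → N α β []

namespace Base
variable (S : Base)

@[fun_prop] theorem sre_T {α : Type*} [Primcodable α] (f g : α → List Bool) (hf : Primrec f)
    (hg : Primrec g) : SRE (fun x => S.T (f x) (g x)) :=
  sre_comp _ (fun x => (f x, g x)) S.T_sre (by fun_prop)

@[fun_prop] theorem sre_N {α : Type*} [Primcodable α] (f g h : α → List Bool) (hf : Primrec f)
    (hg : Primrec g) (hh : Primrec h) : SRE (fun x => S.N (f x) (g x) (h x)) :=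
  sre_comp _ (fun x => (f x, g x, h x)) S.N_sre (by fun_prop)

/-- Number of colors. -/
def KK (ν j : ℕ) : ℕ := 4 * 2 ^ (4 * Nat.pair ν j + 8)

@[fun_prop] theorem prim_KK {α : Type*} [Primcodable α] (f g : α → ℕ) (hf : Primrec f)
    (hg : Primrec g) : Primrec (fun x => KK (f x) (g x)) := by
  unfold KK; fun_prop

/-- The set of oracles strings mapping into the domain of `D`. -/
def LamSet (D : List Ent) : Set (List Bool) := {ρ | ∃ e ∈ D, Comp S.phi ρ e.1}

/-- First part of `Check`. -/
def Check1 (q : Key) (ds : List (List Ent)) (D : List Ent) : Prop :=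
  ∀ e ∈ D, (∃ ep ∈ q.2.2.2, ep.1 <+: e.1 ∧ ep.1[q.2.1]? = some (decide (q.2.2.1 % 2 = 1)) ∧
    ∃ p, ep.2[4 * ds.length + q.2.2.1]? = some p ∧
      ∀ l ∈ List.range (KK q.1 ds.length), ∃ x, e.2[l]? = some x ∧ p.1 <+: x.1 ∧ S.N e.1 x.1 x.2) ∧
    (∀ d ∈ ds, ∀ e' ∈ d, Inc e.1 e'.1) ∧ q.2.1 + 1 < e.1.length

/-- Second part of `Check`. -/
def Check2 (q : Key) (j : ℕ) (D : List Ent) : Prop :=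
  ∀ e ∈ D, ∀ e' ∈ D, (¬ e.1 <+: e'.1 ∨ e = e') ∧ ∀ l ∈ List.range (KK q.1 j),
    ∀ l' ∈ List.range (KK q.1 j), l = l' ∨
      ∃ x x', e.2[l]? = some x ∧ e'.2[l']? = some x' ∧ Inc x.2 x'.2

/-- Legitimate candidates for a new version. -/
def Check (y : Key × List (List Ent)) (D : List Ent) : Prop :=
  S.Check1 y.1 y.2 D ∧ Check2 y.1 y.2.length D ∧ Big (S.LamSet D) (y.1.1 + 4)

theorem sre_Check : SRE (fun x : (Key × List (List Ent)) × List Ent => S.Check x.1 x.2) := by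
  unfold Check
  refine sre_and _ _ ?_ (sre_and _ _ ?_ ?_)
  · unfold Check1
    apply sre_ball
    · fun_prop
    · refine sre_and _ _ ?_ (by fun_prop)
      apply sre_ex
      refine sre_and _ _ (by fun_prop) (sre_and _ _ (by fun_prop) (sre_and _ _ (by fun_prop) ?_))
      apply sre_ex
      refine sre_and _ _ (by fun_prop) ?_
      apply sre_ball
      · fun_prop
      · fun_prop
  · unfold Check2
    apply sre_ball
    · fun_prop
    · apply sre_ball
      · fun_prop
      · refine sre_and _ _ (sre_of_pp _ (by fun_prop)) ?_
        apply sre_ball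
        · fun_prop
        · apply sre_ball
          · fun_prop
          · fun_prop
  · apply sre_Big (fun x : (Key × List (List Ent)) × List Ent => S.LamSet x.2)
    · fun_prop
    · unfold LamSet
      simp only [Set.mem_setOf_eq]
      fun_prop

/-- Selection of a version. -/
noncomputable def Sel : (Key × List (List Ent)) → List Ent → Prop := S.sre_Check.uniformize.choose

theorem sre_Sel : SRE (fun x : (Key × List (List Ent)) × List Ent => S.Sel x.1 x.2) :=
  S.sre_Check.uniformize.choose_spec.1
theorem Sel_check {y D} (h : S.Sel y D) : S.Check y D :=
  S.sre_Check.uniformize.choose_spec.2.1 y D h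
theorem Sel_fun {y D D'} (h : S.Sel y D) (h' : S.Sel y D') : D = D' :=
  S.sre_Check.uniformize.choose_spec.2.2.1 y D D' h h'
theorem Sel_tot {y D} (h : S.Check y D) : ∃ D', S.Sel y D' :=
  S.sre_Check.uniformize.choose_spec.2.2.2 y D h

/-- `ds` is a list of successive versions. -/
def Ver (q : Key) (ds : List (List Ent)) : Prop :=
  ∀ i ∈ List.range ds.length, ∃ d, ds[i]? = some d ∧ S.Sel (q, ds.take i) d

/-- `D` is version number `j`. -/
def Dsel (q : Key) (j : ℕ) (D : List Ent) : Prop :=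
  ∃ ds : List (List Ent), ds.length = j ∧ S.Ver q ds ∧ S.Sel (q, ds) D

/-- One step from a configuration to a later one. -/
def Step (x y : Key × ℕ) : Prop :=
  S.Dsel x.1 x.2 y.1.2.2.2 ∧ y.1.2.2.1 < 4 ∧
    y.1.1 = 4 * Nat.pair x.1.1 x.2 + y.1.2.2.1 + 1 ∧ y.1.2.1 = x.1.2.1 + 1 ∧
    y.2 < 2 ^ (y.1.1 + 4)

@[fun_prop] theorem sre_Sel' {α : Type*} [Primcodable α] (f : α → Key × List (List Ent))
    (g : α → List Ent) (hf : Primrec f) (hg : Primrec g) : SRE (fun x => S.Sel (f x) (g x)) :=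
  sre_comp _ (fun x => (f x, g x)) S.sre_Sel (by fun_prop)

theorem sre_Ver0 : SRE (fun x : Key × List (List Ent) => S.Ver x.1 x.2) := by
  unfold Ver
  apply sre_ball
  · fun_prop
  · fun_prop

@[fun_prop] theorem sre_Ver {α : Type*} [Primcodable α] (f : α → Key)
    (g : α → List (List Ent)) (hf : Primrec f) (hg : Primrec g) :
    SRE (fun x => S.Ver (f x) (g x)) :=
  sre_comp _ (fun x => (f x, g x)) S.sre_Ver0 (by fun_prop)

theorem sre_Dsel0 : SRE (fun x : Key × ℕ × List Ent => S.Dsel x.1 x.2.1 x.2.2) := by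
  unfold Dsel; fun_prop

@[fun_prop] theorem sre_Dsel {α : Type*} [Primcodable α] (f : α → Key) (j : α → ℕ)
    (g : α → List Ent) (hf : Primrec f) (hj : Primrec j) (hg : Primrec g) :
    SRE (fun x => S.Dsel (f x) (j x) (g x)) :=
  sre_comp _ (fun x => (f x, j x, g x)) S.sre_Dsel0 (by fun_prop)

theorem sre_Step : SRE (fun x : (Key × ℕ) × (Key × ℕ) => S.Step x.1 x.2) := by
  unfold Step; fun_prop

end Base

end TypicalDegree


namespace TypicalDegree
open MeasureTheory
open scoped ENNReal
namespace Base
variable (S : Base)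

/-- Primitive recursive stage predicate for `T`. -/
noncomputable def Tq : (List Bool × List Bool) × ℕ → Prop := S.T_sre.choose

theorem pp_Tq0 : PrimrecPred S.Tq := S.T_sre.choose_spec.1

@[fun_prop] theorem pp_Tq {α : Type*} [Primcodable α] (f : α → (List Bool × List Bool) × ℕ)
    (hf : Primrec f) : PrimrecPred (fun x => S.Tq (f x)) := pp_comp _ _ S.pp_Tq0 hf

theorem T_iff (α β : List Bool) : S.T α β ↔ ∃ s, S.Tq ((α, β), s) :=
  S.T_sre.choose_spec.2 (α, β)

/-- Splitting above `β` relative to `α`. -/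
def Spl (α β : List Bool) : Prop :=
  ∃ β' β'' w' w'' : List Bool, β <+: β' ∧ β <+: β'' ∧ S.N α β' w' ∧ S.N α β'' w'' ∧ Inc w' w''

theorem sre_Spl0 : SRE (fun x : List Bool × List Bool => S.Spl x.1 x.2) := by
  unfold Spl
  refine sre_ex _ (sre_ex _ (sre_ex _ (sre_ex _ ?_)))
  fun_prop

@[fun_prop] theorem sre_Spl {α : Type*} [Primcodable α] (f g : α → List Bool) (hf : Primrec f)
    (hg : Primrec g) : SRE (fun x => S.Spl (f x) (g x)) :=
  sre_comp _ (fun x => (f x, g x)) S.sre_Spl0 (by fun_prop)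

theorem Spl.mono {S : Base} {α α' β : List Bool} (h : S.Spl α β) (h' : α <+: α') : S.Spl α' β := by
  obtain ⟨β', β'', w', w'', h1, h2, h3, h4, h5⟩ := h
  exact ⟨β', β'', w', w'', h1, h2, S.N_mono _ _ _ _ h3 h', S.N_mono _ _ _ _ h4 h', h5⟩

/-- The splitting requirement up to `n`. -/
def SplReq (n : ℕ) (α : List Bool) : Prop :=
  ∀ t ∈ List.range n, (Encodable.decode t : Option ((List Bool × List Bool) × ℕ)) = none ∨
    ∃ z : (List Bool × List Bool) × ℕ, Encodable.decode t = some z ∧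
      (¬ (z.1.1 <+: α ∧ S.b0 <+: z.1.2 ∧ S.Tq z) ∨ S.Spl α z.1.2)

theorem sre_SplReq0 : SRE (fun x : ℕ × List Bool => S.SplReq x.1 x.2) := by
  unfold SplReq
  apply sre_ball
  · fun_prop
  · refine sre_or _ _ (by fun_prop) (sre_ex _ (sre_and _ _ (by fun_prop)
      (sre_or _ _ (sre_of_pp _ (by fun_prop)) (by fun_prop))))

@[fun_prop] theorem sre_SplReq {α : Type*} [Primcodable α] (f : α → ℕ) (g : α → List Bool)
    (hf : Primrec f) (hg : Primrec g) : SRE (fun x => S.SplReq (f x) (g x)) :=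
  sre_comp _ (fun x => (f x, g x)) S.sre_SplReq0 (by fun_prop)

/-- `α` is in the domain of `q`. -/
def Dom (q : Key) (α : List Bool) : Prop :=
  ∃ ep ∈ q.2.2.2, ep.1 <+: α ∧ ep.1[q.2.1]? = some (decide (q.2.2.1 % 2 = 1))

/-- `α` is unresolved at stage `n`. -/
def Unres (n : ℕ) (q : Key) (ds : List (List Ent)) (α : List Bool) : Prop :=
  n ≤ α.length ∧ Dom q α ∧ (∀ d ∈ ds, ∀ e ∈ d, ¬ e.1 <+: α) ∧ S.SplReq n α

/-- Oracle strings whose image is unresolved. -/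
def WW (n : ℕ) (q : Key) (ds : List (List Ent)) : Set (List Bool) :=
  {ρ | ∃ α, Comp S.phi ρ α ∧ S.Unres n q ds α}

theorem sre_WW : SRE (fun x : (ℕ × Key × List (List Ent)) × List Bool =>
    x.2 ∈ S.WW x.1.1 x.1.2.1 x.1.2.2) := by
  unfold WW Unres Dom
  simp only [Set.mem_setOf_eq]
  refine sre_ex _ (sre_and _ _ (by fun_prop) (sre_and _ _ (by fun_prop) (sre_and _ _ (by fun_prop)
    (sre_and _ _ (sre_of_pp _ (by fun_prop)) (by fun_prop)))))

theorem WW_up (n : ℕ) (q : Key) (ds : List (List Ent)) : UpClosed (S.WW n q ds) := by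
  rintro σ τ ⟨α, h1, h2⟩ h
  exact ⟨α, h1.mono h, h2⟩

theorem WW_anti {n n' : ℕ} (h : n ≤ n') (q : Key) (ds : List (List Ent)) :
    S.WW n' q ds ⊆ S.WW n q ds := by
  rintro ρ ⟨α, h1, h2, h3, h4, h5⟩
  refine ⟨α, h1, h.trans h2, h3, h4, fun t ht => h5 t ?_⟩
  simp only [List.mem_range] at *; omega

theorem LamSet_up (D : List Ent) : UpClosed (S.LamSet D) := by
  rintro σ τ ⟨e, h1, h2⟩ h
  exact ⟨e, h1, h2.mono h⟩

/-! ### Versions -/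

theorem Ver.get {S : Base} {q : Key} {ds : List (List Ent)} (h : S.Ver q ds) {i : ℕ} {d : List Ent}
    (hd : ds[i]? = some d) : S.Sel (q, ds.take i) d := by
  have hi : i < ds.length := by
    by_contra hi
    rw [List.getElem?_eq_none (by omega)] at hd; cases hd
  obtain ⟨d', h1, h2⟩ := h i (by simpa using hi)
  rw [hd] at h1; cases h1; exact h2

theorem Ver.take {S : Base} {q : Key} {ds : List (List Ent)} (h : S.Ver q ds) (i : ℕ) :
    S.Ver q (ds.take i) := by
  intro k hk
  simp only [List.length_take, List.mem_range] at hk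
  obtain ⟨d, h1, h2⟩ := h k (by simp; omega)
  refine ⟨d, ?_, ?_⟩
  · rw [List.getElem?_take, if_pos (by omega), h1]
  · rw [List.take_take, min_eq_left (by omega)]; exact h2

theorem Ver.snoc {S : Base} {q : Key} {ds : List (List Ent)} (h : S.Ver q ds) {D : List Ent}
    (hD : S.Sel (q, ds) D) : S.Ver q (ds ++ [D]) := by
  intro k hk
  simp only [List.length_append, List.length_singleton, List.mem_range] at hk
  rcases Nat.lt_succ_iff_lt_or_eq.1 hk with hk | hk
  · obtain ⟨d, h1, h2⟩ := h k (by simpa using hk)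
    refine ⟨d, ?_, ?_⟩
    · rw [List.getElem?_append_left hk, h1]
    · rw [List.take_append_of_le_length (by omega)]; exact h2
  · subst hk
    exact ⟨D, by simp, by simpa using hD⟩

theorem Ver.unique {S : Base} {q : Key} {ds ds' : List (List Ent)} (h : S.Ver q ds)
    (h' : S.Ver q ds') (hl : ds.length ≤ ds'.length) : ds <+: ds' := by
  have key : ∀ n ≤ ds.length, ds.take n = ds'.take n := by
    intro n
    induction n with
    | zero => simp
    | succ n ih =>
      intro hn
      have ih := ih (by omega)
      obtain ⟨d, h1, h2⟩ := h n (by simp; omega)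
      obtain ⟨d', h1', h2'⟩ := h' n (by simp; omega)
      rw [ih] at h2
      have := S.Sel_fun h2 h2'
      subst this
      rw [List.take_add_one, List.take_add_one, ih, h1, h1']
  have := key _ le_rfl
  rw [List.take_length] at this
  rw [List.prefix_iff_eq_take]; exact this

theorem Dsel_fun {q : Key} {j : ℕ} {D D' : List Ent} (h : S.Dsel q j D) (h' : S.Dsel q j D') :
    D = D' := by
  obtain ⟨ds, rfl, h2, h3⟩ := h
  obtain ⟨ds', h1', h2', h3'⟩ := h'
  have : ds = ds' := (h2.unique h2' h1'.ge).eq_of_length h1'.symm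
  subst this
  exact S.Sel_fun h3 h3'

theorem max_unique {q : Key} {ds ds' : List (List Ent)} (h : S.Ver q ds) (h' : S.Ver q ds')
    (hm : ¬ ∃ D, S.Sel (q, ds) D) (hm' : ¬ ∃ D, S.Sel (q, ds') D) : ds = ds' := by
  have aux : ∀ {ds ds' : List (List Ent)}, S.Ver q ds → S.Ver q ds' →
      (¬ ∃ D, S.Sel (q, ds) D) → ¬ ds.length < ds'.length := by
    intro ds ds' h h' hm hl
    obtain ⟨d, h1, h2⟩ := h' ds.length (by simpa using hl)
    have := h.unique h' hl.le
    rw [List.prefix_iff_eq_take] at this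
    rw [← this] at h2
    exact hm ⟨d, h2⟩
  have h1 := aux h h' hm
  have h2 := aux h' h hm'
  exact (h.unique h' (by omega)).eq_of_length (by omega)

theorem Ver.disjoint {S : Base} {q : Key} {ds : List (List Ent)} (h : S.Ver q ds) {i k : ℕ}
    {d d' : List Ent} (hik : i < k) (hd : ds[i]? = some d) (hd' : ds[k]? = some d')
    {e e' : Ent} (he : e ∈ d) (he' : e' ∈ d') : Inc e.1 e'.1 := by
  have := (S.Sel_check (h.get hd')).1 e' he'
  refine (this.2.1 d ?_ e he).symm
  rw [List.mem_iff_getElem?]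
  exact ⟨i, by rw [List.getElem?_take, if_pos hik, hd]⟩

theorem openOf_LamSet_disjoint {D D' : List Ent} (h : ∀ e ∈ D, ∀ e' ∈ D', Inc e.1 e'.1) :
    Disjoint (openOf (S.LamSet D)) (openOf (S.LamSet D')) := by
  rw [Set.disjoint_left]
  intro X h1 h2
  rw [mem_openOf_up (S.LamSet_up _)] at h1 h2
  obtain ⟨n, e, he, hc⟩ := h1
  obtain ⟨n', e', he', hc'⟩ := h2
  have hc := hc.mono (pre_pfx X (le_max_left n n'))
  have hc' := hc'.mono (pre_pfx X (le_max_right n n'))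
  rcases hc.consistent hc' with h' | h'
  · exact (h e he e' he').1 h'
  · exact (h e he e' he').2 h'

theorem Ver.length_lt {S : Base} {q : Key} {ds : List (List Ent)} (h : S.Ver q ds) :
    ds.length < 2 ^ (q.1 + 4) := by
  rcases Nat.eq_zero_or_pos ds.length with h0 | h0
  · rw [h0]; positivity
  have hget : ∀ i : Fin ds.length, ds[i.1]? = some (ds.get i) := by
    intro i; simp
  have hdis : Pairwise (Function.onFun Disjoint
      (fun i : Fin ds.length => openOf (S.LamSet (ds.get i)))) := by
    intro i k hik
    rcases lt_or_gt_of_ne (fun h => hik (Fin.ext h) : i.1 ≠ k.1) with hl | hl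
    · exact S.openOf_LamSet_disjoint fun e he e' he' => h.disjoint hl (hget i) (hget k) he he'
    · exact S.openOf_LamSet_disjoint fun e he e' he' =>
        (h.disjoint hl (hget k) (hget i) he' he).symm
  have h1 := measure_iUnion (μ := mu) hdis (fun i => measurableSet_openOf _)
  rw [tsum_fintype] at h1
  have h2 : ∀ i : Fin ds.length, (2 : ℝ≥0∞)⁻¹ ^ (q.1 + 4) < mu (openOf (S.LamSet (ds.get i))) := by
    intro i
    exact (big_iff (S.LamSet_up _) _).1 (S.Sel_check (h.get (hget i))).2.2
  have h3 : ∑ i : Fin ds.length, (2 : ℝ≥0∞)⁻¹ ^ (q.1 + 4) < 1 := by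
    refine lt_of_lt_of_le (b := ∑ i : Fin ds.length, mu (openOf (S.LamSet (ds.get i)))) ?_ ?_
    · apply ENNReal.sum_lt_sum_of_nonempty
      · exact ⟨⟨0, h0⟩, Finset.mem_univ _⟩
      · intro i _; exact h2 i
    · rw [← h1]; exact prob_le_one
  rw [Finset.sum_const, Finset.card_univ, Fintype.card_fin, nsmul_eq_mul, ← two_inv_pow,
    ← div_eq_mul_inv, ENNReal.div_lt_iff (by left; simp) (by left; simp), one_mul] at h3
  exact_mod_cast h3

theorem exists_max (q : Key) : ∃ ds, S.Ver q ds ∧ ¬ ∃ D, S.Sel (q, ds) D := by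
  by_contra hcon
  push Not at hcon
  have : ∀ n : ℕ, ∃ ds, S.Ver q ds ∧ ds.length = n := by
    intro n
    induction n with
    | zero => exact ⟨[], by intro i hi; simp at hi, rfl⟩
    | succ n ih =>
      obtain ⟨ds, h1, h2⟩ := ih
      obtain ⟨D, hD⟩ := hcon ds h1
      exact ⟨_, h1.snoc hD, by simp [h2]⟩
  obtain ⟨ds, h1, h2⟩ := this (2 ^ (q.1 + 4))
  exact absurd h1.length_lt (by omega)

end Base
end TypicalDegree


namespace TypicalDegree
open MeasureTheory
open scoped ENNReal

/-! ## Random colorings -/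

theorem coloring (K : ℕ) (hK : 0 < K) : ∃ k : ℕ, ∀ (V ι : Type) [Fintype V] [DecidableEq V]
    (s : Finset ι) (m : ι → ℝ) (_ : ∀ i, 0 ≤ m i) (Sf : ι → Finset V)
    (_ : ∀ i ∈ s, (Sf i).card = k), ∃ (f : V → Fin K) (s' : Finset ι), s' ⊆ s ∧
      (∀ i ∈ s', ∀ c, ∃ v ∈ Sf i, f v = c) ∧ (∑ i ∈ s, m i) / 2 ≤ ∑ i ∈ s', m i := by
  classical
  have hK' : (0 : ℝ) < K := by exact_mod_cast hK
  obtain ⟨k, hk⟩ : ∃ k : ℕ, (((K : ℝ) - 1) / K) ^ k < 1 / (2 * K) := by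
    apply exists_pow_lt_of_lt_one (by positivity)
    rw [div_lt_one hK']; linarith
  refine ⟨k, ?_⟩
  intro V ι _ _ s m hm Sf hSf
  let P : ι → (V → Fin K) → Prop := fun i f => ∀ c, ∃ v ∈ Sf i, f v = c
  have hbad : ∀ i ∈ s, ((Finset.univ.filter (fun f => ¬ P i f)).card : ℝ) ≤
      (K : ℝ) ^ Fintype.card V / 2 := by
    intro i hi
    have h1 : (Finset.univ.filter (fun f => ¬ P i f)) ⊆ Finset.univ.biUnion (fun c : Fin K =>
        Fintype.piFinset (fun v => if v ∈ Sf i then Finset.univ.erase c else Finset.univ)) := by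
      intro f hf
      simp only [Finset.mem_filter, Finset.mem_univ, true_and, P, not_forall, not_exists,
        not_and] at hf
      obtain ⟨c, hc⟩ := hf
      simp only [Finset.mem_biUnion, Finset.mem_univ, true_and, Fintype.mem_piFinset]
      refine ⟨c, fun v => ?_⟩
      split_ifs with hv
      · simpa using hc v hv
      · simp
    have h2 : ∀ c : Fin K, ((Fintype.piFinset (fun v => if v ∈ Sf i then Finset.univ.erase c
        else Finset.univ)).card : ℝ) = (K : ℝ) ^ Fintype.card V * (((K : ℝ) - 1) / K) ^ k := by
      intro c
      rw [Fintype.card_piFinset]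
      push_cast
      have : ∀ v : V, (((if v ∈ Sf i then Finset.univ.erase c
        else Finset.univ : Finset (Fin K)).card : ℕ) : ℝ) =
          (K : ℝ) * (if v ∈ Sf i then ((K : ℝ) - 1) / K else 1) := by
        intro v
        split_ifs
        · rw [Finset.card_erase_of_mem (Finset.mem_univ _), Finset.card_univ, Fintype.card_fin,
            Nat.cast_sub (by omega)]
          field_simp
          simp
        · simp
      rw [Finset.prod_congr rfl (fun v _ => this v), Finset.prod_mul_distrib, Finset.prod_const,
        Finset.card_univ, Finset.prod_ite_mem, Finset.univ_inter, Finset.prod_const, hSf i hi]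
    calc ((Finset.univ.filter (fun f => ¬ P i f)).card : ℝ)
        ≤ ((Finset.univ.biUnion (fun c : Fin K => Fintype.piFinset
          (fun v => if v ∈ Sf i then Finset.univ.erase c else Finset.univ))).card : ℝ) := by
          exact_mod_cast Finset.card_le_card h1
      _ ≤ ∑ c : Fin K, ((Fintype.piFinset (fun v => if v ∈ Sf i then Finset.univ.erase c
        else Finset.univ)).card : ℝ) := by exact_mod_cast Finset.card_biUnion_le
      _ = K * ((K : ℝ) ^ Fintype.card V * (((K : ℝ) - 1) / K) ^ k) := by
          rw [Finset.sum_congr rfl (fun c _ => h2 c)]; simp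
      _ = (K : ℝ) ^ Fintype.card V * (K * (((K : ℝ) - 1) / K) ^ k) := by ring
      _ ≤ (K : ℝ) ^ Fintype.card V * (K * (1 / (2 * K))) := by gcongr
      _ = (K : ℝ) ^ Fintype.card V / 2 := by field_simp
  have hgood : ∀ i ∈ s, (K : ℝ) ^ Fintype.card V / 2 ≤
      ((Finset.univ.filter (fun f => P i f)).card : ℝ) := by
    intro i hi
    have h1 := hbad i hi
    have h2 := Finset.card_filter_add_card_filter_not (s := (Finset.univ : Finset (V → Fin K)))
      (fun f => P i f)
    rw [Finset.card_univ, Fintype.card_fun, Fintype.card_fin] at h2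
    have h3 : ((Finset.univ.filter (fun f => P i f)).card : ℝ) +
      ((Finset.univ.filter (fun f => ¬ P i f)).card : ℝ) = (K : ℝ) ^ Fintype.card V := by
      exact_mod_cast h2
    linarith
  have hsum : ∑ f : V → Fin K, (∑ i ∈ s, m i) / 2 ≤
      ∑ f : V → Fin K, ∑ i ∈ s.filter (fun i => P i f), m i := by
    simp_rw [Finset.sum_filter]
    rw [Finset.sum_comm]
    have : ∀ i ∈ s, (K : ℝ) ^ Fintype.card V / 2 * m i ≤
        ∑ f : V → Fin K, if P i f then m i else 0 := by
      intro i hi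
      rw [← Finset.sum_filter, Finset.sum_const, nsmul_eq_mul]
      exact mul_le_mul_of_nonneg_right (hgood i hi) (hm i)
    refine le_trans (le_of_eq ?_) (Finset.sum_le_sum this)
    rw [Finset.sum_const, Finset.card_univ, Fintype.card_fun, Fintype.card_fin, ← Finset.mul_sum,
      nsmul_eq_mul]
    push_cast
    ring
  haveI : Nonempty (Fin K) := ⟨⟨0, hK⟩⟩
  obtain ⟨f, -, hf⟩ := Finset.exists_le_of_sum_le Finset.univ_nonempty hsum
  exact ⟨f, s.filter (fun i => P i f), Finset.filter_subset _ _,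
    fun i hi => (Finset.mem_filter.1 hi).2, hf⟩

/-! ## Continuity from below -/

theorem exists_lt_of_eventually {E : Set (ℕ → Bool)} {F : ℕ → Set (ℕ → Bool)} {c : ℝ≥0∞}
    (hc : c < mu E) (h : ∀ X ∈ E, ∃ n0, ∀ n ≥ n0, X ∈ F n) : ∃ n0, ∀ n ≥ n0, c < mu (F n) := by
  let G : ℕ → Set (ℕ → Bool) := fun n0 => {X | ∀ n ≥ n0, X ∈ F n}
  have hG : Monotone G := fun a b hab X hX n hn => hX n (le_trans hab hn)
  have hE : E ⊆ ⋃ n, G n := by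
    intro X hX
    obtain ⟨n0, hn⟩ := h X hX
    exact Set.mem_iUnion.2 ⟨n0, hn⟩
  have ht := tendsto_measure_iUnion_atTop (μ := mu) hG
  have hlt : c < mu (⋃ n, G n) := lt_of_lt_of_le hc (measure_mono hE)
  obtain ⟨n0, hn0⟩ := (ht.eventually (lt_mem_nhds hlt)).exists
  exact ⟨n0, fun n hn => lt_of_lt_of_le hn0 (measure_mono fun X hX => hX n hn)⟩

namespace Base
variable (S : Base)

/-! ## Many values above a node -/

/-- `X` has the splitting property above `b0`. -/
def SplX (X : ℕ → Bool) : Prop :=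
  ∀ l β, S.b0 <+: β → S.T (pre X l) β → ∃ l', S.Spl (pre X l') β

theorem value_step {α β β' β'' w w' w'' : List Bool} (h1 : β <+: β') (h2 : β <+: β'')
    (h : S.N α β w) (h' : S.N α β' w') (h'' : S.N α β'' w'') (hI : Inc w' w'') :
    w <+: w' ∧ w.length < w'.length := by
  have c1 := S.N_cons _ _ _ _ (S.N_ext _ _ _ _ h h1 (S.N_T _ _ _ h')) h'
  have c2 := S.N_cons _ _ _ _ (S.N_ext _ _ _ _ h h2 (S.N_T _ _ _ h'')) h''
  have hn : ¬ w' <+: w := by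
    intro hw
    rcases c2 with c2 | c2
    · exact hI.1 (hw.trans c2)
    · exact hI.not_both hw c2
  rcases c1 with c1 | c1
  · refine ⟨c1, lt_of_le_of_ne c1.length_le fun hl => hn ?_⟩
    rw [c1.eq_of_length hl]
  · exact absurd c1 hn

theorem prefix_of_len {u v w : List Bool} (h : u <+: w ∨ w <+: u) (hl : u.length ≤ w.length) :
    u <+: w := by
  rcases h with h | h
  · exact h
  · rw [h.eq_of_length (le_antisymm h.length_le hl)]

/-- Long values exist. -/
theorem exists_value {X : ℕ → Bool} (hX : S.SplX X) (L : ℕ) : ∀ l β, S.b0 <+: β →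
    S.T (pre X l) β → ∃ l' β' w, β <+: β' ∧ w.length = L ∧ S.N (pre X l') β' w := by
  induction L with
  | zero => intro l β _ h2; exact ⟨l, β, [], List.prefix_rfl, rfl, S.N_nil _ _ h2⟩
  | succ L ih =>
    intro l β h1 h2
    obtain ⟨l1, β1, w, h3, h4, h5⟩ := ih l β h1 h2
    obtain ⟨l2, β', β'', w', w'', a1, a2, a3, a4, a5⟩ := hX l1 β1 (h1.trans h3) (S.N_T _ _ _ h5)
    have p1 := pre_pfx X (le_max_left l1 l2)
    have p2 := pre_pfx X (le_max_right l1 l2)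
    have b3 := S.N_mono _ _ _ _ a3 p2
    have b4 := S.N_mono _ _ _ _ a4 p2
    have b5 := S.N_mono _ _ _ _ h5 p1
    obtain ⟨c1, c2⟩ := S.value_step a1 a2 b5 b3 b4 a5
    refine ⟨_, β', w'.take (L + 1), h3.trans a1, ?_, S.N_down _ _ _ _ b3 (List.take_prefix _ _)⟩
    rw [List.length_take]; omega

/-- `k` values of length `L` above `β`. -/
def Vals (α β : List Bool) (L : ℕ) (F : Finset (List Bool)) : Prop :=
  ∀ w ∈ F, w.length = L ∧ ∃ β', β <+: β' ∧ S.N α β' w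

theorem Vals.mono {S : Base} {α α' β : List Bool} {L : ℕ} {F : Finset (List Bool)}
    (h : S.Vals α β L F) (h' : α <+: α') : S.Vals α' β L F := by
  intro w hw
  obtain ⟨h1, β', h2, h3⟩ := h w hw
  exact ⟨h1, β', h2, S.N_mono _ _ _ _ h3 h'⟩

theorem exists_vals {X : ℕ → Bool} (hX : S.SplX X) (k : ℕ) : ∀ l β, S.b0 <+: β →
    S.T (pre X l) β → ∃ L0, ∀ L ≥ L0, ∃ l0, ∃ F : Finset (List Bool), F.card = k ∧
      S.Vals (pre X l0) β L F := by
  classical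
  induction k with
  | zero =>
    intro l β _ _
    exact ⟨0, fun L _ => ⟨0, ∅, rfl, fun w hw => absurd hw (Finset.notMem_empty _)⟩⟩
  | succ k ih =>
    intro l β h1 h2
    obtain ⟨l2, β', β'', w', w'', a1, a2, a3, a4, a5⟩ := hX l β h1 h2
    obtain ⟨L0, hL0⟩ := ih l2 β' (h1.trans a1) (S.N_T _ _ _ a3)
    refine ⟨max L0 (max w'.length w''.length), fun L hL => ?_⟩
    obtain ⟨l3, F, hF, hV⟩ := hL0 L (le_trans (le_max_left _ _) hL)
    have hL1 : w'.length ≤ L := le_trans (le_trans (le_max_left _ _) (le_max_right _ _)) hL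
    have hL2 : w''.length ≤ L := le_trans (le_trans (le_max_right _ _) (le_max_right _ _)) hL
    obtain ⟨l4, γ, w, g1, g2, g3⟩ := S.exists_value hX L l2 β'' (h1.trans a2) (S.N_T _ _ _ a4)
    obtain ⟨M, m2, m3, m4⟩ : ∃ M, l2 ≤ M ∧ l3 ≤ M ∧ l4 ≤ M :=
      ⟨max l2 (max l3 l4), by simp, by simp, by simp⟩
    have a3 := S.N_mono _ _ _ _ a3 (pre_pfx X m2)
    have a4 := S.N_mono _ _ _ _ a4 (pre_pfx X m2)
    have g3 := S.N_mono _ _ _ _ g3 (pre_pfx X m4)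
    have hV := hV.mono (pre_pfx X m3)
    have hw : w ∉ F := by
      intro hw
      obtain ⟨hl, δ, d1, d2⟩ := hV w hw
      have e1 := prefix_of_len (v := []) (S.N_cons _ _ _ _ (S.N_ext _ _ _ _ a3 d1 (S.N_T _ _ _ d2)) d2)
        (by omega)
      have e2 := prefix_of_len (v := []) (S.N_cons _ _ _ _ (S.N_ext _ _ _ _ a4 g1 (S.N_T _ _ _ g3)) g3)
        (by omega)
      exact a5.not_both e1 e2
    refine ⟨M, insert w F, by rw [Finset.card_insert_of_notMem hw, hF], ?_⟩
    intro v hv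
    rcases Finset.mem_insert.1 hv with rfl | hv
    · exact ⟨g2, γ, a2.trans g1, g3⟩
    · obtain ⟨d0, δ, d1, d2⟩ := hV v hv
      exact ⟨d0, δ, a1.trans d1, d2⟩

end Base
end TypicalDegree


namespace TypicalDegree
open MeasureTheory
open scoped ENNReal
namespace Base
variable (S : Base)

/-- Invariant of reachable keys. -/
structure Inv (q : Key) : Prop where
  anti : ∀ e ∈ q.2.2.2, ∀ e' ∈ q.2.2.2, e.1 <+: e'.1 → e = e'
  len : ∀ e ∈ q.2.2.2, q.2.1 < e.1.length
  ent : ∀ e ∈ q.2.2.2, ∀ l < 4 * 2 ^ (q.1 + 4), ∃ x, e.2[l]? = some x ∧ S.N e.1 x.1 x.2 ∧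
    S.b0 <+: x.1
  c4 : q.2.2.1 < 4

theorem exists_seq {R : ℕ → Bool} (h : ∀ n, ∃ k α, n ≤ α.length ∧ Comp S.phi (pre R k) α) :
    ∃ X : ℕ → Bool, ∀ k α, Comp S.phi (pre R k) α → α = pre X α.length := by
  choose k α h1 h2 using h
  refine ⟨fun i => ((α (i + 1))[i]?).getD false, ?_⟩
  intro k' α' h'
  rw [pre_eq_iff]
  intro i b hb
  have hi : i < (α (i + 1)).length := h1 (i + 1)
  have c1 := (h2 (i + 1)).mono (pre_pfx R (le_max_left (k (i + 1)) k'))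
  have c2 := h'.mono (pre_pfx R (le_max_right (k (i + 1)) k'))
  rcases c1.consistent c2 with hp | hp
  · have := pfx_get hp (List.getElem?_eq_getElem hi)
    rw [hb] at this
    cases this
    rw [List.getElem?_eq_getElem hi]; rfl
  · rw [pfx_get hp hb]; rfl

/-- Good strings for the next version. -/
def GG (q : Key) (ds : List (List Ent)) (k L l : ℕ) (α : List Bool) : Prop :=
  α.length = l ∧ q.2.1 + 1 < l ∧ (∀ d ∈ ds, ∀ e' ∈ d, Inc α e'.1) ∧
    ∃ ep ∈ q.2.2.2, ep.1 <+: α ∧ ep.1[q.2.1]? = some (decide (q.2.2.1 % 2 = 1)) ∧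
      ∃ p, ep.2[4 * ds.length + q.2.2.1]? = some p ∧
        ∃ F : Finset (List Bool), F.card = k ∧ S.Vals α p.1 L F

/-- Oracles mapping into good strings. -/
def OO (q : Key) (ds : List (List Ent)) (k L l : ℕ) : Set (ℕ → Bool) :=
  {R | ∃ α, S.GG q ds k L l α ∧ R ∈ openOf {ρ | Comp S.phi ρ α}}

theorem comp_up (α : List Bool) : UpClosed {ρ | Comp S.phi ρ α} := by
  intro σ τ h h'
  exact Comp.mono h h'

theorem mem_OO {q : Key} {ds : List (List Ent)} (hI : S.Inv q) (hV : S.Ver q ds) (k : ℕ)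
    {R : ℕ → Bool} (hR : ∀ n, R ∈ openOf (S.WW n q ds)) :
    ∃ L0, ∀ L ≥ L0, ∃ l0, ∀ l ≥ l0, R ∈ S.OO q ds k L l := by
  have hR' : ∀ n, ∃ k α, Comp S.phi (pre R k) α ∧ S.Unres n q ds α := by
    intro n
    have := hR n
    rw [mem_openOf_up (S.WW_up _ _ _)] at this
    obtain ⟨k, α, h⟩ := this
    exact ⟨k, α, h⟩
  obtain ⟨X, hX⟩ := S.exists_seq (R := R) (fun n => by
    obtain ⟨k, α, h1, h2⟩ := hR' n
    exact ⟨k, α, h2.1, h1⟩)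
  have hR2 : ∀ n, ∃ k l, n ≤ l ∧ Comp S.phi (pre R k) (pre X l) ∧ S.Unres n q ds (pre X l) := by
    intro n
    obtain ⟨k, α, h1, h2⟩ := hR' n
    refine ⟨k, α.length, h2.1, ?_⟩
    rw [← hX k α h1]; exact ⟨h1, h2⟩
  have hcomp : ∀ l, ∃ k, Comp S.phi (pre R k) (pre X l) := by
    intro l
    obtain ⟨k, l', h1, h2, _⟩ := hR2 l
    exact ⟨k, h2.down (pre_pfx X h1)⟩
  have hspl : S.SplX X := by
    intro l β hb hT
    obtain ⟨s, hs⟩ := (S.T_iff _ _).1 hT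
    obtain ⟨k, l', h1, h2, h3⟩ := hR2 (max l (Encodable.encode ((pre X l, β), s) + 1))
    refine ⟨l', ?_⟩
    have h4 := h3.2.2.2 (Encodable.encode ((pre X l, β), s)) (by
      rw [List.mem_range]; exact lt_of_lt_of_le (Nat.lt_succ_self _) (le_max_right _ _))
    rw [Encodable.encodek] at h4
    rcases h4 with h4 | ⟨z, hz, h4⟩
    · cases h4
    · cases hz
      rcases h4 with h4 | h4
      · exact absurd ⟨pre_pfx X (le_trans (le_max_left _ _) h1), hb, hs⟩ h4
      · exact h4
  obtain ⟨l1, ep, hep, hep1, hepb⟩ : ∃ l1, Dom q (pre X l1) := by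
    obtain ⟨k, l, _, _, h⟩ := hR2 0
    exact ⟨l, h.2.1⟩
  have hjc : 4 * ds.length + q.2.2.1 < 4 * 2 ^ (q.1 + 4) := by
    have := hV.length_lt; have := hI.c4; omega
  obtain ⟨p, hp, hpN, hpb⟩ := hI.ent ep hep _ hjc
  have hepN := S.N_mono _ _ _ _ hpN hep1
  obtain ⟨L0, hL0⟩ := S.exists_vals hspl k l1 p.1 hpb (S.N_T _ _ _ hepN)
  refine ⟨L0, fun L hL => ?_⟩
  obtain ⟨l2, F, hF, hVal⟩ := hL0 L hL
  obtain ⟨M, hM⟩ : ∃ M, ∀ d ∈ ds, ∀ e ∈ d, e.1.length ≤ M := by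
    let f : List ℕ := ds.flatten.map (fun e => e.1.length)
    refine ⟨f.sum, fun d hd e he => List.single_le_sum (by simp) _ ?_⟩
    exact List.mem_map.2 ⟨e, List.mem_flatten.2 ⟨d, hd, he⟩, rfl⟩
  refine ⟨l1 + l2 + M + q.2.1 + 2, fun l hl => ?_⟩
  obtain ⟨kk, hk⟩ := hcomp l
  refine ⟨pre X l, ⟨by simp, by omega, ?_, ep, hep, hep1.trans (pre_pfx X (by omega)), hepb, p, hp,
    F, hF, hVal.mono (pre_pfx X (by omega))⟩, ?_⟩
  · intro d hd e he
    obtain ⟨k3, l3, h31, _, h33⟩ := hR2 l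
    have hne : ¬ e.1 <+: pre X l := fun h => h33.2.2.1 d hd e he (h.trans (pre_pfx X h31))
    refine ⟨fun h => hne ?_, hne⟩
    have h5 : (pre X l).length ≤ e.1.length := h.length_le
    rw [h.eq_of_length]
    have := hM d hd e he
    simp at *; omega
  · rw [mem_openOf_up (S.comp_up _)]
    exact ⟨kk, hk⟩

theorem found {q : Key} {ds : List (List Ent)} (hI : S.Inv q) (hV : S.Ver q ds)
    (h : (2 : ℝ≥0∞)⁻¹ ^ (q.1 + 3) < mu (⋂ n, openOf (S.WW n q ds))) :
    ∃ D, S.Check (q, ds) D := by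
  classical
  set K := KK q.1 ds.length with hKdef
  have hK : 0 < K := by rw [hKdef]; unfold KK; positivity
  obtain ⟨k, hk⟩ := coloring K hK
  obtain ⟨L, hL⟩ := exists_lt_of_eventually
    (F := fun L => {R | ∃ l0, ∀ l ≥ l0, R ∈ S.OO q ds k L l}) h (fun R hR =>
      S.mem_OO hI hV k (by simpa using hR))
  obtain ⟨l, hl⟩ := exists_lt_of_eventually (F := fun l => S.OO q ds k L l) (hL L le_rfl)
    (fun R hR => hR)
  have hl := hl l le_rfl
  have hfin : {α | S.GG q ds k L l α}.Finite :=
    (List.finite_length_eq Bool l).subset (fun α hα => hα.1)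
  let s := hfin.toFinset
  have hs : ∀ α, α ∈ s ↔ S.GG q ds k L l α := fun α => hfin.mem_toFinset
  let T : Finset (List Bool) := (List.finite_length_eq Bool L).toFinset
  have hT : ∀ w, w ∈ T ↔ w.length = L := fun w => (List.finite_length_eq Bool L).mem_toFinset
  have hG : ∀ α ∈ s, ∃ (p : List Bool × List Bool) (F : Finset (List Bool)), F.card = k ∧
      S.Vals α p.1 L F ∧ ∃ ep ∈ q.2.2.2, ep.1 <+: α ∧
      ep.1[q.2.1]? = some (decide (q.2.2.1 % 2 = 1)) ∧
      ep.2[4 * ds.length + q.2.2.1]? = some p := by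
    intro α hα
    obtain ⟨_, _, _, ep, h1, h2, h3, p, h4, F, h5, h6⟩ := (hs α).1 hα
    exact ⟨p, F, h5, h6, ep, h1, h2, h3, h4⟩
  choose! p F hFc hFv hep using hG
  let C : List Bool → Set (ℕ → Bool) := fun α => openOf {ρ | Comp S.phi ρ α}
  obtain ⟨f, s', hss, hhit, hsum⟩ := hk T (List Bool) s (fun α => (mu (C α)).toReal)
    (fun α => ENNReal.toReal_nonneg) (fun α => (F α).subtype (· ∈ T)) (by
      intro α hα
      rw [Finset.card_subtype, Finset.filter_true_of_mem, hFc α hα]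
      intro w hw
      exact (hT w).2 (hFv α hα w hw).1)
  -- the entries
  have hen : ∀ α ∈ s', ∃ en : Ent, en.1 = α ∧ ∀ c : Fin K, ∃ x, en.2[c.1]? = some x ∧
      (p α).1 <+: x.1 ∧ S.N α x.1 x.2 ∧ ∃ hx : x.2 ∈ T, f ⟨x.2, hx⟩ = c := by
    intro α hα
    have : ∀ c : Fin K, ∃ x : List Bool × List Bool, (p α).1 <+: x.1 ∧ S.N α x.1 x.2 ∧
        ∃ hx : x.2 ∈ T, f ⟨x.2, hx⟩ = c := by
      intro c
      obtain ⟨v, hv, hc⟩ := hhit α hα c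
      rw [Finset.mem_subtype] at hv
      obtain ⟨h1, β, h2, h3⟩ := hFv α (hss hα) v.1 hv
      exact ⟨(β, v.1), h2, h3, v.2, hc⟩
    choose x hx using this
    refine ⟨(α, List.ofFn x), rfl, fun c => ⟨x c, ?_, hx c⟩⟩
    rw [List.getElem?_ofFn]; simp
  choose! en hen1 hen2 using hen
  have hmem : ∀ e, e ∈ s'.toList.map en ↔ ∃ α ∈ s', en α = e := by
    intro e; simp
  refine ⟨s'.toList.map en, ?_, ?_, ?_⟩
  · intro e he
    obtain ⟨α, hα, rfl⟩ := (hmem e).1 he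
    obtain ⟨ep, h1, h2, h3, h4⟩ := hep α (hss hα)
    obtain ⟨g1, g2, g3, _⟩ := (hs α).1 (hss hα)
    rw [hen1 α hα]
    refine ⟨⟨ep, h1, h2, h3, p α, h4, ?_⟩, g3, by rw [g1]; exact g2⟩
    intro c hc
    obtain ⟨x, x1, x2, x3, _⟩ := hen2 α hα ⟨c, by simpa using hc⟩
    exact ⟨x, x1, x2, x3⟩
  · intro e he e' he'
    obtain ⟨α, hα, rfl⟩ := (hmem e).1 he
    obtain ⟨α', hα', rfl⟩ := (hmem e').1 he'
    rw [hen1 α hα, hen1 α' hα']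
    constructor
    · by_cases hp : α <+: α'
      · right
        rw [hp.eq_of_length]
        rw [((hs α).1 (hss hα)).1, ((hs α').1 (hss hα')).1]
      · exact Or.inl hp
    · intro c hc c' hc'
      rw [List.mem_range] at hc hc'
      rcases eq_or_ne c c' with heq | hne
      · exact Or.inl heq
      right
      obtain ⟨x, x1, x2, x3, x4, x5⟩ := hen2 α hα ⟨c, hc⟩
      obtain ⟨y, y1, y2, y3, y4, y5⟩ := hen2 α' hα' ⟨c', hc'⟩
      refine ⟨x, y, x1, y1, ?_⟩
      have hxy : x.2 ≠ y.2 := by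
        intro heq
        apply hne
        have : (⟨x.2, x4⟩ : T) = ⟨y.2, y4⟩ := Subtype.ext heq
        rw [this, y5] at x5
        exact (congrArg Fin.val x5).symm
      have hlen : x.2.length = y.2.length := by rw [(hT _).1 x4, (hT _).1 y4]
      exact ⟨fun h => hxy (h.eq_of_length hlen), fun h => hxy (h.eq_of_length hlen.symm).symm⟩
  · rw [big_iff (S.LamSet_up _)]
    have hU : openOf (S.LamSet (s'.toList.map en)) = ⋃ α ∈ s', C α := by
      ext R
      simp only [Set.mem_iUnion, C, exists_prop]
      simp only [mem_openOf_up (S.LamSet_up _), mem_openOf_up (S.comp_up _)]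
      constructor
      · rintro ⟨n, e, he, hc⟩
        obtain ⟨α, hα, rfl⟩ := (hmem e).1 he
        rw [hen1 α hα] at hc
        exact ⟨α, hα, n, hc⟩
      · rintro ⟨α, hα, n, hc⟩
        refine ⟨n, en α, (hmem _).2 ⟨α, hα, rfl⟩, ?_⟩
        rw [hen1 α hα]; exact hc
    have hdis : (↑s' : Set (List Bool)).PairwiseDisjoint C := by
      intro α hα α' hα' hne
      have hlen : α.length = α'.length := by
        rw [((hs α).1 (hss hα)).1, ((hs α').1 (hss hα')).1]
      have := S.openOf_LamSet_disjoint (D := [(α, [])]) (D' := [(α', [])]) (by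
        intro e he e' he'
        simp only [List.mem_singleton] at he he'
        subst he he'
        exact ⟨fun h => hne (h.eq_of_length hlen), fun h => hne (h.eq_of_length hlen.symm).symm⟩)
      simpa [LamSet] using this
    rw [hU, measure_biUnion_finset hdis (fun α _ => measurableSet_openOf _)]
    have h1 : mu (S.OO q ds k L l) ≤ ∑ α ∈ s, mu (C α) := by
      refine le_trans (measure_mono ?_) (measure_biUnion_finset_le s C)
      rintro R ⟨α, h1, h2⟩
      exact Set.mem_biUnion ((hs α).2 h1) h2
    have h2 := lt_of_lt_of_le hl h1
    have hfin1 : ∀ t : Finset (List Bool), ∑ α ∈ t, mu (C α) ≠ ⊤ := by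
      intro t
      exact (ENNReal.sum_lt_top.2 fun α _ => measure_lt_top _ _).ne
    rw [← ENNReal.toReal_lt_toReal (by simp) (hfin1 s), ENNReal.toReal_sum (by simp)] at h2
    rw [← ENNReal.toReal_lt_toReal (by simp) (hfin1 s'), ENNReal.toReal_sum (by simp)]
    have e1 : ((2 : ℝ≥0∞)⁻¹ ^ (q.1 + 4)).toReal = ((2 : ℝ≥0∞)⁻¹ ^ (q.1 + 3)).toReal / 2 := by
      rw [pow_succ, ENNReal.toReal_mul]
      simp [div_eq_mul_inv]
    rw [e1]
    linarith

/-- When there is no further version, the unresolved sets become small. -/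
theorem small {q : Key} {ds : List (List Ent)} (hI : S.Inv q) (hV : S.Ver q ds)
    (hm : ¬ ∃ D, S.Sel (q, ds) D) : ∃ n, ¬ Big (S.WW n q ds) (q.1 + 2) := by
  by_contra hcon
  push Not at hcon
  have h1 : ¬ (2 : ℝ≥0∞)⁻¹ ^ (q.1 + 3) < mu (⋂ n, openOf (S.WW n q ds)) := by
    intro h
    obtain ⟨D, hD⟩ := S.found hI hV h
    exact hm (S.Sel_tot hD)
  apply h1
  have ht := tendsto_measure_iInter_atTop (μ := mu) (s := fun n => openOf (S.WW n q ds))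
    (fun n => (measurableSet_openOf _).nullMeasurableSet)
    (fun a b hab => openOf_mono (S.WW_anti hab _ _)) ⟨0, measure_ne_top _ _⟩
  have h2 : (2 : ℝ≥0∞)⁻¹ ^ (q.1 + 2) ≤ mu (⋂ n, openOf (S.WW n q ds)) := by
    refine ge_of_tendsto' ht fun n => ?_
    exact ((big_iff (S.WW_up _ _ _) _).1 (hcon n)).le
  refine lt_of_lt_of_le ?_ h2
  rw [← two_inv_pow, ← two_inv_pow]
  apply ENNReal.inv_lt_inv.2
  exact_mod_cast Nat.pow_lt_pow_right (by norm_num) (by omega)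

end Base
end TypicalDegree


namespace TypicalDegree
open MeasureTheory
open scoped ENNReal
open Relation

/-- The situation of the main case of the forcing step. -/
structure Ctx where
  S : Base
  A : ℕ → Bool
  R : ℕ → Bool
  l0 : ℕ
  l0_pos : 0 < l0
  T0 : S.T (pre A l0) S.b0
  heval : OracleCode.eval (chi R) S.phi = chi A
  spl : S.SplX A

namespace Ctx
variable (Z : Ctx)

/-- The root key with name `i`. -/
def root (i : ℕ) : Key :=
  (i, 0, cond (Z.A 0) 1 0, [(pre Z.A Z.l0, List.replicate (4 * 2 ^ (i + 4)) (Z.S.b0, []))])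

theorem prim_root : Primrec Z.root := by
  unfold root; fun_prop

theorem inv_root (i : ℕ) : Z.S.Inv (Z.root i) := by
  refine ⟨?_, ?_, ?_, ?_⟩
  · intro e he e' he' _
    simp only [root, List.mem_singleton] at he he'
    rw [he, he']
  · intro e he
    simp only [root, List.mem_singleton] at he
    subst he
    simpa [root] using Z.l0_pos
  · intro e he l hl
    simp only [root, List.mem_singleton] at he hl
    subst he
    refine ⟨(Z.S.b0, []), ?_, Z.S.N_nil _ _ Z.T0, List.prefix_rfl⟩
    rw [List.getElem?_replicate, if_pos hl]
  · simp only [root]; cases Z.A 0 <;> simp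

theorem inv_step {S : Base} {x y : Key × ℕ} (hx : S.Inv x.1) (h : S.Step x y) : S.Inv y.1 := by
  obtain ⟨⟨ds, hds, hV, hS⟩, hc, hν, hm, hj⟩ := h
  obtain ⟨h1, h2, -⟩ := S.Sel_check hS
  refine ⟨?_, ?_, ?_, hc⟩
  · intro e he e' he' hp
    rcases (h2 e he e' he').1 with h | h
    · exact absurd hp h
    · exact h
  · intro e he
    rw [hm]; exact (h1 e he).2.2
  · intro e he l hl
    obtain ⟨⟨ep, g1, g2, g3, p, g4, g5⟩, -, -⟩ := h1 e he
    have hjc : 4 * ds.length + x.1.2.2.1 < 4 * 2 ^ (x.1.1 + 4) := by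
      have := hV.length_lt; have := hx.c4; omega
    obtain ⟨p', k1, k2, k3⟩ := hx.ent ep g1 _ hjc
    have : p = p' := by
      have := g4.symm.trans k1; exact Option.some.inj this
    subst this
    obtain ⟨z, z1, z2, z3⟩ := g5 l (by
      rw [List.mem_range]
      refine lt_of_lt_of_le hl ?_
      show _ ≤ 4 * 2 ^ (4 * Nat.pair x.1.1 ds.length + 8)
      refine Nat.mul_le_mul_left _ (Nat.pow_le_pow_right (by norm_num) ?_)
      rw [hν, hds]; omega)
    exact ⟨z, z1, z3, k3.trans z2⟩

theorem inv_reach {i j0 : ℕ} {x : Key × ℕ} (h : ReflTransGen Z.S.Step (Z.root i, j0) x) :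
    Z.S.Inv x.1 := by
  induction h with
  | refl => exact Z.inv_root i
  | tail _ h ih => exact inv_step ih h

theorem name_lt {S : Base} {x y : Key × ℕ} (h : S.Step x y) : x.1.1 < y.1.1 := by
  rw [h.2.2.1]
  have := Nat.left_le_pair x.1.1 x.2
  omega

theorem name_ge {i j0 : ℕ} {x : Key × ℕ} (h : ReflTransGen Z.S.Step (Z.root i, j0) x) :
    i ≤ x.1.1 := by
  induction h with
  | refl => exact le_rfl
  | tail _ h ih => exact ih.trans (name_lt h).le

theorem step_det {S : Base} {x x' y y' : Key × ℕ} (h : S.Step x y) (h' : S.Step x' y')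
    (hx : x.1 = x'.1) (hj : x.2 = x'.2) (hν : y.1.2.2.1 = y'.1.2.2.1) : y.1 = y'.1 := by
  obtain ⟨h1, h2, h3, h4, h5⟩ := h
  obtain ⟨h1', h2', h3', h4', h5'⟩ := h'
  rw [hx, hj] at h1 h3
  rw [hx] at h4
  have hD := S.Dsel_fun h1 h1'
  refine Prod.ext (by rw [h3, h3', hν]) (Prod.ext (by rw [h4, h4']) (Prod.ext hν hD))

theorem name_inj {i j0 j0' : ℕ} {x y : Key × ℕ} (hx : ReflTransGen Z.S.Step (Z.root i, j0) x)
    (hy : ReflTransGen Z.S.Step (Z.root i, j0') y) (h : x.1.1 = y.1.1) : x.1 = y.1 := by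
  induction hx generalizing y with
  | refl =>
    cases hy with
    | refl => rfl
    | tail h1 h2 =>
      have := Z.name_ge h1
      have := name_lt h2
      have : i = y.1.1 := h
      omega
  | @tail x1 x h1 h2 ih =>
    cases hy with
    | refl =>
      have := Z.name_ge h1
      have := name_lt h2
      have : x.1.1 = i := h
      omega
    | @tail y1 _ k1 k2 =>
      have e1 := h2.2.2.1
      have e2 := k2.2.2.1
      have c1 := h2.2.1
      have c2 := k2.2.1
      have ec : x.1.2.2.1 = y.1.2.2.1 := by omega
      have ep : Nat.pair x1.1.1 x1.2 = Nat.pair y1.1.1 y1.2 := by omega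
      obtain ⟨p1, p2⟩ := Nat.pair_eq_pair.1 ep
      exact step_det h2 k2 (ih k1 p1) p2 ec

/-- Witnesses for the test. -/
abbrev Wit := (ℕ × (Key × ℕ)) × (List (List Ent)) × ℕ

/-- Positive part of the test. -/
def P1 (i : ℕ) (σ : List Bool) (z : Wit) : Prop :=
  ReflTransGen Z.S.Step (Z.root i, z.1.1) z.1.2 ∧ Z.S.Ver z.1.2.1 z.2.1 ∧
    σ ∈ Z.S.WW z.2.2 z.1.2.1 z.2.1

/-- Negative part of the test. -/
def P2 (z : Wit) : Prop :=
  (∃ D, Z.S.Sel (z.1.2.1, z.2.1) D) ∨ Big (Z.S.WW z.2.2 z.1.2.1 z.2.1) (z.1.2.1.1 + 2)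

/-- The test. -/
def VV (i : ℕ) : Set (List Bool) := {σ | ∃ z : Wit, Z.P1 i σ z ∧ ¬ Z.P2 z}

theorem sre_reach {α : Type*} [Primcodable α] (f g : α → Key × ℕ) (hf : Primrec f)
    (hg : Primrec g) : SRE (fun x => ReflTransGen Z.S.Step (f x) (g x)) := by
  have := sre_rtg (α := Unit) (fun _ => Z.S.Step)
    (sre_comp _ (fun x : Unit × (Key × ℕ) × (Key × ℕ) => x.2) Z.S.sre_Step (by fun_prop))
  exact sre_comp _ (fun x => ((), f x, g x)) this (by fun_prop)

theorem VV_ce : UniformCEIn zeroJump Z.VV := by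
  apply uniformCE_zeroJump (β := Wit) (P1 := Z.P1) (P2 := fun _ _ => Z.P2)
  · unfold P1
    refine sre_and _ _ (Z.sre_reach _ _ ?_ (by fun_prop)) (sre_and _ _ (by fun_prop) ?_)
    · have : Primrec (fun x : (ℕ × List Bool) × Wit => Z.root x.1.1) :=
        Z.prim_root.comp (by fun_prop)
      fun_prop
    · exact sre_comp _ (fun x : (ℕ × List Bool) × Wit => ((x.2.2.2, x.2.1.2.1, x.2.2.1), x.1.2))
        Z.S.sre_WW (by fun_prop)
  · unfold P2
    refine sre_or _ _ (by fun_prop) ?_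
    apply sre_Big (fun x : (ℕ × List Bool) × Wit => Z.S.WW x.2.2.2 x.2.1.2.1 x.2.2.1)
    · fun_prop
    · exact sre_comp _ (fun x : ((ℕ × List Bool) × Wit) × List Bool =>
        ((x.1.2.2.2, x.1.2.1.2.1, x.1.2.2.1), x.2)) Z.S.sre_WW (by fun_prop)

/-- The part of the test with name `i + k`. -/
def EE (i k : ℕ) : Set (ℕ → Bool) :=
  {R | ∃ z : Wit, ReflTransGen Z.S.Step (Z.root i, z.1.1) z.1.2 ∧ Z.S.Ver z.1.2.1 z.2.1 ∧
    ¬ Z.P2 z ∧ z.1.2.1.1 = i + k ∧ R ∈ openOf (Z.S.WW z.2.2 z.1.2.1 z.2.1)}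

theorem mu_EE (i k : ℕ) : mu (Z.EE i k) ≤ (2 : ℝ≥0∞)⁻¹ ^ (i + k + 2) := by
  classical
  by_cases hne : ∃ n, ∃ z : Wit, ReflTransGen Z.S.Step (Z.root i, z.1.1) z.1.2 ∧
      Z.S.Ver z.1.2.1 z.2.1 ∧ ¬ Z.P2 z ∧ z.1.2.1.1 = i + k ∧ z.2.2 = n
  · obtain ⟨z, h1, h2, h3, h4, h5⟩ := Nat.find_spec hne
    have hsub : Z.EE i k ⊆ openOf (Z.S.WW z.2.2 z.1.2.1 z.2.1) := by
      rintro R ⟨y, g1, g2, g3, g4, g5⟩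
      have hle : Nat.find hne ≤ y.2.2 := Nat.find_min' hne ⟨y, g1, g2, g3, g4, rfl⟩
      have hq : y.1.2.1 = z.1.2.1 := Z.name_inj g1 h1 (by rw [g4, h4])
      unfold P2 at h3 g3
      push Not at h3 g3
      have hds : y.2.1 = z.2.1 := by
        rw [hq] at g2 g3
        exact Z.S.max_unique g2 h2 (by push Not; exact g3.1) (by push Not; exact h3.1)
      rw [hq, hds] at g5
      rw [h5]
      exact openOf_mono (Z.S.WW_anti hle _ _) g5
    refine (measure_mono hsub).trans ?_
    unfold P2 at h3
    push Not at h3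
    rw [big_iff (Z.S.WW_up _ _ _), h4] at h3
    exact not_lt.1 h3.2
  · have : Z.EE i k = ∅ := by
      ext R
      simp only [Set.mem_empty_iff_false, iff_false]
      rintro ⟨z, g1, g2, g3, g4, g5⟩
      exact hne ⟨z.2.2, z, g1, g2, g3, g4, rfl⟩
    rw [this]; simp

theorem VV_sub (i : ℕ) : openOf (Z.VV i) ⊆ ⋃ k, Z.EE i k := by
  rintro R ⟨σ, ⟨z, ⟨h1, h2, h3⟩, h4⟩, hR⟩
  have := Z.name_ge h1
  exact Set.mem_iUnion.2 ⟨z.1.2.1.1 - i, z, h1, h2, h4, by omega, σ, h3, hR⟩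

theorem VV_test : MLTest zeroJump Z.VV := by
  refine ⟨Z.VV_ce, fun i => ?_⟩
  have h1 : mu (openOf (Z.VV i)) ≤ (2 : ℝ≥0∞)⁻¹ ^ (i + 1) := by
    calc mu (openOf (Z.VV i)) ≤ mu (⋃ k, Z.EE i k) := measure_mono (Z.VV_sub i)
      _ ≤ ∑' k, mu (Z.EE i k) := measure_iUnion_le _
      _ ≤ ∑' k, (2 : ℝ≥0∞)⁻¹ ^ (i + k + 2) := ENNReal.tsum_le_tsum (Z.mu_EE i)
      _ = ∑' k, (2 : ℝ≥0∞)⁻¹ ^ (i + 2) * (2 : ℝ≥0∞)⁻¹ ^ k := by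
          congr 1; ext k; rw [← pow_add]; congr 1; omega
      _ = (2 : ℝ≥0∞)⁻¹ ^ (i + 2) * 2 := by
          rw [ENNReal.tsum_mul_left, ENNReal.tsum_geometric, ENNReal.one_sub_inv_two, inv_inv]
      _ = (2 : ℝ≥0∞)⁻¹ ^ (i + 1) := by
          rw [show i + 2 = (i + 1) + 1 from rfl, pow_succ _ (i + 1), mul_assoc,
            ENNReal.inv_mul_cancel (by simp) (by simp), mul_one]
  refine lt_of_le_of_lt ((stringMeasure_le _).trans h1) ?_
  rw [← two_inv_pow, ← two_inv_pow]
  apply ENNReal.inv_lt_inv.2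
  exact_mod_cast Nat.pow_lt_pow_right (by norm_num) (by omega)

/-! ### Passing the test -/

theorem splReq (n : ℕ) : ∃ l1, ∀ l ≥ l1, Z.S.SplReq n (pre Z.A l) := by
  induction n with
  | zero => exact ⟨0, fun l _ t ht => by simp at ht⟩
  | succ n ih =>
    obtain ⟨l1, h1⟩ := ih
    have : ∃ l2, ∀ l ≥ l2, (Encodable.decode n : Option ((List Bool × List Bool) × ℕ)) = none ∨
        ∃ z : (List Bool × List Bool) × ℕ, Encodable.decode n = some z ∧
        (¬ (z.1.1 <+: (pre Z.A l) ∧ Z.S.b0 <+: z.1.2 ∧ Z.S.Tq z) ∨ Z.S.Spl (pre Z.A l) z.1.2) := by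
      cases hd : (Encodable.decode n : Option ((List Bool × List Bool) × ℕ)) with
      | none => exact ⟨0, fun l _ => Or.inl rfl⟩
      | some z =>
        by_cases hz : ∃ l, z.1.1 <+: (pre Z.A l) ∧ Z.S.b0 <+: z.1.2 ∧ Z.S.Tq z
        · obtain ⟨l, z1, z2, z3⟩ := hz
          have hT : Z.S.T (pre Z.A l) z.1.2 :=
            Z.S.T_mono _ _ _ ((Z.S.T_iff _ _).2 ⟨z.2, z3⟩) z1
          obtain ⟨l', hl'⟩ := Z.spl l _ z2 hT
          exact ⟨l', fun l hl => Or.inr ⟨z, rfl, Or.inr (hl'.mono (pre_pfx _ hl))⟩⟩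
        · exact ⟨0, fun l _ => Or.inr ⟨z, rfl, Or.inl fun h => hz ⟨l, h⟩⟩⟩
    obtain ⟨l2, h2⟩ := this
    refine ⟨max l1 l2, fun l hl t ht => ?_⟩
    rw [List.mem_range] at ht
    rcases Nat.lt_succ_iff_lt_or_eq.1 ht with ht | rfl
    · exact h1 l (le_trans (le_max_left _ _) hl) t (by simpa using ht)
    · exact h2 l (le_trans (le_max_right _ _) hl)

theorem resolve {i : ℕ} (hR : Z.R ∉ openOf (Z.VV i)) {j0 : ℕ} {x : Key × ℕ}
    (hx : ReflTransGen Z.S.Step (Z.root i, j0) x) {l : ℕ} (hd : Base.Dom x.1 (pre Z.A l)) :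
    ∃ j D, j < 2 ^ (x.1.1 + 4) ∧ Z.S.Dsel x.1 j D ∧ ∃ e ∈ D, ∃ l', e.1 <+: pre Z.A l' := by
  obtain ⟨ds, hV, hm⟩ := Z.S.exists_max x.1
  by_contra hcon
  have hno : ∀ d ∈ ds, ∀ e ∈ d, ∀ l', ¬ e.1 <+: pre Z.A l' := by
    intro d hd e he l' hp
    obtain ⟨j, hj⟩ := List.mem_iff_getElem?.1 hd
    have hjl : j < ds.length := by
      by_contra hc
      rw [List.getElem?_eq_none (by omega)] at hj; cases hj
    exact hcon ⟨j, d, hjl.trans hV.length_lt, ⟨ds.take j, by rw [List.length_take]; omega,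
      hV.take j, hV.get hj⟩, e, he, l', hp⟩
  obtain ⟨n, hn⟩ := Z.S.small (Z.inv_reach hx) hV hm
  apply hR
  obtain ⟨l1, h1⟩ := Z.splReq n
  set L := max l (max l1 n) with hL
  obtain ⟨k, hk⟩ := exists_Comp Z.heval L
  refine ⟨pre Z.R k, ⟨((j0, x), ds, n), ⟨hx, hV, pre Z.A L, hk, ?_, ?_, ?_, ?_⟩, ?_⟩, ?_⟩
  · simp [hL]
  · obtain ⟨ep, e1, e2, e3⟩ := hd
    exact ⟨ep, e1, e2.trans (pre_pfx _ (by simp [hL])), e3⟩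
  · intro d hd e he; exact hno d hd e he L
  · exact h1 L (by simp [hL])
  · rintro (h | h)
    · exact hm h
    · exact hn h
  · rw [extendsStr_iff]; simp

end Ctx
end TypicalDegree


namespace TypicalDegree
open Relation
namespace Ctx
variable (Z : Ctx)

/-- The node of configuration `x` seen by `α`. -/
def At (x : Key × ℕ) (α β w : List Bool) : Prop :=
  ∃ e ∈ x.1.2.2.2, e.1 <+: α ∧ e.1[x.1.2.1]? = some (decide (x.1.2.2.1 % 2 = 1)) ∧
    e.2[4 * x.2 + x.1.2.2.1]? = some (β, w)

theorem sre_At {γ : Type*} [Primcodable γ] (f : γ → Key × ℕ) (g h k : γ → List Bool)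
    (hf : Primrec f) (hg : Primrec g) (hh : Primrec h) (hk : Primrec k) :
    SRE (fun z => At (f z) (g z) (h z) (k z)) := by
  unfold At
  apply sre_of_pp
  fun_prop

theorem At.mono {x : Key × ℕ} {α α' β w : List Bool} (h : At x α β w) (h' : α <+: α') :
    At x α' β w := by
  obtain ⟨e, h1, h2, h3⟩ := h
  exact ⟨e, h1, h2.trans h', h3⟩

theorem At.unique {S : Base} {x : Key × ℕ} (hI : S.Inv x.1) {α β w β' w' : List Bool}
    (h : At x α β w) (h' : At x α β' w') : β = β' ∧ w = w' := by
  obtain ⟨e, h1, h2, h3, h4⟩ := h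
  obtain ⟨e', h1', h2', h3', h4'⟩ := h'
  have : e = e' := by
    rcases prefix_comparable h2 h2' with hp | hp
    · exact hI.anti e h1 e' h1' hp
    · exact (hI.anti e' h1' e h1 hp).symm
  subst this
  rw [h4] at h4'
  simpa using h4'

theorem At.spec {S : Base} {x : Key × ℕ} (hI : S.Inv x.1) (hj : x.2 < 2 ^ (x.1.1 + 4))
    {α β w : List Bool} (h : At x α β w) : S.N α β w ∧ S.b0 <+: β := by
  obtain ⟨e, h1, h2, h3, h4⟩ := h
  obtain ⟨y, g1, g2, g3⟩ := hI.ent e h1 (4 * x.2 + x.1.2.2.1) (by have := hI.c4; omega)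
  rw [h4] at g1
  cases g1
  exact ⟨S.N_mono _ _ _ _ g2 h2, g3⟩

theorem Dsel_lt {S : Base} {q : Key} {j : ℕ} {D : List Ent} (h : S.Dsel q j D) :
    j < 2 ^ (q.1 + 4) := by
  obtain ⟨ds, rfl, h, _⟩ := h
  exact h.length_lt

theorem Dsel_spec {S : Base} {q : Key} {j : ℕ} {D : List Ent} (h : S.Dsel q j D) {e : Ent}
    (he : e ∈ D) : q.2.1 + 1 < e.1.length ∧ ∃ β w, At (q, j) e.1 β w ∧ ∀ l < Base.KK q.1 j,
      ∃ x, e.2[l]? = some x ∧ β <+: x.1 := by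
  obtain ⟨ds, rfl, _, h⟩ := h
  obtain ⟨⟨ep, h1, h2, h3, p, h4, h5⟩, _, h6⟩ := (S.Sel_check h).1 e he
  refine ⟨h6, p.1, p.2, ⟨ep, h1, h2, h3, h4⟩, ?_⟩
  intro l hl
  obtain ⟨x, x1, x2, _⟩ := h5 l (by simpa using hl)
  exact ⟨x, x1, x2⟩

theorem Dsel_inc {S : Base} {q : Key} {j : ℕ} {D : List Ent} (h : S.Dsel q j D) {e e' : Ent}
    (he : e ∈ D) (he' : e' ∈ D) {l l' : ℕ} (hl : l < Base.KK q.1 j) (hl' : l' < Base.KK q.1 j)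
    (hne : l ≠ l') {x x' : List Bool × List Bool} (hx : e.2[l]? = some x)
    (hx' : e'.2[l']? = some x') : Inc x.2 x'.2 := by
  obtain ⟨ds, rfl, _, h⟩ := h
  rcases ((S.Sel_check h).2.1 e he e' he').2 l (by simpa using hl) l' (by simpa using hl')
    with h | ⟨y, y', h1, h2, h3⟩
  · exact absurd h hne
  · rw [hx] at h1; rw [hx'] at h2
    cases h1; cases h2; exact h3

theorem color_lt {S : Base} {x y : Key × ℕ} (h : S.Step x y) :
    4 * y.2 + y.1.2.2.1 < Base.KK x.1.1 x.2 := by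
  obtain ⟨_, h2, h3, _, h5⟩ := h
  have h6 : 2 ^ (y.1.1 + 4) ≤ 2 ^ (4 * Nat.pair x.1.1 x.2 + 8) :=
    Nat.pow_le_pow_right (by norm_num) (by omega)
  unfold Base.KK
  omega

/-- Nodes are monotone along steps. -/
theorem At.back {S : Base} {x y : Key × ℕ} (h : S.Step x y) {α β w : List Bool} (hy : At y α β w) :
    ∃ β' w', At x α β' w' ∧ β' <+: β := by
  obtain ⟨e, h1, h2, h3, h4⟩ := hy
  obtain ⟨_, β', w', g1, g2⟩ := Dsel_spec h.1 h1
  obtain ⟨z, z1, z2⟩ := g2 _ (color_lt h)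
  rw [h4] at z1
  cases z1
  exact ⟨β', w', g1.mono h2, z2⟩

theorem At.back_rtg {S : Base} {x y : Key × ℕ} (h : ReflTransGen S.Step x y) {α β w : List Bool}
    (hy : At y α β w) : ∃ β' w', At x α β' w' ∧ β' <+: β := by
  induction h generalizing β w with
  | refl => exact ⟨β, w, hy, List.prefix_rfl⟩
  | tail _ h ih =>
    obtain ⟨β', w', h1, h2⟩ := hy.back h
    obtain ⟨β'', w'', h3, h4⟩ := ih h1
    exact ⟨β'', w'', h3, h4.trans h2⟩

theorem level_rtg {S : Base} {x y : Key × ℕ} (h : ReflTransGen S.Step x y) :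
    x.1.2.1 ≤ y.1.2.1 ∧ (x.1.2.1 = y.1.2.1 → x = y) := by
  induction h with
  | refl => exact ⟨le_rfl, fun _ => rfl⟩
  | tail _ h ih =>
    have := h.2.2.2.1
    exact ⟨by omega, fun h => by omega⟩

/-- The new tree. -/
def TT (i j0 : ℕ) (α β : List Bool) : Prop :=
  ∃ (x : Key × ℕ) (D : List Ent) (w : List Bool), ReflTransGen Z.S.Step (Z.root i, j0) x ∧
    Z.S.Dsel x.1 x.2 D ∧ (∃ e ∈ D, e.1 <+: α) ∧ At x α β w

theorem sre_TT (i j0 : ℕ) : SRE (fun x : List Bool × List Bool => Z.TT i j0 x.1 x.2) := by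
  unfold TT
  refine sre_ex _ (sre_ex _ (sre_ex _ (sre_and _ _ (Z.sre_reach _ _ (by fun_prop) (by fun_prop))
    (sre_and _ _ (by fun_prop) (sre_and _ _ (by fun_prop)
      (sre_At _ _ _ _ (by fun_prop) (by fun_prop) (by fun_prop) (by fun_prop)))))))

theorem TT_mono {i j0 : ℕ} {α α' β : List Bool} (h : Z.TT i j0 α β) (h' : α <+: α') :
    Z.TT i j0 α' β := by
  obtain ⟨x, D, w, h1, h2, ⟨e, h3, h4⟩, h5⟩ := h
  exact ⟨x, D, w, h1, h2, ⟨e, h3, h4.trans h'⟩, h5.mono h'⟩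

theorem TT_spec {i j0 : ℕ} {α β : List Bool} (h : Z.TT i j0 α β) :
    Z.S.T α β ∧ Z.S.b0 <+: β := by
  obtain ⟨x, D, w, h1, h2, _, h5⟩ := h
  have := h5.spec (Z.inv_reach h1) (Dsel_lt h2)
  exact ⟨Z.S.N_T _ _ _ this.1, this.2⟩

/-- Live configurations. -/
def Live (i j0 : ℕ) (x : Key × ℕ) : Prop :=
  ReflTransGen Z.S.Step (Z.root i, j0) x ∧ ∃ D, Z.S.Dsel x.1 x.2 D ∧ ∃ e ∈ D, ∃ l,
    e.1 <+: pre Z.A l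

theorem Live.node {Z : Ctx} {i j0 : ℕ} {x : Key × ℕ} (h : Z.Live i j0 x) :
    ∃ l β w, At x (pre Z.A l) β w ∧ Z.TT i j0 (pre Z.A l) β := by
  obtain ⟨h1, D, h2, e, h3, l, h4⟩ := h
  obtain ⟨_, β, w, h5, _⟩ := Dsel_spec h2 h3
  have h6 := At.mono h5 h4
  exact ⟨l, β, w, h6, x, D, w, h1, h2, ⟨e, h3, h4⟩, h6⟩

theorem Live.next {Z : Ctx} {i j0 : ℕ} (hR : Z.R ∉ openOf (Z.VV i)) {x : Key × ℕ}
    (h : Z.Live i j0 x) (b : ℕ) (hb : b < 2) :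
    ∃ y, Z.S.Step x y ∧ Z.Live i j0 y ∧ y.1.2.2.1 / 2 = b := by
  obtain ⟨h1, D, h2, e, h3, l, h4⟩ := h
  obtain ⟨hl, _⟩ := Dsel_spec h2 h3
  set a : ℕ := cond (Z.A (x.1.2.1 + 1)) 1 0 with ha
  have ha2 : a < 2 := by rw [ha]; cases Z.A (x.1.2.1 + 1) <;> simp
  let q' : Key := (4 * Nat.pair x.1.1 x.2 + (2 * b + a) + 1, x.1.2.1 + 1, 2 * b + a, D)
  have hs : ∀ j, j < 2 ^ (q'.1 + 4) → Z.S.Step x (q', j) := fun j hj =>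
    ⟨h2, by show 2 * b + a < 4; omega, rfl, rfl, hj⟩
  have hd : Base.Dom q' (pre Z.A l) := by
    refine ⟨e, h3, h4, ?_⟩
    show e.1[x.1.2.1 + 1]? = some (decide ((2 * b + a) % 2 = 1))
    have e1 : (pre Z.A l)[x.1.2.1 + 1]? = some _ := pfx_get h4 (List.getElem?_eq_getElem hl)
    rw [List.getElem?_eq_getElem hl, ← e1]
    have hl2 : x.1.2.1 + 1 < l := by
      have := h4.length_le; simp at this; omega
    rw [pre_getElem?_of_lt _ hl2, Nat.mul_add_mod, ha]
    cases Z.A (x.1.2.1 + 1) <;> simp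
  obtain ⟨j, D', hj, hD', e', he', l', hl'⟩ :=
    Z.resolve hR (h1.tail (hs 0 (by positivity))) hd
  refine ⟨(q', j), hs j hj, ⟨h1.tail (hs j hj), D', hD', e', he', l', hl'⟩, ?_⟩
  show (2 * b + a) / 2 = b
  omega

theorem exists_root_live {i : ℕ} (hR : Z.R ∉ openOf (Z.VV i)) : ∃ j0, Z.Live i j0 (Z.root i, j0) := by
  have hd : Base.Dom (Z.root i) (pre Z.A Z.l0) := by
    refine ⟨_, List.mem_singleton.2 rfl, List.prefix_rfl, ?_⟩
    show (pre Z.A Z.l0)[0]? = some (decide ((cond (Z.A 0) 1 0 : ℕ) % 2 = 1))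
    rw [pre_getElem?_of_lt _ Z.l0_pos]
    rcases hA : Z.A 0 with _ | _ <;> simp
  obtain ⟨j, D, hj, hD, e, he, l, hl⟩ := Z.resolve hR (j0 := 0) (x := (Z.root i, 0)) .refl hd
  exact ⟨j, .refl, D, hD, e, he, l, hl⟩

theorem TT_live {i j0 l : ℕ} {β : List Bool} (h : Z.TT i j0 (pre Z.A l) β) :
    ∃ x w, Z.Live i j0 x ∧ At x (pre Z.A l) β w := by
  obtain ⟨x, D, w, h1, h2, ⟨e, h3, h4⟩, h5⟩ := h
  exact ⟨x, w, ⟨h1, D, h2, e, h3, l, h4⟩, h5⟩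

theorem TT_good {i j0 : ℕ} (hR : Z.R ∉ openOf (Z.VV i)) {l : ℕ} {β : List Bool}
    (h : Z.TT i j0 (pre Z.A l) β) : ∃ l' β' β'', β <+: β' ∧ β <+: β'' ∧ Inc β' β'' ∧
      Z.TT i j0 (pre Z.A l') β' ∧ Z.TT i j0 (pre Z.A l') β'' := by
  obtain ⟨x, w, hL, hA⟩ := Z.TT_live h
  obtain ⟨y, hs, hy, hyb⟩ := hL.next hR 0 (by norm_num)
  obtain ⟨y', hs', hy', hyb'⟩ := hL.next hR 1 (by norm_num)
  obtain ⟨m, β', w', h1, h2⟩ := hy.node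
  obtain ⟨m', β'', w'', h1', h2'⟩ := hy'.node
  obtain ⟨M, k1, k2, k3⟩ : ∃ M, l ≤ M ∧ m ≤ M ∧ m' ≤ M := ⟨max l (max m m'), by simp, by simp, by simp⟩
  have hA := hA.mono (pre_pfx Z.A k1)
  have h1 := h1.mono (pre_pfx Z.A k2)
  have h1' := h1'.mono (pre_pfx Z.A k3)
  have hI := Z.inv_reach hL.1
  have p1 : β <+: β' := by
    obtain ⟨γ, v, g1, g2⟩ := h1.back hs
    rw [(hA.unique hI g1).1]; exact g2
  have p2 : β <+: β'' := by
    obtain ⟨γ, v, g1, g2⟩ := h1'.back hs'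
    rw [(hA.unique hI g1).1]; exact g2
  refine ⟨M, β', β'', p1, p2, ?_, Z.TT_mono h2 (pre_pfx Z.A k2), Z.TT_mono h2' (pre_pfx Z.A k3)⟩
  have n1 := (h1.spec (Z.inv_reach hy.1) hs.2.2.2.2).1
  have n2 := (h1'.spec (Z.inv_reach hy'.1) hs'.2.2.2.2).1
  have hInc : Inc w' w'' := by
    obtain ⟨e, e1, e2, e3, e4⟩ := h1
    obtain ⟨e', e1', e2', e3', e4'⟩ := h1'
    have hD := Z.S.Dsel_fun hs.1 hs'.1
    rw [← hD] at e1'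
    refine Dsel_inc hs.1 e1 e1' (color_lt hs) (color_lt hs') ?_ e4 e4'
    intro heq
    have := hs.2.1
    have := hs'.2.1
    omega
  constructor
  · intro hp
    have := Z.S.N_cons _ _ _ _ (Z.S.N_ext _ _ _ _ n1 hp (Z.S.N_T _ _ _ n2)) n2
    rcases this with h | h
    · exact hInc.1 h
    · exact hInc.2 h
  · intro hp
    have := Z.S.N_cons _ _ _ _ (Z.S.N_ext _ _ _ _ n2 hp (Z.S.N_T _ _ _ n1)) n1
    rcases this with h | h
    · exact hInc.2 h
    · exact hInc.1 h

/-! ### Decoding -/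

/-- Step guided by the value string `u`. -/
def StepY (u : List Bool) (x y : Key × ℕ) : Prop :=
  Z.S.Step x y ∧ ∃ e ∈ y.1.2.2.2, ∃ p, e.2[4 * y.2 + y.1.2.2.1]? = some p ∧ p.2 <+: u

theorem StepY.mono {Z : Ctx} {u v : List Bool} (h : u <+: v) {x y : Key × ℕ} (hs : Z.StepY u x y) :
    Z.StepY v x y := by
  obtain ⟨h1, e, h2, p, h3, h4⟩ := hs
  exact ⟨h1, e, h2, p, h3, h4.trans h⟩

theorem StepY.unique {Z : Ctx} (u : List Bool) : Relator.RightUnique (Z.StepY u) := by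
  rintro x y y' ⟨h1, e, h2, p, h3, h4⟩ ⟨h1', e', h2', p', h3', h4'⟩
  have hD := Z.S.Dsel_fun h1.1 h1'.1
  rw [← hD] at h2'
  have heq : 4 * y.2 + y.1.2.2.1 = 4 * y'.2 + y'.1.2.2.1 := by
    by_contra hne
    exact (Dsel_inc h1.1 h2 h2' (color_lt h1) (color_lt h1') hne h3 h3').not_both h4 h4'
  have c1 := h1.2.1
  have c2 := h1'.2.1
  exact Prod.ext (step_det h1 h1' rfl rfl (by omega)) (by omega)

theorem sre_RY (r : Key × ℕ) : SRE (fun x : List Bool × (Key × ℕ) =>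
    ReflTransGen (Z.StepY x.1) r x.2) := by
  have h1 : SRE (fun x : List Bool × (Key × ℕ) × (Key × ℕ) => Z.StepY x.1 x.2.1 x.2.2) := by
    unfold StepY
    refine sre_and _ _ (sre_comp _ (fun x : List Bool × (Key × ℕ) × (Key × ℕ) => x.2) Z.S.sre_Step
      (by fun_prop)) (by fun_prop)
  exact sre_comp _ (fun x : List Bool × (Key × ℕ) => (x.1, r, x.2)) (sre_rtg _ h1) (by fun_prop)

theorem sre_RY' (r : Key × ℕ) {γ : Type*} [Primcodable γ] (f : γ → List Bool) (g : γ → Key × ℕ)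
    (hf : Primrec f) (hg : Primrec g) : SRE (fun x => ReflTransGen (Z.StepY (f x)) r (g x)) :=
  sre_comp _ (fun x => (f x, g x)) (Z.sre_RY r) (by fun_prop)

theorem RY_step {u : List Bool} {x y : Key × ℕ} (h : ReflTransGen (Z.StepY u) x y) :
    ReflTransGen Z.S.Step x y := by
  induction h with
  | refl => exact .refl
  | tail _ h2 ih => exact ih.tail h2.1

theorem RY_mono {u v : List Bool} (h : u <+: v) {x y : Key × ℕ}
    (hs : ReflTransGen (Z.StepY u) x y) : ReflTransGen (Z.StepY v) x y := by
  induction hs with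
  | refl => exact .refl
  | tail _ h2 ih => exact ih.tail (h2.mono h)

/-- Decoding `A`. -/
def QA (r : Key × ℕ) (u : List Bool) (n : ℕ) (b : Bool) : Prop :=
  ∃ x : Key × ℕ, ReflTransGen (Z.StepY u) r x ∧ x.1.2.1 = n ∧ b = decide (x.1.2.2.1 % 2 = 1)

theorem sre_QA (r : Key × ℕ) {γ : Type*} [Primcodable γ] (f : γ → List Bool) (g : γ → ℕ)
    (h : γ → Bool) (hf : Primrec f) (hg : Primrec g) (hh : Primrec h) :
    SRE (fun x => Z.QA r (f x) (g x) (h x)) := by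
  unfold QA
  exact sre_ex _ (sre_and _ _ (Z.sre_RY' r _ _ (by fun_prop) (by fun_prop)) (by fun_prop))

/-- Decoding `B`. -/
def QB (r : Key × ℕ) (u : List Bool) (n : ℕ) (b : Bool) : Prop :=
  ∃ x : Key × ℕ, ReflTransGen (Z.StepY u) r x ∧ ∃ e ∈ x.1.2.2.2,
    (∀ i ∈ List.range e.1.length, ∃ b', e.1[i]? = some b' ∧ Z.QA r u i b') ∧
    ∃ p, e.2[4 * x.2 + x.1.2.2.1]? = some p ∧ p.1[n]? = some b

theorem sre_QB (r : Key × ℕ) : SRE (fun x : List Bool × ℕ × Bool => Z.QB r x.1 x.2.1 x.2.2) := by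
  unfold QB
  refine sre_ex _ (sre_and _ _ (Z.sre_RY' r _ _ (by fun_prop) (by fun_prop)) (sre_ex _
    (sre_and _ _ (by fun_prop) (sre_and _ _ ?_ (by fun_prop)))))
  apply sre_ball
  · fun_prop
  · exact sre_ex _ (sre_and _ _ (by fun_prop) (Z.sre_QA r _ _ _ (by fun_prop) (by fun_prop)
      (by fun_prop)))

section decode
variable {Z}
variable {i j0 : ℕ} {B Y : ℕ → Bool}

/-- Configurations whose node lies on `B`. -/
def OnB (Z : Ctx) (i j0 : ℕ) (B : ℕ → Bool) (x : Key × ℕ) (k : ℕ) : Prop :=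
  ReflTransGen Z.S.Step (Z.root i, j0) x ∧ x.2 < 2 ^ (x.1.1 + 4) ∧
    ∃ l w, At x (pre Z.A l) (pre B k) w

theorem onB_RY
    (hY : ∀ l k w, Z.S.N (pre Z.A l) (pre B k) w → w = pre Y w.length)
    {x : Key × ℕ} {k : ℕ} (h : OnB Z i j0 B x k) :
    ∃ n, ReflTransGen (Z.StepY (pre Y n)) (Z.root i, j0) x := by
  obtain ⟨h1, hj, l, w, hA⟩ := h
  induction h1 generalizing k w with
  | refl => exact ⟨0, .refl⟩
  | @tail y x h1 h2 ih =>
    obtain ⟨β', w', h3, h4⟩ := hA.back h2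
    have hy2 : y.2 < 2 ^ (y.1.1 + 4) := Dsel_lt h2.1
    obtain ⟨e4, _⟩ := (prefix_pre_iff ..).1 h4
    rw [e4] at h3
    obtain ⟨n, hn⟩ := ih hy2 w' h3
    have hN := (hA.spec (Z.inv_reach (h1.tail h2)) hj).1
    have hw := hY _ _ _ hN
    refine ⟨max n w.length, (Z.RY_mono (pre_pfx Y (le_max_left _ _)) hn).tail ⟨h2, ?_⟩⟩
    obtain ⟨e, g1, g2, g3, g4⟩ := hA
    refine ⟨e, g1, _, g4, ?_⟩
    show w <+: _
    rw [hw]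
    exact pre_pfx Y (by simp)

theorem exists_onB
    (hB : ∀ n, ∃ k ≥ n, ∃ l, Z.TT i j0 (pre Z.A l) (pre B k))
    (n : ℕ) : ∃ x k, n ≤ k ∧ OnB Z i j0 B x k := by
  obtain ⟨k, hk, l, x, D, w, h1, h2, _, h4⟩ := hB n
  exact ⟨x, k, hk, h1, Dsel_lt h2, l, w, h4⟩

theorem OnB.unique {x : Key × ℕ} {k k' : ℕ} (h : OnB Z i j0 B x k) (h' : OnB Z i j0 B x k') :
    k = k' := by
  obtain ⟨h1, _, l, w, h3⟩ := h
  obtain ⟨_, _, l', w', h3'⟩ := h'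
  have := (h3.mono (pre_pfx Z.A (le_max_left l l'))).unique (Z.inv_reach h1)
    (h3'.mono (pre_pfx Z.A (le_max_right l l')))
  simpa using congrArg List.length this.1

theorem OnB.back {x y : Key × ℕ} (hx : ReflTransGen Z.S.Step (Z.root i, j0) x)
    (hj : x.2 < 2 ^ (x.1.1 + 4)) (h : ReflTransGen Z.S.Step x y) {k : ℕ}
    (hy : OnB Z i j0 B y k) : ∃ k' ≤ k, OnB Z i j0 B x k' := by
  obtain ⟨_, _, l, w, h3⟩ := hy
  obtain ⟨β', w', h4, h5⟩ := h3.back_rtg h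
  obtain ⟨e, e'⟩ := (prefix_pre_iff ..).1 h5
  exact ⟨β'.length, e', hx, hj, l, w', e ▸ h4⟩

theorem onB_total
    (hY : ∀ l k w, Z.S.N (pre Z.A l) (pre B k) w → w = pre Y w.length)
    {x y : Key × ℕ} {n k : ℕ}
    (hx : ReflTransGen (Z.StepY (pre Y n)) (Z.root i, j0) x) (hy : OnB Z i j0 B y k) :
    ReflTransGen Z.S.Step x y ∨ ReflTransGen Z.S.Step y x := by
  obtain ⟨m, hm⟩ := onB_RY hY hy
  rcases ReflTransGen.total_of_right_unique (StepY.unique (pre Y (max n m)))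
    (Z.RY_mono (pre_pfx Y (le_max_left _ _)) hx)
    (Z.RY_mono (pre_pfx Y (le_max_right _ _)) hm) with h | h
  · exact Or.inl (Z.RY_step h)
  · exact Or.inr (Z.RY_step h)

theorem level_unbounded
    (hB : ∀ n, ∃ k ≥ n, ∃ l, Z.TT i j0 (pre Z.A l) (pre B k))
    (hY : ∀ l k w, Z.S.N (pre Z.A l) (pre B k) w → w = pre Y w.length)
    (n : ℕ) : ∃ x k, OnB Z i j0 B x k ∧ n ≤ x.1.2.1 := by
  induction n with
  | zero =>
    obtain ⟨x, k, _, h⟩ := exists_onB hB 0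
    exact ⟨x, k, h, Nat.zero_le _⟩
  | succ n ih =>
    obtain ⟨x, k, h1, h2⟩ := ih
    obtain ⟨y, k', hk, h3⟩ := exists_onB hB (k + 1)
    refine ⟨y, k', h3, ?_⟩
    obtain ⟨m, hm⟩ := onB_RY hY h1
    rcases onB_total hY hm h3 with h | h
    · have := level_rtg h
      rcases Nat.lt_or_ge n y.1.2.1 with hl | hl
      · exact hl
      · have := this.2 (by omega)
        subst this
        have := h1.unique h3
        omega
    · obtain ⟨k2, h5, h6⟩ := OnB.back h3.1 h3.2.1 h h1
      have := h6.unique h3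
      omega

theorem exists_level {r x : Key × ℕ} (h : ReflTransGen Z.S.Step r x) (hx : x.2 < 2 ^ (x.1.1 + 4))
    {n : ℕ} (h1 : r.1.2.1 ≤ n) (h2 : n ≤ x.1.2.1) :
    ∃ y, ReflTransGen Z.S.Step r y ∧ ReflTransGen Z.S.Step y x ∧ y.1.2.1 = n ∧
      y.2 < 2 ^ (y.1.1 + 4) := by
  induction h with
  | refl => exact ⟨r, .refl, .refl, by omega, hx⟩
  | @tail y x h3 h4 ih =>
    rcases Nat.lt_or_ge y.1.2.1 n with hl | hl
    · have := h4.2.2.2.1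
      exact ⟨x, h3.tail h4, .refl, by omega, hx⟩
    · obtain ⟨z, z1, z2, z3, z4⟩ := ih (Dsel_lt h4.1) hl
      exact ⟨z, z1, z2.tail h4, z3, z4⟩

theorem exact_level
    (hB : ∀ n, ∃ k ≥ n, ∃ l, Z.TT i j0 (pre Z.A l) (pre B k))
    (hY : ∀ l k w, Z.S.N (pre Z.A l) (pre B k) w → w = pre Y w.length)
    (n : ℕ) : ∃ x k, OnB Z i j0 B x k ∧ x.1.2.1 = n := by
  obtain ⟨x, k, h1, h2⟩ := level_unbounded hB hY n
  obtain ⟨y, y1, y2, y3, y4⟩ := exists_level h1.1 h1.2.1 (Nat.zero_le n) h2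
  obtain ⟨k', _, h⟩ := OnB.back y1 y4 y2 h1
  exact ⟨y, k', h, y3⟩

theorem OnB.bit {x : Key × ℕ} {k : ℕ} (h : OnB Z i j0 B x k) :
    Z.A x.1.2.1 = decide (x.1.2.2.1 % 2 = 1) := by
  obtain ⟨_, _, l, w, e, h1, h2, h3, _⟩ := h
  have := pfx_get h2 h3
  rw [pre_getElem?] at this
  split_ifs at this
  exact Option.some.inj this

theorem QA_correct
    (hB : ∀ n, ∃ k ≥ n, ∃ l, Z.TT i j0 (pre Z.A l) (pre B k))
    (hY : ∀ l k w, Z.S.N (pre Z.A l) (pre B k) w → w = pre Y w.length)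
    {m n : ℕ} {b : Bool} (h : Z.QA (Z.root i, j0) (pre Y m) n b) : b = Z.A n := by
  obtain ⟨x, h1, h2, h3⟩ := h
  obtain ⟨y, k, h4, h5⟩ := exact_level hB hY n
  have : x = y := by
    rcases onB_total hY h1 h4 with h | h
    · exact (level_rtg h).2 (by omega)
    · exact ((level_rtg h).2 (by omega)).symm
  subst this
  rw [h3, ← h4.bit, h2]

theorem QA_exists
    (hB : ∀ n, ∃ k ≥ n, ∃ l, Z.TT i j0 (pre Z.A l) (pre B k))
    (hY : ∀ l k w, Z.S.N (pre Z.A l) (pre B k) w → w = pre Y w.length)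
    (n : ℕ) : ∃ m, Z.QA (Z.root i, j0) (pre Y m) n (Z.A n) := by
  obtain ⟨y, k, h4, h5⟩ := exact_level hB hY n
  obtain ⟨m, hm⟩ := onB_RY hY h4
  exact ⟨m, y, hm, h5, by rw [← h4.bit, h5]⟩

theorem QA_mono {r : Key × ℕ} {u v : List Bool} (h : u <+: v) {n : ℕ} {b : Bool}
    (hq : Z.QA r u n b) : Z.QA r v n b := by
  obtain ⟨x, h1, h2⟩ := hq
  exact ⟨x, Z.RY_mono h h1, h2⟩

theorem QA_all
    (hB : ∀ n, ∃ k ≥ n, ∃ l, Z.TT i j0 (pre Z.A l) (pre B k))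
    (hY : ∀ l k w, Z.S.N (pre Z.A l) (pre B k) w → w = pre Y w.length)
    (L : ℕ) : ∃ m, ∀ n < L, Z.QA (Z.root i, j0) (pre Y m) n (Z.A n) := by
  induction L with
  | zero => exact ⟨0, fun n hn => absurd hn (by omega)⟩
  | succ L ih =>
    obtain ⟨m, hm⟩ := ih
    obtain ⟨m', hm'⟩ := QA_exists hB hY L
    refine ⟨max m m', fun n hn => ?_⟩
    rcases Nat.lt_succ_iff_lt_or_eq.1 hn with h | rfl
    · exact QA_mono (pre_pfx Y (le_max_left _ _)) (hm n h)
    · exact QA_mono (pre_pfx Y (le_max_right _ _)) hm'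

theorem decode_A
    (hB : ∀ n, ∃ k ≥ n, ∃ l, Z.TT i j0 (pre Z.A l) (pre B k))
    (hY : ∀ l k w, Z.S.N (pre Z.A l) (pre B k) w → w = pre Y w.length) : TRed Z.A Y :=
  tred_of_sre (Q := Z.QA (Z.root i, j0)) (Z.sre_QA _ _ _ _ (by fun_prop) (by fun_prop) (by fun_prop))
    (QA_exists hB hY) (fun _ _ _ h => QA_correct hB hY h)

theorem decode_B
    (hB : ∀ n, ∃ k ≥ n, ∃ l, Z.TT i j0 (pre Z.A l) (pre B k))
    (hY : ∀ l k w, Z.S.N (pre Z.A l) (pre B k) w → w = pre Y w.length) : TRed B Y := by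
  refine tred_of_sre (Q := Z.QB (Z.root i, j0)) (Z.sre_QB _) ?_ ?_
  · intro n
    obtain ⟨x, k, hk, h⟩ := exists_onB hB (n + 1)
    obtain ⟨m, hm⟩ := onB_RY hY h
    obtain ⟨_, _, l, w, e, h1, h2, h3, h4⟩ := h
    obtain ⟨m', hm'⟩ := QA_all hB hY e.1.length
    refine ⟨max m m', x, Z.RY_mono (pre_pfx Y (le_max_left _ _)) hm, e, h1, ?_, _, h4, ?_⟩
    · intro a ha
      rw [List.mem_range] at ha
      refine ⟨Z.A a, ?_, QA_mono (pre_pfx Y (le_max_right _ _)) (hm' a ha)⟩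
      have h5 := pfx_get h2 (List.getElem?_eq_getElem ha)
      rw [List.getElem?_eq_getElem ha, ← h5, pre_getElem?_of_lt]
      have := h2.length_le
      simp at this; omega
    · exact pre_getElem?_of_lt _ (by omega)
  · rintro m n b ⟨x, h1, e, h2, h3, p, h4, h5⟩
    obtain ⟨y, k, hy, hl⟩ := level_unbounded hB hY (x.1.2.1 + 1)
    have hxy : ReflTransGen Z.S.Step x y := by
      rcases onB_total hY h1 hy with h | h
      · exact h
      · have := (level_rtg h).1; omega
    obtain ⟨_, _, l, w, hA⟩ := hy
    obtain ⟨β, v, ⟨e', g1, g2, g3, g4⟩, g5⟩ := hA.back_rtg hxy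
    have heA : e.1 = pre Z.A e.1.length := by
      rw [pre_eq_iff]
      intro a b' hab
      have ha : a < e.1.length := by
        by_contra hc
        rw [List.getElem?_eq_none (by omega)] at hab; cases hab
      obtain ⟨b2, q1, q2⟩ := h3 a (by simpa using ha)
      rw [hab] at q1; cases q1
      exact QA_correct hB hY q2
    have hI := Z.inv_reach (Z.RY_step h1)
    have hee : e = e' := by
      have k1 : e.1 <+: pre Z.A (max e.1.length l) := by
        have := pre_pfx Z.A (le_max_left e.1.length l)
        rwa [← heA] at this
      have k2 := g2.trans (pre_pfx Z.A (le_max_right e.1.length l))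
      rcases prefix_comparable k1 k2 with hp | hp
      · exact hI.anti e h2 e' g1 hp
      · exact (hI.anti e' g1 e h2 hp).symm
    subst hee
    rw [h4] at g4
    cases g4
    have := pfx_get g5 h5
    rw [pre_getElem?] at this
    split_ifs at this
    exact (Option.some.inj this).symm

end decode

end Ctx
end TypicalDegree

namespace TypicalDegree
open Relation

/-- The base built from a tree predicate and a code. -/
def mkBase (T : List Bool → List Bool → Prop) (c phi : OracleCode) (b0 : List Bool)
    (hs : SRE (fun x : List Bool × List Bool => T x.1 x.2))
    (hm : ∀ α α' β, T α β → α <+: α' → T α' β) : Base where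
  T := T
  N := fun α β w => T α β ∧ Comp c (joinStr α β) w
  b0 := b0
  phi := phi
  T_sre := hs
  N_sre := by
    have hj : Primrec (fun x : List Bool × List Bool × List Bool => joinStr x.1 x.2.1) :=
      prim_joinStr.comp (f := fun x : List Bool × List Bool => joinStr x.1 x.2)
        (g := fun x : List Bool × List Bool × List Bool => (x.1, x.2.1)) (by fun_prop)
    exact sre_and _ _ (sre_comp _ (fun x : List Bool × List Bool × List Bool => (x.1, x.2.1)) hs
      (by fun_prop)) (sre_comp _ (fun x : List Bool × List Bool × List Bool =>
        (joinStr x.1 x.2.1, x.2.2)) (sre_Comp c) (by fun_prop))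
  T_mono := hm
  N_T := fun _ _ _ h => h.1
  N_mono := fun _ _ _ _ h hα => ⟨hm _ _ _ h.1 hα, h.2.mono (joinStr_mono hα List.prefix_rfl)⟩
  N_ext := fun _ _ _ _ h hβ hT => ⟨hT, h.2.mono (joinStr_mono List.prefix_rfl hβ)⟩
  N_down := fun _ _ _ _ h hw => ⟨h.1, h.2.down hw⟩
  N_cons := fun _ _ _ _ h h' => h.2.consistent h'.2
  N_nil := fun _ _ h => ⟨h, fun i hi => by simp at hi⟩

/-- Trees that are perfect relative to `A`. -/
structure GoodT (A : ℕ → Bool) (T : List Bool → List Bool → Prop) : Prop where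
  sre : SRE (fun x : List Bool × List Bool => T x.1 x.2)
  mono : ∀ α α' β, T α β → α <+: α' → T α' β
  perf : ∀ l β, T (pre A l) β → ∃ l' β' β'', β <+: β' ∧ β <+: β'' ∧ Inc β' β'' ∧
    T (pre A l') β' ∧ T (pre A l') β''

/-- `B` is a path. -/
def PathT (A : ℕ → Bool) (T : List Bool → List Bool → Prop) (B : ℕ → Bool) : Prop :=
  ∀ n, ∃ k ≥ n, ∃ l, T (pre A l) (pre B k)

theorem step_nosplit {A : ℕ → Bool} {T : List Bool → List Bool → Prop} (hT : GoodT A T)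
    {c phi : OracleCode} {b0 β1 : List Bool}
    (hn : ∀ l, ¬ (mkBase T c phi b0 hT.sre hT.mono).Spl (pre A l) β1) {B Y : ℕ → Bool}
    (hB : PathT A (fun α β => T α β ∧ β1 <+: β) B) (hY : c.eval (chi (join A B)) = chi Y) :
    TRed Y A := by
  have key : ∀ n m, ∃ L ≥ m, ∃ K, β1 <+: pre B K ∧ T (pre A L) (pre B K) ∧
      Comp c (joinStr (pre A L) (pre B K)) (pre Y (n + 1)) := by
    intro n m
    obtain ⟨k, hk⟩ := exists_Comp hY (n + 1)
    obtain ⟨K, hK, l, h1, h2⟩ := hB k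
    obtain ⟨L, g1, g2, g3⟩ : ∃ L, l ≤ L ∧ K ≤ L ∧ m ≤ L :=
      ⟨max l (max K m), by simp, by simp, by simp⟩
    refine ⟨L, g3, K, h2, hT.mono _ _ _ h1 (pre_pfx A g1), ?_⟩
    rw [joinStr_pre]
    exact hk.mono (pre_pfx _ (by rw [min_eq_right g2]; omega))
  have hj : Primrec (fun x : ((List Bool × ℕ × Bool) × List Bool) × List Bool =>
      joinStr x.1.1.1 x.1.2) :=
    prim_joinStr.comp (f := fun x : List Bool × List Bool => joinStr x.1 x.2)
      (g := fun x : ((List Bool × ℕ × Bool) × List Bool) × List Bool => (x.1.1.1, x.1.2))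
      (by fun_prop)
  refine tred_of_sre (Q := fun α n b => ∃ β w, β1 <+: β ∧ T α β ∧ Comp c (joinStr α β) w ∧
    w[n]? = some b) ?_ ?_ ?_
  · refine sre_ex _ (sre_ex _ (sre_and _ _ (sre_of_pp _ (by fun_prop)) (sre_and _ _ ?_
      (sre_and _ _ ?_ (sre_of_pp _ (by fun_prop))))))
    · exact sre_comp _ (fun x : ((List Bool × ℕ × Bool) × List Bool) × List Bool =>
        (x.1.1.1, x.1.2)) hT.sre (by fun_prop)
    · exact sre_comp _ (fun x : ((List Bool × ℕ × Bool) × List Bool) × List Bool =>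
        (joinStr x.1.1.1 x.1.2, x.2)) (sre_Comp c) (by fun_prop)
  · intro n
    obtain ⟨L, -, K, h1, h2, h3⟩ := key n 0
    exact ⟨L, _, _, h1, h2, h3, pre_getElem?_of_lt Y (by omega)⟩
  · rintro k n b ⟨β, w, h1, h2, h3, h4⟩
    obtain ⟨L, hL, K, g1, g2, g3⟩ := key n k
    by_contra hb
    have hp := pre_pfx A hL
    have hy : (pre Y (n + 1))[n]? = some (Y n) := pre_getElem?_of_lt Y (by omega)
    refine hn L ⟨β, pre B K, w, pre Y (n + 1), h1, g1,
      ⟨hT.mono _ _ _ h2 hp, h3.mono (joinStr_mono hp List.prefix_rfl)⟩, ⟨g2, g3⟩, ?_, ?_⟩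
    · intro h
      have := pfx_get h h4
      rw [hy] at this
      exact hb (Option.some.inj this).symm
    · intro h
      have := pfx_get h hy
      rw [h4] at this
      exact hb (Option.some.inj this)

theorem step_lemma {A R : ℕ → Bool} (hR : TwoRandom R) (hAR : TRed A R)
    {T : List Bool → List Bool → Prop} (hT : GoodT A T) {l : ℕ} {β0 : List Bool}
    (h0 : T (pre A l) β0) (c : OracleCode) :
    ∃ T', GoodT A T' ∧ (∃ l β, T' (pre A l) β) ∧
      (∀ l β, T' (pre A l) β → T (pre A l) β ∧ β0 <+: β) ∧
      ∀ B Y, PathT A T' B → c.eval (chi (join A B)) = chi Y → TRed Y A ∨ TRed (join A B) Y := by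
  obtain ⟨phi, hphi⟩ := hAR
  let S := mkBase T c phi β0 hT.sre hT.mono
  by_cases hs : S.SplX A
  · let Z : Ctx := { S := S, A := A, R := R, l0 := l + 1, l0_pos := by omega,
                     T0 := hT.mono _ _ _ h0 (pre_pfx A (by omega)), heval := hphi, spl := hs }
    obtain ⟨i, hi⟩ := hR _ Z.VV_test
    obtain ⟨j0, hj⟩ := Z.exists_root_live (i := i) hi
    refine ⟨Z.TT i j0, ⟨Z.sre_TT i j0, fun α α' β h hp => Z.TT_mono h hp,
      fun l β h => Z.TT_good hi h⟩, ?_, fun l β h => Z.TT_spec h, ?_⟩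
    · obtain ⟨l, β, w, -, h⟩ := hj.node
      exact ⟨l, β, h⟩
    · intro B Y hB hY
      have hN : ∀ l k w, Z.S.N (pre Z.A l) (pre B k) w → w = pre Y w.length := by
        rintro l k w ⟨-, h⟩
        have h' : Comp c (joinStr (pre A l) (pre B k)) w := h
        rw [joinStr_pre] at h'
        exact Comp.prefix_of_eval hY h'
      exact Or.inr (tred_join (Ctx.decode_A hB hN) (Ctx.decode_B hB hN))
  · have : ∃ l β, β0 <+: β ∧ T (pre A l) β ∧ ∀ l', ¬ S.Spl (pre A l') β := by
      by_contra hcon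
      apply hs
      intro l β h1 h2
      by_contra h3
      exact hcon ⟨l, β, h1, h2, fun l' h => h3 ⟨l', h⟩⟩
    obtain ⟨l1, β1, h1, h2, h3⟩ := this
    refine ⟨fun α β => T α β ∧ β1 <+: β, ⟨?_, fun _ _ _ h hp => ⟨hT.mono _ _ _ h.1 hp, h.2⟩, ?_⟩,
      ⟨l1, β1, h2, List.prefix_rfl⟩, fun l β h => ⟨h.1, h1.trans h.2⟩, ?_⟩
    · exact sre_and _ _ hT.sre (sre_of_pp _ (by fun_prop))
    · rintro l β ⟨g1, g2⟩
      obtain ⟨l', β', β'', k1, k2, k3, k4, k5⟩ := hT.perf l β g1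
      exact ⟨l', β', β'', k1, k2, k3, ⟨k4, g2.trans k1⟩, ⟨k5, g2.trans k2⟩⟩
    · intro B Y hB hY
      exact Or.inl (step_nosplit hT h3 hB hY)

/-- A stage of the construction. -/
structure Stage (A : ℕ → Bool) where
  T : List Bool → List Bool → Prop
  good : GoodT A T
  stem : List Bool
  lev : ℕ
  mem : T (pre A lev) stem

theorem GoodT.longer {A : ℕ → Bool} {T : List Bool → List Bool → Prop} (hT : GoodT A T) {l : ℕ}
    {β : List Bool} (h : T (pre A l) β) (E : ℕ → Bool) : ∃ l' β', T (pre A l') β' ∧ β <+: β' ∧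
      β.length < β'.length ∧ β' ≠ pre E β'.length := by
  obtain ⟨l', β', β'', k1, k2, k3, k4, k5⟩ := hT.perf l β h
  have key : ∀ γ γ' : List Bool, β <+: γ → β <+: γ' → Inc γ γ' → β.length < γ.length := by
    intro γ γ' g1 g2 g3
    refine lt_of_le_of_ne g1.length_le fun h => g3.1 ?_
    rw [← g1.eq_of_length h]; exact g2
  by_cases he : β' = pre E β'.length
  · refine ⟨l', β'', k5, k2, key _ _ k2 k1 k3.symm, fun he' => ?_⟩
    rcases le_total β'.length β''.length with hl | hl
    · exact k3.1 (by rw [he, he']; exact pre_pfx E hl)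
    · exact k3.2 (by rw [he, he']; exact pre_pfx E hl)
  · exact ⟨l', β', k4, k1, key _ _ k1 k2 k3, he⟩

theorem exists_next {A R : ℕ → Bool} (hR : TwoRandom R) (hAR : TRed A R) (c : OracleCode)
    (s : Stage A) : ∃ t : Stage A, s.stem <+: t.stem ∧ s.stem.length < t.stem.length ∧
      (∀ l β, t.T (pre A l) β → s.T (pre A l) β) ∧
      (∀ E, c.eval (chi A) = chi E → t.stem ≠ pre E t.stem.length) ∧
      ∀ B Y, PathT A t.T B → c.eval (chi (join A B)) = chi Y → TRed Y A ∨ TRed (join A B) Y := by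
  have h1 : ∃ l' β', s.T (pre A l') β' ∧ s.stem <+: β' ∧ s.stem.length < β'.length ∧
      ∀ E, c.eval (chi A) = chi E → β' ≠ pre E β'.length := by
    by_cases hE : ∃ E, c.eval (chi A) = chi E
    · obtain ⟨E, hE⟩ := hE
      obtain ⟨l', β', g1, g2, g3, g4⟩ := s.good.longer s.mem E
      refine ⟨l', β', g1, g2, g3, fun E' hE' => ?_⟩
      have : E = E' := by
        funext n
        have h : (cond (E n) 1 0 : ℕ) ∈ chi E' n := by
          rw [← hE', hE, mem_chi]
        rw [mem_chi] at h
        exact cond_inj h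
      exact this ▸ g4
    · obtain ⟨l', β', g1, g2, g3, -⟩ := s.good.longer s.mem A
      exact ⟨l', β', g1, g2, g3, fun E h => absurd ⟨E, h⟩ hE⟩
  obtain ⟨l', β', g1, g2, g3, g4⟩ := h1
  obtain ⟨T', k1, ⟨l, β, k2⟩, k3, k4⟩ := step_lemma hR hAR s.good g1 c
  have hp := (k3 l β k2).2
  refine ⟨⟨T', k1, β, l, k2⟩, g2.trans hp, lt_of_lt_of_le g3 hp.length_le,
    fun l β h => (k3 l β h).1, fun E hE he => g4 E hE ?_, k4⟩
  have he : β = pre E β.length := he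
  rw [he, prefix_pre_iff] at hp
  exact hp.1

/-- The initial stage. -/
def stage0 (A : ℕ → Bool) : Stage A where
  T := fun _ _ => True
  good := ⟨sre_of_pp _ (by fun_prop), fun _ _ _ _ _ => trivial, fun l β _ =>
    ⟨0, β ++ [true], β ++ [false], by simp, by simp, by constructor <;> simp, trivial, trivial⟩⟩
  stem := []
  lev := 0
  mem := trivial

theorem exists_cover {A R : ℕ → Bool} (hR : TwoRandom R) (hAR : TRed A R) :
    ∃ C : ℕ → Bool, (TRed A C ∧ ¬ TRed C A) ∧
      ∀ X : ℕ → Bool, TRed X C → ¬ TRed C X → TRed X A := by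
  obtain ⟨C, hC⟩ := exists_enum_codes
  choose nx n1 n2 n3 n4 n5 using fun c => exists_next (c := c) hR hAR
  let st : ℕ → Stage A := fun n => Nat.rec (stage0 A) (fun e s => nx (C e) s) n
  have hst : ∀ e, st (e + 1) = nx (C e) (st e) := fun e => rfl
  have hlen : ∀ e, e ≤ (st e).stem.length := by
    intro e
    induction e with
    | zero => exact Nat.zero_le _
    | succ e ih => rw [hst]; have := n2 (C e) (st e); omega
  have hmono : ∀ d e, d ≤ e → (st d).stem <+: (st e).stem ∧
      ∀ l β, (st e).T (pre A l) β → (st d).T (pre A l) β := by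
    intro d e h
    induction e, h using Nat.le_induction with
    | base => exact ⟨List.prefix_rfl, fun _ _ h => h⟩
    | succ e _ ih =>
      rw [hst]
      exact ⟨ih.1.trans (n1 _ _), fun l β h => ih.2 l β (n3 _ _ l β h)⟩
  let B : ℕ → Bool := fun n => ((st (n + 1)).stem[n]?).getD false
  have hB : ∀ e, (st e).stem = pre B (st e).stem.length := by
    intro e
    rw [pre_eq_iff]
    intro i b hb
    have hi : i < (st (i + 1)).stem.length := lt_of_lt_of_le (Nat.lt_succ_self i) (hlen (i + 1))
    have hi' := List.getElem?_eq_getElem hi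
    show b = ((st (i + 1)).stem[i]?).getD false
    rw [hi']
    rcases le_total e (i + 1) with h | h
    · have := pfx_get (hmono _ _ h).1 hb
      rw [hi'] at this
      exact (Option.some.inj this).symm
    · have := pfx_get (hmono _ _ h).1 hi'
      rw [hb] at this
      exact Option.some.inj this
  have hpath : ∀ e, PathT A (st e).T B := by
    intro e n
    refine ⟨(st (max e n)).stem.length, le_trans (le_max_right e n) (hlen _), (st (max e n)).lev, ?_⟩
    rw [← hB]
    exact (hmono _ _ (le_max_left e n)).2 _ _ (st (max e n)).mem
  refine ⟨join A B, ⟨tred_join_left A B, fun h => ?_⟩, fun X hX hn => ?_⟩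
  · obtain ⟨c, hc⟩ := (tred_join_right A B).trans h
    obtain ⟨e, rfl⟩ := hC c
    exact n4 (C e) (st e) B hc (hB (e + 1))
  · obtain ⟨c, hc⟩ := hX
    obtain ⟨e, rfl⟩ := hC c
    rcases n5 (C e) (st e) B X (hpath (e + 1)) hc with h | h
    · exact h
    · exact absurd h hn

end TypicalDegree

namespace TypicalDegree

/-- every Turing degree bounded by a 2-random degree has a strong
minimal cover; hence no such degree has the cupping property. -/
theorem strong_minimal_cover_below_twoRandom (A R : ℕ → Bool)
    (hR : TwoRandom R) (hAR : TRed A R) :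
    (∃ C : ℕ → Bool, (TRed A C ∧ ¬ TRed C A) ∧
        ∀ X : ℕ → Bool, TRed X C → ¬ TRed C X → TRed X A) ∧
      ¬ (∀ C : ℕ → Bool, TRed A C → ¬ TRed C A →
          ∃ B : ℕ → Bool, (TRed B C ∧ ¬ TRed C B) ∧ TEquiv (join A B) C) := by
  obtain ⟨C, ⟨h1, h2⟩, h3⟩ := exists_cover hR hAR
  refine ⟨⟨C, ⟨h1, h2⟩, h3⟩, fun h => ?_⟩
  obtain ⟨B, ⟨k1, k2⟩, k3⟩ := h C h1 h2
  exact h2 (k3.2.trans (tred_join (tred_refl A) (h3 B k1 k2)))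

end TypicalDegree
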